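/- arXiv:math/9908003 — 2 statements merged into one kernel-verified Lean document; each statement's English description precedes it below -/
import Mathlib

section
/- Every uniformly recurrent packing of unit closed disks in the Euclidean plane ℝ² whose density equals the circle packing density π/√12 is congruent to the hexagonal packing, i.e. the packing whose disk centers form a triangular lattice with minimal distance 2. -/
open MeasureTheory Metric Filter Pointwise
open scoped ENNReal NNReal

noncomputable section

abbrev Euc (d : ℕ) : Type := EuclideanSpace ℝ (Fin d)

/-- A body: a compact domain (compact set equal to the closure of its interior). -/
def IsBody {d : ℕ} (K : Set (Euc d)) : Prop :=
  IsCompact K ∧ K = closure (interior K)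

/-- `D` is an isometric copy of `K`. -/
def IsIsomCopy {d : ℕ} (K D : Set (Euc d)) : Prop :=
  ∃ f : Euc d ≃ᵢ Euc d, D = f '' K

def PairwiseDisjointInteriors {d : ℕ} (P : Set (Set (Euc d))) : Prop :=
  P.Pairwise fun D E => interior D ∩ interior E = ∅

/-- A packing of the body `K`: a collection of isometric copies of `K`
with pairwise disjoint interiors. -/
def IsPacking {d : ℕ} (K : Set (Euc d)) (P : Set (Set (Euc d))) : Prop :=
  (∀ D ∈ P, IsIsomCopy K D) ∧ PairwiseDisjointInteriors P

/-- Translate every element of a collection by the vector `v`. -/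
def translatePacking {d : ℕ} (v : Euc d) (P : Set (Set (Euc d))) : Set (Set (Euc d)) :=
  (fun D => (fun x => x + v) '' D) '' P

/-- The fraction of the ball `B(p,r)` covered by the collection `P`
(the sum over elements of `P` of the volume of the intersection, divided
by the volume of the ball). -/
def ballFrac {d : ℕ} (P : Set (Set (Euc d))) (p : Euc d) (r : ℝ) : ℝ :=
  ((∑' D : P, volume ((D : Set (Euc d)) ∩ ball p r)) / volume (ball p r)).toReal

/-- `P` has density `δ`. -/
def HasDensity {d : ℕ} (P : Set (Set (Euc d))) (δ : ℝ) : Prop :=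
  ∀ p : Euc d, Tendsto (fun r => ballFrac P p r) atTop (nhds δ)

/-- `P` has density `δ` uniformly in the center point. -/
def HasUniformDensity {d : ℕ} (P : Set (Set (Euc d))) (δ : ℝ) : Prop :=
  TendstoUniformly (fun r (p : Euc d) => ballFrac P p r) (fun _ => δ) atTop

/-- The packing density of the body `K`. -/
def packingDensity {d : ℕ} (K : Set (Euc d)) : ℝ :=
  sSup {δ : ℝ | ∃ P, IsPacking K P ∧ HasDensity P δ}

/-- Modified Hausdorff distance at most `ε` between two collections: there is a
relation between elements, related elements are at Hausdorff distance at most `ε`,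
and every element meeting the ball `B(0,1/ε)` is related to a unique element on
the other side. -/
def PackingClose {d : ℕ} (ε : ℝ) (P Q : Set (Set (Euc d))) : Prop :=
  ∃ R : Set (Euc d) → Set (Euc d) → Prop,
    (∀ A B, R A B → A ∈ P ∧ B ∈ Q ∧ Metric.hausdorffDist A B ≤ ε) ∧
    (∀ A ∈ P, (A ∩ ball (0 : Euc d) (1 / ε)).Nonempty → ∃! B, R A B) ∧
    (∀ B ∈ Q, (B ∩ ball (0 : Euc d) (1 / ε)).Nonempty → ∃! A, R A B)

/-- Convergence of a sequence of collections to `Q` in the modified Hausdorff topology. -/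
def PackingTendsto {d : ℕ} (Ps : ℕ → Set (Set (Euc d))) (Q : Set (Set (Euc d))) : Prop :=
  ∀ ε : ℝ, 0 < ε → ∀ᶠ n in atTop, PackingClose ε (Ps n) Q

/-- `A ≽_L B` : some sequence of translates of `B` converges to `A`. -/
def IsLimitOf {d : ℕ} (A B : Set (Set (Euc d))) : Prop :=
  ∃ v : ℕ → Euc d, PackingTendsto (fun n => translatePacking (v n) B) A

/-- A packing of `K` is uniformly recurrent if it is maximal with respect to `≽_L`
among packings of `K`. -/
def UniformlyRecurrent {d : ℕ} (K : Set (Euc d)) (A : Set (Set (Euc d))) : Prop :=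
  ∀ B, IsPacking K B → IsLimitOf B A → IsLimitOf A B

/-- `P` is `n`-saturated: one cannot remove `n-1` of its elements and replace them
by `n` isometric copies of `K` so that the result is still a packing. -/
def Saturated {d : ℕ} (K : Set (Euc d)) (n : ℕ) (P : Set (Set (Euc d))) : Prop :=
  ¬ ∃ F G : Finset (Set (Euc d)), ↑F ⊆ P ∧ F.card = n - 1 ∧ G.card = n ∧
      Disjoint (↑G : Set (Set (Euc d))) (P \ ↑F) ∧
      IsPacking K ((P \ ↑F) ∪ ↑G)

def CompletelySaturated {d : ℕ} (K : Set (Euc d)) (P : Set (Set (Euc d))) : Prop :=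
  ∀ n : ℕ, 1 ≤ n → Saturated K n P

/-- `K` (strictly) self-nests: for every `ε > 0` some isometric copy of `K` lies in
the interior of `(1+ε)K`. -/
def SelfNests {d : ℕ} (K : Set (Euc d)) : Prop :=
  ∀ ε : ℝ, 0 < ε → ∃ f : Euc d ≃ᵢ Euc d, f '' K ⊆ interior ((1 + ε) • K)

/-- A single connected replacement: `A` is obtained from `B` by replacing `k < n`
copies of `K` by `k+1` copies so that the union of the `2k+1` copies involved is
connected. -/
def ConnStep {d : ℕ} (K : Set (Euc d)) (n : ℕ) (B A : Set (Set (Euc d))) : Prop :=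
  ∃ (k : ℕ) (F G : Finset (Set (Euc d))), k < n ∧ ↑F ⊆ B ∧ F.card = k ∧ G.card = k + 1 ∧
    Disjoint (↑G : Set (Set (Euc d))) (B \ ↑F) ∧
    A = (B \ ↑F) ∪ ↑G ∧ IsPacking K A ∧
    IsConnected (⋃ D ∈ (↑F ∪ ↑G : Set (Set (Euc d))), D)

/-- `A ≽_{C,n} B` : `A` is obtained from `B` by finitely many connected replacements. -/
def ConnGE {d : ℕ} (K : Set (Euc d)) (n : ℕ) (A B : Set (Set (Euc d))) : Prop :=
  Relation.ReflTransGen (ConnStep K n) B A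

/-- The density function of the convolution `μ * χ_P` evaluated at the point `p`:
`∑_{D ∈ P} μ {x | p - x ∈ D}`. -/
def diffuse {d : ℕ} (μ : Measure (Euc d)) (P : Set (Set (Euc d))) (p : Euc d) : ℝ≥0∞ :=
  ∑' D : P, μ {x : Euc d | p - x ∈ (D : Set (Euc d))}

/-- The value of the measure `χ_P * μ` on the (Borel) set `R`. -/
def diffuseOn {d : ℕ} (μ : Measure (Euc d)) (P : Set (Set (Euc d))) (R : Set (Euc d)) : ℝ≥0∞ :=
  ∫⁻ p in R, diffuse μ P p

/-- The measure with density `(n/(n+1))^{|x|/(2n-1)}` with respect to Lebesgue measure. -/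
def kupMeasure (d n : ℕ) : Measure (Euc d) :=
  volume.withDensity fun x =>
    ENNReal.ofReal (((n : ℝ) / (n + 1)) ^ (‖x‖ / (2 * (n : ℝ) - 1)))

/-- A generic packing: a collection of bodies with pairwise disjoint interiors. -/
def IsGenPacking {d : ℕ} (P : Set (Set (Euc d))) : Prop :=
  (∀ D ∈ P, IsBody D) ∧ PairwiseDisjointInteriors P

/-- `A ≽_μ B` : `μ * χ_A ≥ μ * χ_B` everywhere. -/
def MuDom {d : ℕ} (μ : Measure (Euc d)) (A B : Set (Set (Euc d))) : Prop :=
  ∀ p : Euc d, diffuse μ B p ≤ diffuse μ A p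

/-- `A ≽_D B` : `A` diffusively dominates `B`. -/
def DiffDom {d : ℕ} (A B : Set (Set (Euc d))) : Prop :=
  ∃ μ : Measure (Euc d), IsFiniteMeasure μ ∧ MuDom μ A B

/-- `P` is weakly recurrent if it is the limit of a sequence of uniformly
recurrent packings of `K`. -/
def WeaklyRecurrent {d : ℕ} (K : Set (Euc d)) (P : Set (Set (Euc d))) : Prop :=
  ∃ Bs : ℕ → Set (Set (Euc d)),
    (∀ i, IsPacking K (Bs i) ∧ UniformlyRecurrent K (Bs i)) ∧ PackingTendsto Bs P


/-- The point `(a, b)` of the Euclidean plane. -/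
def pt2 (a b : ℝ) : Euc 2 := (WithLp.equiv 2 (Fin 2 → ℝ)).symm ![a, b]

/-- A packing of unit closed disks in the plane. -/
def IsDiskPacking (P : Set (Set (Euc 2))) : Prop :=
  (∀ D ∈ P, ∃ c : Euc 2, D = closedBall c 1) ∧ PairwiseDisjointInteriors P

/-- The hexagonal packing: unit disks centered at the points of the triangular
lattice generated by `(2,0)` and `(1,√3)`. -/
def hexPacking : Set (Set (Euc 2)) :=
  {D | ∃ m k : ℤ, D = closedBall ((m : ℝ) • pt2 2 0 + (k : ℝ) • pt2 1 (Real.sqrt 3)) 1}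

/-- Uniform recurrence among packings of unit disks. -/
def UniformlyRecurrentDisk (A : Set (Set (Euc 2))) : Prop :=
  ∀ B, IsDiskPacking B → IsLimitOf B A → IsLimitOf A B

/-- The open circular sector of radius `r` and half-angle `α` around the positive real axis. -/
def openSector (r α : ℝ) : Set ℂ := {z | ‖z‖ < r ∧ ‖z‖ * Real.cos α < z.re}

/-- The circular segment of radius `r` and half-angle `α` around the positive real axis. -/
def circSegment (r α : ℝ) : Set ℂ := {z | ‖z‖ < r ∧ r * Real.cos α ≤ z.re}

lemma measurableSet_openSector (r α : ℝ) : MeasurableSet (openSector r α) := by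
  have h1 : IsOpen (openSector r α) :=
    (isOpen_lt continuous_norm continuous_const).inter
      (isOpen_lt (continuous_norm.mul continuous_const) Complex.continuous_re)
  exact h1.measurableSet

lemma volume_openSector {r α : ℝ} (hr : 0 ≤ r) (h0 : 0 ≤ α) (h1 : α < Real.pi) :
    volume (openSector r α) = ENNReal.ofReal (r ^ 2 * α) := by
  rw [← lintegral_indicator_one (measurableSet_openSector r α),
    ← Complex.lintegral_comp_polarCoord_symm]
  have key : ∀ p ∈ polarCoord.target,
      ENNReal.ofReal p.1 • (openSector r α).indicator (1 : ℂ → ℝ≥0∞) (Complex.polarCoord.symm p)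
        = (Set.Ioo 0 r ×ˢ Set.Ioo (-α) α).indicator (fun p => ENNReal.ofReal p.1) p := by
    rintro ⟨x, θ⟩ hp
    simp only [polarCoord_target, Set.mem_prod, Set.mem_Ioi, Set.mem_Ioo] at hp
    obtain ⟨hx, hθ1, hθ2⟩ := hp
    have hmem : Complex.polarCoord.symm (x, θ) ∈ openSector r α ↔
        (x, θ) ∈ Set.Ioo 0 r ×ˢ Set.Ioo (-α) α := by
      have hnorm : ‖Complex.polarCoord.symm (x, θ)‖ = x := by
        rw [Complex.norm_polarCoord_symm]; exact abs_of_pos hx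
      have hre : (Complex.polarCoord.symm (x, θ)).re = x * Real.cos θ := by
        simp [Complex.polarCoord_symm_apply, Complex.cos_ofReal_re]
      simp only [openSector, Set.mem_ofPred_eq, hnorm, hre, Set.mem_prod, Set.mem_Ioo]
      have hcos : x * Real.cos α < x * Real.cos θ ↔ -α < θ ∧ θ < α := by
        rw [mul_lt_mul_iff_right₀ hx, ← abs_lt, ← Real.cos_abs θ]
        exact Real.strictAntiOn_cos.lt_iff_gt (by constructor <;> linarith)
          ⟨abs_nonneg _, (abs_lt.2 ⟨hθ1, hθ2⟩).le⟩
      rw [hcos]; tauto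
    by_cases h : (x, θ) ∈ Set.Ioo 0 r ×ˢ Set.Ioo (-α) α
    · rw [Set.indicator_of_mem h, Set.indicator_of_mem (hmem.2 h)]; simp
    · rw [Set.indicator_of_notMem h, Set.indicator_of_notMem (mt hmem.1 h)]; simp
  have hsub : Set.Ioo 0 r ×ˢ Set.Ioo (-α) α ⊆ polarCoord.target := by
    rw [polarCoord_target]
    exact Set.prod_mono (fun x hx => hx.1) (Set.Ioo_subset_Ioo (by linarith) h1.le)
  rw [setLIntegral_congr_fun polarCoord.open_target.measurableSet key,
    setLIntegral_indicator (measurableSet_Ioo.prod measurableSet_Ioo),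
    Set.inter_eq_left.2 hsub, Measure.volume_eq_prod, ← Measure.prod_restrict,
    lintegral_prod _ (by fun_prop)]
  simp only [lintegral_const, Measure.restrict_apply MeasurableSet.univ, Set.univ_inter,
    Real.volume_Ioo]
  rw [lintegral_mul_const _ (by fun_prop),
    ← ofReal_integral_eq_lintegral_ofReal, ← integral_Ioc_eq_integral_Ioo,
    ← intervalIntegral.integral_of_le hr, integral_id, ← ENNReal.ofReal_mul' (by linarith)]
  · congr 1; ring
  · exact (continuous_id.integrableOn_Icc (a := 0) (b := r)).mono_set Set.Ioo_subset_Icc_self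
  · exact (ae_restrict_mem measurableSet_Ioo).mono fun x hx => hx.1.le

lemma volume_openSector_diff_circSegment {r α : ℝ} (hr : 0 ≤ r) (h0 : 0 ≤ α)
    (h1 : α < Real.pi / 2) :
    ENNReal.ofReal (r ^ 2 * (Real.sin α * Real.cos α)) ≤
      volume (openSector r α \ circSegment r α) := by
  have hc : 0 < Real.cos α := Real.cos_pos_of_mem_Ioo ⟨by linarith, h1⟩
  have hs : 0 ≤ Real.sin α := Real.sin_nonneg_of_nonneg_of_le_pi h0 (by linarith)
  set t := Real.tan α with ht
  have ht0 : 0 ≤ t := Real.tan_nonneg_of_nonneg_of_le_pi_div_two h0 h1.le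
  have htc : t * Real.cos α = Real.sin α := Real.tan_mul_cos hc.ne'
  set A : Set (ℝ × ℝ) := regionBetween (fun x => -(t * x)) (fun x => t * x)
    (Set.Ioc 0 (r * Real.cos α)) with hA
  have hvol : volume A = ENNReal.ofReal (r ^ 2 * (Real.sin α * Real.cos α)) := by
    rw [hA, Measure.volume_eq_prod, volume_regionBetween_eq_integral]
    · rw [← intervalIntegral.integral_of_le (by positivity)]
      simp only [Pi.sub_apply, sub_neg_eq_add, ← two_mul]
      rw [intervalIntegral.integral_const_mul, intervalIntegral.integral_const_mul, integral_id,
        ← htc]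
      congr 1; ring
    · exact ((continuous_const.mul continuous_id).neg.integrableOn_Icc).mono_set
        Set.Ioc_subset_Icc_self
    · exact ((continuous_const.mul continuous_id).integrableOn_Icc).mono_set
        Set.Ioc_subset_Icc_self
    · exact measurableSet_Ioc
    · intro x hx
      have := mul_nonneg ht0 hx.1.le
      linarith
  rw [← hvol, ← Complex.volume_preserving_equiv_real_prod.measure_preimage_equiv,
    ← measure_sdiff_null (s := Complex.measurableEquivRealProd ⁻¹' A)
      (t := {z : ℂ | z.re = r * Real.cos α})]
  · refine measure_mono ?_
    rintro z ⟨⟨⟨hz1, hz2⟩, hz3, hz4⟩, hz5⟩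
    simp only [Complex.measurableEquivRealProd_apply, Set.mem_ofPred_eq] at hz1 hz2 hz3 hz4 hz5
    have hz2' : z.re < r * Real.cos α := lt_of_le_of_ne hz2 hz5
    have hn : ‖z‖ * Real.cos α < z.re := by
      have h3 : (‖z‖ * Real.cos α) ^ 2 < z.re ^ 2 := by
        rw [mul_pow, Complex.sq_norm, Complex.normSq_apply]
        have h4 : z.im ^ 2 < (t * z.re) ^ 2 := sq_lt_sq' hz3 hz4
        have h5 : (t * Real.cos α) ^ 2 + Real.cos α ^ 2 = 1 := by
          rw [htc]; exact Real.sin_sq_add_cos_sq α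
        nlinarith [pow_pos hc 2]
      exact lt_of_pow_lt_pow_left₀ 2 hz1.le h3
    have hn2 : ‖z‖ < r := lt_of_mul_lt_mul_right (hn.trans hz2') hc.le
    exact ⟨⟨hn2, hn⟩, fun h => absurd h.2 (not_le.2 hz2')⟩
  · have : {z : ℂ | z.re = r * Real.cos α} = Complex.measurableEquivRealProd ⁻¹'
        ({r * Real.cos α} ×ˢ Set.univ) := by
      ext z; simp [Complex.measurableEquivRealProd_apply]
    rw [this, Complex.volume_preserving_equiv_real_prod.measure_preimage_equiv,
      Measure.volume_eq_prod, Measure.prod_prod]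
    simp

lemma circSegment_subset_openSector {r α : ℝ} (hc : 0 < Real.cos α) :
    circSegment r α ⊆ openSector r α :=
  fun _ hz => ⟨hz.1, (mul_lt_mul_of_pos_right hz.1 hc).trans_le hz.2⟩

lemma measurableSet_circSegment (r α : ℝ) : MeasurableSet (circSegment r α) :=
  (isOpen_lt continuous_norm continuous_const).measurableSet.inter
    (isClosed_le continuous_const Complex.continuous_re).measurableSet

lemma volume_circSegment_le {r α : ℝ} (hr : 0 ≤ r) (h0 : 0 ≤ α) (h1 : α < Real.pi / 2) :
    volume (circSegment r α) ≤ ENNReal.ofReal (r ^ 2 * (α - Real.sin α * Real.cos α)) := by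
  have hc : 0 < Real.cos α := Real.cos_pos_of_mem_Ioo ⟨by linarith, h1⟩
  have hs : 0 ≤ Real.sin α := Real.sin_nonneg_of_nonneg_of_le_pi h0 (by linarith)
  have h2 := measure_sdiff_add_inter (μ := volume) (openSector r α) (measurableSet_circSegment r α)
  rw [Set.inter_eq_right.2 (circSegment_subset_openSector hc),
    volume_openSector hr h0 (by linarith [Real.pi_pos])] at h2
  have h3 := volume_openSector_diff_circSegment hr h0 h1
  rw [mul_sub, ENNReal.ofReal_sub _ (by positivity), ← h2]
  refine ENNReal.le_sub_of_add_le_left ENNReal.ofReal_ne_top ?_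
  gcongr

/-- A set of points with mutual distances at least `2`. -/
def TwoSeparated (S : Set ℂ) : Prop := S.Pairwise fun a b => 2 ≤ dist a b

/-- The circumradius of the equilateral triangle with side `2`. -/
def hexCircumradius : ℝ := 2 / √3

local notation "ρ" => hexCircumradius

lemma hexCircumradius_sq : ρ ^ 2 = 4 / 3 := by
  rw [hexCircumradius, div_pow, Real.sq_sqrt (by norm_num)]; norm_num

lemma hexCircumradius_pos : 0 < ρ := by unfold hexCircumradius; positivity

lemma hexCircumradius_lt_two : ρ < 2 := by
  nlinarith [hexCircumradius_sq, hexCircumradius_pos]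

lemma lt_two_mul_hexCircumradius : 9 / 4 < 2 * ρ := by
  nlinarith [hexCircumradius_sq, hexCircumradius_pos]

lemma cos_pi_div_six_eq : Real.cos (Real.pi / 6) = 2 / (2 * ρ) := by
  rw [Real.cos_pi_div_six, hexCircumradius]
  field_simp

/-- The part of the Voronoi cell of `c` at distance less than `2 / √3` from `c`. -/
def truncCell (S : Set ℂ) (c : ℂ) : Set ℂ :=
  {x | dist x c < ρ ∧ ∀ p ∈ S, p ≠ c → dist x c < dist x p}

/-- Half the angle under which the chord cut off by the bisector of `c` and `p` is seen. -/
def chordAngle (c p : ℂ) : ℝ := Real.arccos (dist p c / (2 * ρ))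

/-- The isometry of `ℂ` taking `c` to `0` and `p` to the positive real axis. -/
def alignMap (c p x : ℂ) : ℂ := (x - c) * (starRingEnd ℂ (p - c) / ‖p - c‖)

lemma TwoSeparated.eq_of_dist_lt {S : Set ℂ} (hS : TwoSeparated S) {a b : ℂ} (ha : a ∈ S)
    (hb : b ∈ S) (h : dist a b < 2) : a = b := by
  by_contra hab
  exact absurd (hS ha hb hab) (not_le.2 h)

lemma TwoSeparated.isClosed {S : Set ℂ} (hS : TwoSeparated S) : IsClosed S :=
  isClosed_of_pairwise_le_dist two_pos hS

lemma TwoSeparated.finite_inter_ball {S : Set ℂ} (hS : TwoSeparated S) (c : ℂ) (r : ℝ) :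
    (S ∩ ball c r).Finite := by
  have hd : DiscreteTopology S := by
    refine DiscreteTopology.of_forall_le_dist two_pos fun a b hab => ?_
    exact hS a.2 b.2 (fun h => hab (Subtype.ext h))
  rw [Set.inter_comm]
  exact Metric.finite_isBounded_inter_isClosed ⟨hd⟩ isBounded_ball hS.isClosed

lemma norm_align_factor {c p : ℂ} (h : p ≠ c) : ‖starRingEnd ℂ (p - c) / (‖p - c‖ : ℂ)‖ = 1 := by
  have : ‖p - c‖ ≠ 0 := norm_ne_zero_iff.2 (sub_ne_zero.2 h)
  rw [norm_div, RCLike.norm_conj, Complex.norm_real, norm_norm, div_self this]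

lemma norm_alignMap {c p : ℂ} (h : p ≠ c) (x : ℂ) : ‖alignMap c p x‖ = dist x c := by
  rw [alignMap, norm_mul, norm_align_factor h, mul_one, dist_eq_norm]

lemma re_alignMap (c p x : ℂ) :
    (alignMap c p x).re = inner ℝ (x - c) (p - c) / ‖p - c‖ := by
  rw [alignMap, ← mul_div_assoc, Complex.div_ofReal_re, real_inner_comm, Complex.inner]

lemma measurePreserving_alignMap {c p : ℂ} (h : p ≠ c) : MeasurePreserving (alignMap c p) := by
  let w : Circle := ⟨_, mem_sphere_zero_iff_norm.2 (norm_align_factor h)⟩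
  have h1 : alignMap c p = (fun x => rotation w x) ∘ fun x => x - c := by
    funext x
    rw [Function.comp_apply, rotation_apply, mul_comm]
    rfl
  rw [h1]
  exact (rotation w).measurePreserving.comp (measurePreserving_sub_right volume c)

lemma not_three_far_points_near {E : Type*} [NormedAddCommGroup E] [InnerProductSpace ℝ E]
    {a b c : E} {r : ℝ} (hr : r ^ 2 = 4 / 3) (hr0 : 0 < r) (ha : ‖a‖ ≤ r) (hb : ‖b‖ < r)
    (hc : ‖c‖ < r) (hab : 2 ≤ ‖a - b‖) (hac : 2 ≤ ‖a - c‖) (hbc : 2 ≤ ‖b - c‖) : False := by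
  have hr2 : r < 2 := by nlinarith
  have key : ∀ x y : E, ‖x‖ ≤ r → ‖y‖ < r → 2 ≤ ‖x - y‖ →
      0 < ‖x‖ ∧ 0 < ‖y‖ ∧ inner ℝ x y < -(‖x‖ * ‖y‖) / 2 := by
    intro x y hx hy hxy
    have h1 := norm_sub_sq_real x y
    have h2 := norm_sub_le x y
    have hx0 : 0 < ‖x‖ := by linarith
    have hy0 : 0 < ‖y‖ := by linarith
    refine ⟨hx0, hy0, ?_⟩
    nlinarith [mul_pos hx0 hy0]
  obtain ⟨ha0, hb0, h1⟩ := key a b ha hb hab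
  obtain ⟨-, hc0, h2⟩ := key a c ha hc hac
  obtain ⟨-, -, h3⟩ := key b c hb.le hc hbc
  have h4 := sq_nonneg ‖((‖b‖ * ‖c‖) • a + (‖a‖ * ‖c‖) • b) + ((‖a‖ * ‖b‖) • c)‖
  rw [norm_add_sq_real, norm_add_sq_real, inner_add_left] at h4
  simp only [real_inner_smul_left, real_inner_smul_right, norm_smul, Real.norm_eq_abs, abs_mul,
    abs_norm] at h4
  have e1 := mul_lt_mul_of_pos_left h1 (by positivity : 0 < ‖a‖ * ‖b‖ * ‖c‖ * ‖c‖)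
  have e2 := mul_lt_mul_of_pos_left h2 (by positivity : 0 < ‖a‖ * ‖b‖ * ‖c‖ * ‖b‖)
  have e3 := mul_lt_mul_of_pos_left h3 (by positivity : 0 < ‖a‖ * ‖b‖ * ‖c‖ * ‖a‖)
  nlinarith

lemma cos_chordAngle {c p : ℂ} (h : dist p c < 2 * ρ) :
    Real.cos (chordAngle c p) = dist p c / (2 * ρ) := by
  have hρ := hexCircumradius_pos
  rw [chordAngle, Real.cos_arccos]
  · have : 0 ≤ dist p c / (2 * ρ) := by positivity
    linarith
  · rw [div_le_one (by positivity)]; exact h.le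

lemma chordAngle_nonneg (c p : ℂ) : 0 ≤ chordAngle c p := Real.arccos_nonneg _

lemma chordAngle_le {c p : ℂ} (h : 2 ≤ dist p c) : chordAngle c p ≤ Real.pi / 6 := by
  have hρ := hexCircumradius_pos
  have h1 : Real.pi / 6 = Real.arccos (2 / (2 * ρ)) := by
    rw [← cos_pi_div_six_eq, Real.arccos_cos] <;> linarith [Real.pi_pos]
  rw [h1]
  exact Real.antitone_arccos (by gcongr)

/-- The sector around `c` towards `p` spanned by the chord cut off by the bisector. -/
def chordSector (c p : ℂ) : Set ℂ := alignMap c p ⁻¹' openSector ρ (chordAngle c p)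

lemma two_mul_inner_of_mem_chordSector {c p x : ℂ} (h0 : p ≠ c) (h : dist p c < 2 * ρ)
    (hx : x ∈ chordSector c p) :
    0 < ‖x - c‖ ∧ ‖x - c‖ * ‖p - c‖ ^ 2 < 2 * ρ * inner ℝ (x - c) (p - c) := by
  have hρ := hexCircumradius_pos
  have hx2 := hx.2
  have hp : 0 < ‖p - c‖ := norm_pos_iff.2 (sub_ne_zero.2 h0)
  rw [norm_alignMap h0, re_alignMap, cos_chordAngle h, dist_eq_norm, dist_eq_norm,
    lt_div_iff₀ hp] at hx2
  have h2 : ‖x - c‖ * ‖p - c‖ ^ 2 < 2 * ρ * inner ℝ (x - c) (p - c) := by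
    have := mul_lt_mul_of_pos_left hx2 (by positivity : 0 < 2 * ρ)
    calc _ = 2 * ρ * (‖x - c‖ * (‖p - c‖ / (2 * ρ)) * ‖p - c‖) := by field_simp
      _ < _ := this
  refine ⟨?_, h2⟩
  rw [norm_pos_iff]
  intro h3
  simp [h3] at h2

lemma disjoint_chordSector {c p q : ℂ} (hp : 2 ≤ dist p c) (hq : 2 ≤ dist q c)
    (hpq : 2 ≤ dist p q) (hp' : dist p c < 2 * ρ) (hq' : dist q c < 2 * ρ) :
    Disjoint (chordSector c p) (chordSector c q) := by
  have hρ := hexCircumradius_pos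
  rw [Set.disjoint_left]
  intro x hxp hxq
  have hpc : p ≠ c := by rintro rfl; simp at hp; linarith
  have hqc : q ≠ c := by rintro rfl; simp at hq; linarith
  obtain ⟨hx, h1⟩ := two_mul_inner_of_mem_chordSector hpc hp' hxp
  obtain ⟨-, h2⟩ := two_mul_inner_of_mem_chordSector hqc hq' hxq
  rw [dist_eq_norm] at hp hq hpq
  set y := (ρ / ‖x - c‖) • (x - c) with hy
  have hyn : ‖y‖ = ρ := by
    rw [hy, norm_smul, Real.norm_of_nonneg (by positivity), div_mul_cancel₀ _ hx.ne']
  have near : ∀ v : ℂ, ‖x - c‖ * ‖v‖ ^ 2 < 2 * ρ * inner ℝ (x - c) v → ‖v - y‖ < ρ := by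
    intro v hv
    have h3 : ‖v‖ ^ 2 < 2 * inner ℝ y v := by
      rw [hy, real_inner_smul_left]
      have : 2 * (ρ / ‖x - c‖ * inner ℝ (x - c) v) = 2 * ρ * inner ℝ (x - c) v / ‖x - c‖ := by
        ring
      rw [this, lt_div_iff₀ hx]; linarith
    have h4 := norm_sub_sq_real v y
    rw [hyn, real_inner_comm] at h4
    exact lt_of_pow_lt_pow_left₀ 2 hρ.le (by linarith)
  refine not_three_far_points_near (a := -y) (b := p - c - y) (c := q - c - y) hexCircumradius_sq hρ
    (by rw [norm_neg, hyn]) (near _ h1) (near _ h2) ?_ ?_ ?_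
  · rw [show -y - (p - c - y) = -(p - c) by ring, norm_neg]; exact hp
  · rw [show -y - (q - c - y) = -(q - c) by ring, norm_neg]; exact hq
  · rw [show p - c - y - (q - c - y) = p - q by ring]; exact hpq

lemma ball_subset_truncCell_union {S : Set ℂ} {c : ℂ} {T : Finset ℂ}
    (hT : ∀ p, p ∈ T ↔ p ∈ S ∧ p ≠ c ∧ dist p c < 2 * ρ) :
    ball c ρ ⊆ truncCell S c ∪ ⋃ p ∈ T, alignMap c p ⁻¹' circSegment ρ (chordAngle c p) := by
  have hρ := hexCircumradius_pos
  intro x hx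
  rw [mem_ball] at hx
  by_cases h : x ∈ truncCell S c
  · exact Or.inl h
  right
  have h1 : ∃ p ∈ S, p ≠ c ∧ dist x p ≤ dist x c := by
    by_contra! h2
    exact h ⟨hx, h2⟩
  obtain ⟨p, hpS, hpc, hxp⟩ := h1
  have hd : dist p c < 2 * ρ := by
    have := dist_triangle_left p c x
    linarith
  simp only [Set.mem_iUnion]
  refine ⟨p, (hT p).2 ⟨hpS, hpc, hd⟩, ?_, ?_⟩
  · rwa [norm_alignMap hpc]
  · have hp : 0 < ‖p - c‖ := norm_pos_iff.2 (sub_ne_zero.2 hpc)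
    rw [re_alignMap, cos_chordAngle hd, dist_eq_norm, le_div_iff₀ hp]
    have h2 : ρ * (‖p - c‖ / (2 * ρ)) * ‖p - c‖ = ‖p - c‖ ^ 2 / 2 := by field_simp
    rw [h2]
    have h3 := norm_sub_sq_real (x - c) (p - c)
    rw [sub_sub_sub_cancel_right, ← dist_eq_norm, ← dist_eq_norm] at h3
    nlinarith [dist_nonneg (x := x) (y := p)]

lemma measurableSet_truncCell {S : Set ℂ} (hS : TwoSeparated S) {c : ℂ} :
    MeasurableSet (truncCell S c) := by
  have hρ := hexCircumradius_pos
  have hfin := hS.finite_inter_ball c (2 * ρ)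
  have : truncCell S c = ball c ρ ∩ ⋂ p ∈ (S ∩ ball c (2 * ρ)) \ {c}, {x | dist x c < dist x p} := by
    ext x
    simp only [truncCell, Set.mem_ofPred_eq, Set.mem_inter_iff, mem_ball, Set.mem_iInter,
      Set.mem_sdiff, Set.mem_singleton_iff]
    refine and_congr_right fun hx => ⟨fun h p hp => h p hp.1.1 hp.2, fun h p hp hpc => ?_⟩
    by_cases hd : dist p c < 2 * ρ
    · exact h p ⟨⟨hp, hd⟩, hpc⟩
    · have := dist_triangle_left p c x
      linarith
  rw [this]
  refine measurableSet_ball.inter (MeasurableSet.biInter (hfin.subset Set.sdiff_subset).countable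
    fun p _ => ?_)
  exact (isOpen_lt (by fun_prop) (by fun_prop)).measurableSet

lemma volume_real_ball_complex (c : ℂ) {r : ℝ} (hr : 0 ≤ r) :
    volume.real (ball c r) = Real.pi * r ^ 2 := by
  rw [measureReal_def, Complex.volume_ball]
  simp [ENNReal.toReal_ofReal hr, mul_comm]

lemma volume_truncCell_ge_sum {S : Set ℂ} (hS : TwoSeparated S) {c : ℂ} (hc : c ∈ S) :
    ∃ T : Finset ℂ, (∀ p, p ∈ T ↔ p ∈ S ∧ p ≠ c ∧ dist p c < 2 * ρ) ∧
      ∑ p ∈ T, chordAngle c p ≤ Real.pi ∧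
      ρ ^ 2 * (Real.pi - ∑ p ∈ T, (chordAngle c p -
        Real.sin (chordAngle c p) * Real.cos (chordAngle c p))) ≤ volume.real (truncCell S c) := by
  have hρ := hexCircumradius_pos
  have hfin := (hS.finite_inter_ball c (2 * ρ)).subset
    (Set.sdiff_subset (s := S ∩ ball c (2 * ρ)) (t := {c}))
  have hT : ∀ p, p ∈ hfin.toFinset ↔ p ∈ S ∧ p ≠ c ∧ dist p c < 2 * ρ := by
    intro p; simp; tauto
  refine ⟨hfin.toFinset, hT, ?_, ?_⟩
  all_goals
    set T := hfin.toFinset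
    have hdist : ∀ p ∈ T, 2 ≤ dist p c := fun p hp =>
      hS ((hT p).1 hp).1 hc ((hT p).1 hp).2.1
    have hα : ∀ p ∈ T, chordAngle c p < Real.pi / 2 := fun p hp => by
      have := chordAngle_le (hdist p hp)
      linarith [Real.pi_pos]
  · have hsub : (⋃ p ∈ T, chordSector c p) ⊆ ball c ρ := by
      intro x hx
      simp only [Set.mem_iUnion] at hx
      obtain ⟨p, hp, hx⟩ := hx
      have := hx.1
      rwa [norm_alignMap ((hT p).1 hp).2.1] at this
    have htop : ∀ p ∈ T, volume (chordSector c p) ≠ ⊤ := fun p hp =>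
      ((measure_mono ((Set.subset_biUnion_of_mem (u := chordSector c) hp).trans hsub)).trans_lt
        measure_ball_lt_top).ne
    have h1 := measureReal_mono (μ := volume) hsub measure_ball_lt_top.ne
    rw [volume_real_ball_complex c hρ.le, measureReal_biUnion_finset (h := htop)] at h1
    · have h2 : ∀ p ∈ T, volume.real (chordSector c p) = ρ ^ 2 * chordAngle c p := by
        intro p hp
        rw [measureReal_def, chordSector,
          (measurePreserving_alignMap ((hT p).1 hp).2.1).measure_preimage
            (measurableSet_openSector _ _).nullMeasurableSet,
          volume_openSector hρ.le (chordAngle_nonneg c p) (by linarith [hα p hp, Real.pi_pos]),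
          ENNReal.toReal_ofReal (by have := chordAngle_nonneg c p; positivity)]
      rw [Finset.sum_congr rfl h2, ← Finset.mul_sum, mul_comm Real.pi] at h1
      exact le_of_mul_le_mul_left h1 (by positivity)
    · intro p hp q hq hpq
      exact disjoint_chordSector (hdist p hp) (hdist q hq)
        (hS ((hT p).1 hp).1 ((hT q).1 hq).1 hpq) ((hT p).1 hp).2.2 ((hT q).1 hq).2.2
    · intro p hp
      exact (measurePreserving_alignMap ((hT p).1 hp).2.1).measurable
        (measurableSet_openSector _ _)
  · have hcell : volume (truncCell S c) ≠ ⊤ :=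
      ((measure_mono (fun x hx => hx.1 : truncCell S c ⊆ ball c ρ)).trans_lt
        measure_ball_lt_top).ne
    have hseg : ∀ p ∈ T, volume (alignMap c p ⁻¹' circSegment ρ (chordAngle c p)) ≤
        ENNReal.ofReal (ρ ^ 2 * (chordAngle c p -
          Real.sin (chordAngle c p) * Real.cos (chordAngle c p))) := by
      intro p hp
      rw [(measurePreserving_alignMap ((hT p).1 hp).2.1).measure_preimage
        (measurableSet_circSegment _ _).nullMeasurableSet]
      exact volume_circSegment_le hρ.le (chordAngle_nonneg c p) (hα p hp)
    have hnn : ∀ p ∈ T, 0 ≤ ρ ^ 2 * (chordAngle c p -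
          Real.sin (chordAngle c p) * Real.cos (chordAngle c p)) := by
      intro p hp
      have h0 := chordAngle_nonneg c p
      have h1 := Real.sin_le h0
      have h2 := Real.cos_le_one (chordAngle c p)
      have h3 : 0 ≤ Real.sin (chordAngle c p) :=
        Real.sin_nonneg_of_nonneg_of_le_pi h0 (by linarith [hα p hp, Real.pi_pos])
      have : 0 ≤ chordAngle c p - Real.sin (chordAngle c p) * Real.cos (chordAngle c p) := by
        nlinarith
      positivity
    have h1 : volume (ball c ρ) ≤ volume (truncCell S c) + ∑ p ∈ T, ENNReal.ofReal
        (ρ ^ 2 * (chordAngle c p - Real.sin (chordAngle c p) * Real.cos (chordAngle c p))) :=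
      (measure_mono (ball_subset_truncCell_union hT)).trans <| (measure_union_le _ _).trans <|
        add_le_add le_rfl <| (measure_biUnion_finset_le _ _).trans (Finset.sum_le_sum hseg)
    rw [← ENNReal.ofReal_sum_of_nonneg hnn] at h1
    have h2 := ENNReal.toReal_mono (by finiteness) h1
    rw [ENNReal.toReal_add hcell ENNReal.ofReal_ne_top,
      ENNReal.toReal_ofReal (Finset.sum_nonneg hnn), ← measureReal_def, ← measureReal_def,
      volume_real_ball_complex c hρ.le, ← Finset.mul_sum] at h2
    linarith

lemma mul_sin_lt_mul_sin {x y : ℝ} (hx : 0 < x) (hxy : x < y) (hy : y ≤ Real.pi) :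
    x * Real.sin y < y * Real.sin x := by
  have hy0 : 0 < y := hx.trans hxy
  have h := strictConcaveOn_sin_Icc.2 ⟨hy0.le, hy⟩ ⟨le_rfl, Real.pi_pos.le⟩ hy0.ne'
    (div_pos hx hy0) (sub_pos.2 ((div_lt_one hy0).2 hxy)) (add_sub_cancel _ _)
  simp only [smul_eq_mul, Real.sin_zero, mul_zero, add_zero] at h
  rw [div_mul_cancel₀ _ hy0.ne', div_mul_eq_mul_div, div_lt_iff₀ hy0] at h
  linarith

lemma mul_sin_le_mul_sin {x y : ℝ} (hx : 0 ≤ x) (hxy : x ≤ y) (hy : y ≤ Real.pi) :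
    x * Real.sin y ≤ y * Real.sin x := by
  rcases hx.eq_or_lt with rfl | hx
  · simp
  rcases hxy.eq_or_lt with rfl | hxy
  · rfl
  exact (mul_sin_lt_mul_sin hx hxy hy).le

lemma mul_sinc_le_sin_mul_cos {α y : ℝ} (h0 : 0 ≤ α) (h : 2 * α ≤ y) (hy0 : 0 < y)
    (hy : y ≤ Real.pi) : α * (Real.sin y / y) ≤ Real.sin α * Real.cos α := by
  have h1 := mul_sin_le_mul_sin (by linarith : 0 ≤ 2 * α) h hy
  rw [Real.sin_two_mul] at h1
  rw [← mul_div_assoc, div_le_iff₀ hy0]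
  linarith

lemma sqrt_three_eq_sinc :
    ρ ^ 2 * (Real.pi * (Real.sin (Real.pi / 3) / (Real.pi / 3))) = 2 * √3 := by
  rw [hexCircumradius_sq, Real.sin_pi_div_three]
  have := Real.pi_pos.ne'
  field_simp
  ring

lemma volume_truncCell_ge {S : Set ℂ} (hS : TwoSeparated S) {c : ℂ} (hc : c ∈ S) :
    2 * √3 ≤ volume.real (truncCell S c) := by
  obtain ⟨T, hT, hsum, hvol⟩ := volume_truncCell_ge_sum hS hc
  refine le_trans ?_ hvol
  have hπ := Real.pi_pos
  have hs : Real.sin (Real.pi / 3) / (Real.pi / 3) ≤ 1 := by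
    rw [div_le_one (by positivity)]
    exact Real.sin_le (by positivity)
  have h1 : ∑ p ∈ T, (chordAngle c p - Real.sin (chordAngle c p) * Real.cos (chordAngle c p)) ≤
      ∑ p ∈ T, chordAngle c p * (1 - Real.sin (Real.pi / 3) / (Real.pi / 3)) := by
    refine Finset.sum_le_sum fun p hp => ?_
    have h2 := chordAngle_le (hS ((hT p).1 hp).1 hc ((hT p).1 hp).2.1)
    have := mul_sinc_le_sin_mul_cos (chordAngle_nonneg c p) (by linarith) (by positivity)
      (by linarith : Real.pi / 3 ≤ Real.pi)
    linarith
  rw [← Finset.sum_mul] at h1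
  rw [← sqrt_three_eq_sinc]
  have h3 := mul_le_mul_of_nonneg_right hsum (sub_nonneg.2 hs)
  gcongr
  linarith

/-- If a truncated cell has almost minimal area, then its center has six near neighbors. -/
lemma exists_volume_gap {δ : ℝ} (hδ : 0 < δ) (hδ' : δ ≤ 1 / 4) :
    ∃ ε > 0, ∀ S : Set ℂ, TwoSeparated S → ∀ c ∈ S,
      2 * √3 + ε ≤ volume.real (truncCell S c) ∨
      ∃ f : Fin 6 → ℂ, Function.Injective f ∧ ∀ i, f i ∈ S ∧ f i ≠ c ∧ dist (f i) c ≤ 2 + δ := by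
  have hρ := hexCircumradius_pos
  have hρ2 := lt_two_mul_hexCircumradius
  have hπ := Real.pi_pos
  set s := Real.sin (Real.pi / 3) / (Real.pi / 3) with hs
  set y := 2 * Real.arccos ((2 + δ) / (2 * ρ)) with hy
  have hy0 : 0 < y := by
    have : 0 < Real.arccos ((2 + δ) / (2 * ρ)) := by
      rw [Real.arccos_pos, div_lt_one (by positivity)]; linarith
    positivity
  have hy1 : y < Real.pi / 3 := by
    have h1 : Real.pi / 6 = Real.arccos (2 / (2 * ρ)) := by
      rw [← cos_pi_div_six_eq, Real.arccos_cos] <;> linarith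
    have h2 : Real.arccos ((2 + δ) / (2 * ρ)) < Real.arccos (2 / (2 * ρ)) := by
      refine Real.strictAntiOn_arccos ⟨?_, ?_⟩ ⟨?_, ?_⟩ ?_
      · linarith [show 0 ≤ 2 / (2 * ρ) by positivity]
      · rw [div_le_one (by positivity)]; linarith
      · linarith [show 0 ≤ (2 + δ) / (2 * ρ) by positivity]
      · rw [div_le_one (by positivity)]; linarith
      · gcongr; linarith
    rw [← h1] at h2
    linarith
  set s' := Real.sin y / y with hs'
  have hss : s < s' := by
    rw [hs, hs', div_lt_div_iff₀ (by positivity) hy0]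
    linarith [mul_sin_lt_mul_sin hy0 hy1 (by linarith)]
  have hs1 : s' ≤ 1 := by
    rw [hs', div_le_one hy0]
    exact Real.sin_le hy0.le
  refine ⟨ρ ^ 2 * ((s' - s) * (Real.pi / 6)), ?_, ?_⟩
  · have := sub_pos.2 hss
    positivity
  intro S hS c hc
  obtain ⟨T, hT, hsum, hvol⟩ := volume_truncCell_ge_sum hS hc
  set N := T.filter fun p => dist p c ≤ 2 + δ with hN
  by_cases hcard : 6 ≤ N.card
  · right
    obtain ⟨N', hN', hcard'⟩ := Finset.exists_subset_card_eq hcard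
    let e := N'.equivFinOfCardEq hcard'
    refine ⟨fun i => e.symm i, Subtype.val_injective.comp e.symm.injective, fun i => ?_⟩
    have h1 := Finset.mem_filter.1 (hN' (e.symm i).2)
    have h2 := (hT _).1 h1.1
    exact ⟨h2.1, h2.2.1, h1.2⟩
  left
  refine le_trans ?_ hvol
  have hα : ∀ p ∈ T, chordAngle c p ≤ Real.pi / 6 := fun p hp =>
    chordAngle_le (hS ((hT p).1 hp).1 hc ((hT p).1 hp).2.1)
  have hnear : ∑ p ∈ N, (chordAngle c p - Real.sin (chordAngle c p) * Real.cos (chordAngle c p)) ≤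
      ∑ p ∈ N, chordAngle c p * (1 - s) := by
    refine Finset.sum_le_sum fun p hp => ?_
    have h2 := hα p (Finset.mem_filter.1 hp).1
    have := mul_sinc_le_sin_mul_cos (chordAngle_nonneg c p) (by linarith) (by positivity)
      (by linarith : Real.pi / 3 ≤ Real.pi)
    rw [← hs] at this
    linarith
  have hfar : ∑ p ∈ T.filter (fun p => ¬ dist p c ≤ 2 + δ),
        (chordAngle c p - Real.sin (chordAngle c p) * Real.cos (chordAngle c p)) ≤
      ∑ p ∈ T.filter (fun p => ¬ dist p c ≤ 2 + δ), chordAngle c p * (1 - s') := by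
    refine Finset.sum_le_sum fun p hp => ?_
    have h3 := (Finset.mem_filter.1 hp).2
    have h2 : chordAngle c p ≤ Real.arccos ((2 + δ) / (2 * ρ)) :=
      Real.antitone_arccos (by rw [not_le] at h3; gcongr)
    have := mul_sinc_le_sin_mul_cos (chordAngle_nonneg c p) (by linarith) hy0
      (by linarith)
    linarith
  have hNsum : ∑ p ∈ N, chordAngle c p ≤ 5 * (Real.pi / 6) := by
    have h1 := Finset.sum_le_card_nsmul N (chordAngle c) (Real.pi / 6)
      fun p hp => hα p (Finset.mem_filter.1 hp).1
    rw [nsmul_eq_mul] at h1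
    have h2 : (N.card : ℝ) ≤ 5 := by exact_mod_cast (by omega : N.card ≤ 5)
    exact h1.trans (by gcongr)
  rw [← Finset.sum_filter_add_sum_filter_not T (fun p => dist p c ≤ 2 + δ)] at hsum ⊢
  rw [← Finset.sum_mul] at hnear hfar
  rw [← sqrt_three_eq_sinc, ← mul_add]
  refine mul_le_mul_of_nonneg_left ?_ (by positivity)
  have e1 := mul_le_mul_of_nonneg_right hsum (sub_nonneg.2 hs1)
  have e2 := mul_le_mul_of_nonneg_right hNsum (sub_nonneg.2 hss.le)
  rw [← hN] at e1 ⊢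
  nlinarith

lemma disjoint_truncCell {S : Set ℂ} {c p : ℂ} (hc : c ∈ S) (hp : p ∈ S) (h : c ≠ p) :
    Disjoint (truncCell S c) (truncCell S p) :=
  Set.disjoint_left.2 fun _ hx hy => lt_asymm (hx.2 p hp h.symm) (hy.2 c hc h)

lemma sum_volume_truncCell_le {S : Set ℂ} (hS : TwoSeparated S) {p : ℂ} {r : ℝ} (hr : 0 ≤ r)
    {F : Finset ℂ} (hF : ↑F ⊆ S ∩ ball p r) :
    ∑ c ∈ F, volume.real (truncCell S c) ≤ Real.pi * (r + ρ) ^ 2 := by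
  have hρ := hexCircumradius_pos
  have hsub : (⋃ c ∈ F, truncCell S c) ⊆ ball p (r + ρ) := by
    intro x hx
    simp only [Set.mem_iUnion] at hx
    obtain ⟨c, hc, hx⟩ := hx
    have h1 := (hF hc).2
    rw [mem_ball] at h1 ⊢
    linarith [dist_triangle x c p, hx.1]
  have htop : ∀ c ∈ F, volume (truncCell S c) ≠ ⊤ := fun c hc =>
    ((measure_mono ((Set.subset_biUnion_of_mem (u := truncCell S) hc).trans hsub)).trans_lt
      measure_ball_lt_top).ne
  have h1 := measureReal_mono (μ := volume) hsub measure_ball_lt_top.ne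
  rwa [volume_real_ball_complex p (by positivity), measureReal_biUnion_finset (h := htop)] at h1
  · exact fun c hc q hq hcq => disjoint_truncCell (hF hc).1 (hF hq).1 hcq
  · exact fun c _ => measurableSet_truncCell hS

lemma card_add_card_le {S : Set ℂ} (hS : TwoSeparated S) {p : ℂ} {r ε : ℝ} (hr : 0 ≤ r)
    {F G : Finset ℂ} (hF : ↑F ⊆ S ∩ ball p r) (hGF : G ⊆ F)
    (hG : ∀ c ∈ G, 2 * √3 + ε ≤ volume.real (truncCell S c)) :
    2 * √3 * F.card + ε * G.card ≤ Real.pi * (r + ρ) ^ 2 := by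
  refine le_trans ?_ (sum_volume_truncCell_le hS hr hF)
  rw [← Finset.sum_sdiff hGF]
  have h1 : ((F \ G).card : ℝ) * (2 * √3) ≤ ∑ c ∈ F \ G, volume.real (truncCell S c) := by
    rw [← nsmul_eq_mul]
    exact Finset.card_nsmul_le_sum _ _ _ fun c hc =>
      volume_truncCell_ge hS (hF (Finset.mem_sdiff.1 hc).1).1
  have h2 : (G.card : ℝ) * (2 * √3 + ε) ≤ ∑ c ∈ G, volume.real (truncCell S c) := by
    rw [← nsmul_eq_mul]
    exact Finset.card_nsmul_le_sum _ _ _ hG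
  have h3 : (F.card : ℝ) = (F \ G).card + G.card := by
    exact_mod_cast (Finset.card_sdiff_add_card_eq_card hGF).symm
  rw [h3]
  linarith

lemma sqrt_three_bounds : 1 < √3 ∧ √3 < 2 := by
  constructor
  · exact Real.lt_sqrt_of_sq_lt (by norm_num)
  · rw [Real.sqrt_lt' (by norm_num)]; norm_num

/-- The point `c` of `S` has six other points of `S` at distance at most `2 + δ`. -/
def HasSixNear (S : Set ℂ) (δ : ℝ) (c : ℂ) : Prop :=
  ∃ f : Fin 6 → ℂ, Function.Injective f ∧ ∀ i, f i ∈ S ∧ f i ≠ c ∧ dist (f i) c ≤ 2 + δ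

/-- In a separated set of maximal density there are arbitrarily large balls in which all points
have six near neighbors. -/
lemma exists_ball_hasSixNear {S : Set ℂ} (hS : TwoSeparated S)
    (hdens : ∀ η > 0, ∀ᶠ r : ℝ in atTop,
      (Real.pi - η) * r ^ 2 ≤ 2 * √3 * (S ∩ ball 0 (r + 1)).ncard)
    {δ : ℝ} (hδ : 0 < δ) (hδ' : δ ≤ 1 / 4) {n : ℝ} (hn : 0 < n) :
    ∃ c ∈ S, ∀ p ∈ S, dist p c < n → HasSixNear S δ p := by
  have hρ := hexCircumradius_pos
  have hρ2 := hexCircumradius_lt_two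
  have hπ := Real.pi_gt_three
  have hπ4 := Real.pi_le_four
  obtain ⟨hs1, hs2⟩ := sqrt_three_bounds
  obtain ⟨ε, hε, hgap⟩ := exists_volume_gap hδ hδ'
  by_contra! hcon
  choose! b hbS hbn hbad using hcon
  have hvol : ∀ p ∈ S, ¬ HasSixNear S δ p → 2 * √3 + ε ≤ volume.real (truncCell S p) :=
    fun p hp hb => (hgap S hS p hp).resolve_right hb
  set M : ℕ := ⌈Real.pi * (n + ρ) ^ 2⌉₊ with hM
  have hMpos : (0 : ℝ) < M := by
    have : 0 < M := Nat.ceil_pos.2 (by positivity)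
    exact_mod_cast this
  set η := min 1 (ε / (16 * M)) with hη
  have hη0 : 0 < η := lt_min one_pos (by positivity)
  have hη1 : η ≤ 1 := min_le_left _ _
  have hηM : η * (16 * M) ≤ ε := (le_div_iff₀ (by positivity)).1 (min_le_right _ _)
  have hev := (hdens η hη0).and ((tendsto_atTop_add_const_right atTop n tendsto_id).eventually
    (hdens η hη0))
  obtain ⟨r, ⟨hr1, hr2⟩, hr3, hr4, hr5⟩ := (hev.and ((eventually_ge_atTop n).and
    ((eventually_ge_atTop (1 : ℝ)).and (eventually_gt_atTop (336 * M / ε))))).exists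
  simp only [id] at hr2
  have hfin := hS.finite_inter_ball 0 (r + 1)
  have hfin' := hS.finite_inter_ball 0 (r + n + 1)
  classical
  set F := hfin.toFinset with hF
  set F' := hfin'.toFinset with hF'
  rw [Set.ncard_eq_toFinset_card _ hfin] at hr1
  rw [Set.ncard_eq_toFinset_card _ hfin'] at hr2
  rw [← hF] at hr1
  rw [← hF'] at hr2
  set G := F'.filter fun p => ¬ HasSixNear S δ p with hG
  have h1 := card_add_card_le hS (by linarith : 0 ≤ r + n + 1) (F := F') (G := G) (ε := ε)
    (p := 0) (by simp [hF']) (Finset.filter_subset _ _) (fun p hp => by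
      obtain ⟨h2, h3⟩ := Finset.mem_filter.1 hp
      exact hvol p ((Set.Finite.mem_toFinset _).1 h2).1 h3)
  have h2 : F.card ≤ M * G.card := by
    refine Finset.card_le_mul_card_image_of_maps_to (f := b) (fun c hc => ?_) M fun q hq => ?_
    · obtain ⟨hcS, hc⟩ := (Set.Finite.mem_toFinset _).1 hc
      refine Finset.mem_filter.2 ⟨(Set.Finite.mem_toFinset _).2 ⟨hbS c hcS, ?_⟩, hbad c hcS⟩
      rw [mem_ball] at hc ⊢
      linarith [dist_triangle (b c) c 0, hbn c hcS]
    · have h3 := card_add_card_le hS hn.le (F := F.filter fun c => b c = q) (G := ∅) (ε := ε)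
        (p := q) ?_ (Finset.empty_subset _) (by simp)
      · have h4 : ((F.filter fun c => b c = q).card : ℝ) ≤ Real.pi * (n + ρ) ^ 2 := by
          refine le_trans ?_ h3
          rw [Finset.card_empty, Nat.cast_zero, mul_zero, add_zero]
          exact le_mul_of_one_le_left (Nat.cast_nonneg _) (by linarith)
        exact_mod_cast h4.trans (Nat.le_ceil _)
      · intro c hc
        obtain ⟨hc1, rfl⟩ := Finset.mem_filter.1 hc
        have hcS := ((Set.Finite.mem_toFinset _).1 hc1).1
        exact ⟨hcS, by rw [mem_ball, dist_comm]; exact hbn c hcS⟩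
  have h2' : (F.card : ℝ) ≤ M * G.card := by exact_mod_cast h2
  set g : ℝ := (G.card : ℝ)
  have hg0 : 0 ≤ g := Nat.cast_nonneg _
  have h5 : ε * g ≤ η * (r + n) ^ 2 + Real.pi * (6 * (r + n) + 9) := by
    have : Real.pi * (r + n + 1 + ρ) ^ 2 ≤ Real.pi * (r + n + 3) ^ 2 :=
      mul_le_mul_of_nonneg_left (pow_le_pow_left₀ (by linarith) (by linarith) 2) (by linarith)
    linarith
  have h6 : η * (r + n) ^ 2 + Real.pi * (6 * (r + n) + 9) ≤ 4 * η * r ^ 2 + 84 * r := by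
    have e1 : η * (r + n) ^ 2 ≤ η * (2 * r) ^ 2 := by gcongr; linarith
    have e2 : Real.pi * (6 * (r + n) + 9) ≤ 4 * (21 * r) := by gcongr; linarith
    linarith
  have h7 : r ^ 2 ≤ 2 * (M * g) := by
    have e1 : 2 * r ^ 2 ≤ (Real.pi - η) * r ^ 2 := by gcongr; linarith
    have e2 : 2 * √3 * F.card ≤ 4 * (M * g) := by gcongr; linarith
    linarith
  have h8 : ε * r ^ 2 ≤ 2 * M * (4 * η * r ^ 2 + 84 * r) := by
    calc ε * r ^ 2 ≤ ε * (2 * (M * g)) := by gcongr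
      _ = 2 * M * (ε * g) := by ring
      _ ≤ _ := by gcongr; linarith
  have h9 : η * (16 * M) * r ^ 2 ≤ ε * r ^ 2 := by gcongr
  rw [div_lt_iff₀ hε] at hr5
  have h10 : 336 * M * r < r * ε * r := by gcongr
  nlinarith

/-- The primitive sixth root of unity in the upper half-plane. -/
def hexRoot : ℂ := Complex.exp ((Real.pi / 3 : ℝ) * Complex.I)

lemma hexRoot_re : hexRoot.re = 1 / 2 := by
  rw [hexRoot, Complex.exp_ofReal_mul_I_re, Real.cos_pi_div_three]

lemma hexRoot_im : hexRoot.im = √3 / 2 := by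
  rw [hexRoot, Complex.exp_ofReal_mul_I_im, Real.sin_pi_div_three]

lemma norm_hexRoot : ‖hexRoot‖ = 1 := Complex.norm_exp_ofReal_mul_I _

lemma hexRoot_pow_three : hexRoot ^ 3 = -1 := by
  rw [hexRoot, ← Complex.exp_nat_mul, ← Complex.exp_pi_mul_I]
  congr 1
  push_cast
  ring

lemma hexRoot_pow_six : hexRoot ^ 6 = 1 := by
  rw [show 6 = 3 * 2 from rfl, pow_mul, hexRoot_pow_three]; norm_num

lemma pi_div_three_le_of_one_le_norm {a b : ℝ}
    (h : 1 ≤ ‖Complex.exp (a * Complex.I) - Complex.exp (b * Complex.I)‖) :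
    Real.pi / 3 ≤ |a - b| := by
  by_contra! hlt
  have h1 : 1 / 2 < Real.cos (a - b) := by
    rw [← Real.cos_pi_div_three, ← Real.cos_abs (a - b)]
    exact Real.cos_lt_cos_of_nonneg_of_le_pi_div_two (abs_nonneg _)
      (by linarith [Real.pi_pos]) hlt
  have h2 : ‖Complex.exp (a * Complex.I) - Complex.exp (b * Complex.I)‖ ^ 2
      = 2 - 2 * Real.cos (a - b) := by
    rw [Complex.sq_norm, Complex.normSq_apply, Complex.sub_re, Complex.sub_im,
      Complex.exp_ofReal_mul_I_re, Complex.exp_ofReal_mul_I_re, Complex.exp_ofReal_mul_I_im,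
      Complex.exp_ofReal_mul_I_im, Real.cos_sub]
    linarith [Real.sin_sq_add_cos_sq a, Real.sin_sq_add_cos_sq b]
  nlinarith

lemma exists_angle {z w : ℂ} (h : ‖z‖ = ‖w‖) (hz : z ≠ 0) :
    ∃ b : ℝ, 0 ≤ b ∧ b < 2 * Real.pi ∧ z * Complex.exp (b * Complex.I) = w := by
  have hn : ‖w / z‖ = 1 := by rw [norm_div, h, div_self (by rw [← h]; simpa using hz)]
  have h1 : Complex.exp ((w / z).arg * Complex.I) = w / z := by
    have := Complex.norm_mul_exp_arg_mul_I (w / z)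
    rwa [hn, Complex.ofReal_one, one_mul] at this
  have h2 := Complex.neg_pi_lt_arg (w / z)
  have h3 := Complex.arg_le_pi (w / z)
  have hπ := Real.pi_pos
  by_cases h0 : 0 ≤ (w / z).arg
  · exact ⟨_, h0, by linarith, by rw [h1, mul_div_cancel₀ _ hz]⟩
  · refine ⟨(w / z).arg + 2 * Real.pi, by linarith, by linarith, ?_⟩
    have : (((w / z).arg + 2 * Real.pi : ℝ) : ℂ) * Complex.I
        = (w / z).arg * Complex.I + 2 * Real.pi * Complex.I := by push_cast; ring
    rw [this, Complex.exp_add, Complex.exp_two_pi_mul_I, mul_one, h1, mul_div_cancel₀ _ hz]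

/-- Six points on the circle of radius `2` with mutual distances at least `2` form a regular
hexagon. -/
lemma hexRoot_mul_mem_of_six_points {w : ℂ} (hw : ‖w‖ = 2) {f : Fin 6 → ℂ}
    (hf : ∀ i, ‖f i‖ = 2) (hff : ∀ i j, i ≠ j → 2 ≤ ‖f i - f j‖)
    (hfw : ∀ i, f i = w ∨ 2 ≤ ‖f i - w‖) : ∃ i, f i = hexRoot * w := by
  have hπ := Real.pi_pos
  have hf0 : ∀ i, f i ≠ 0 := fun i h => by simpa [h] using hf i
  choose b hb0 hb1 hb using fun i => exists_angle ((hf i).trans hw.symm) (hf0 i)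
  have hexp : ∀ i, f i = w * Complex.exp (-(b i : ℝ) * Complex.I) := fun i => by
    rw [← hb i, mul_assoc, ← Complex.exp_add]
    ring_nf
    simp
  have hsep : ∀ i j, i ≠ j → Real.pi / 3 ≤ |b i - b j| := by
    intro i j hij
    have h1 := hff i j hij
    rw [hexp i, hexp j, ← mul_sub, norm_mul, hw] at h1
    rw [show b i - b j = -(-b i - -b j) by ring, abs_neg]
    refine pi_div_three_le_of_one_le_norm ?_
    push_cast
    linarith
  have hk : ∀ i, ⌊b i / (Real.pi / 3)⌋₊ < 6 := fun i => by
    rw [Nat.floor_lt (div_nonneg (hb0 i) (by positivity)), div_lt_iff₀ (by positivity)]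
    push_cast
    linarith [hb1 i]
  have hfloor : ∀ i, (⌊b i / (Real.pi / 3)⌋₊ : ℝ) * (Real.pi / 3) ≤ b i ∧
      b i < (⌊b i / (Real.pi / 3)⌋₊ + 1) * (Real.pi / 3) := fun i => by
    rw [← le_div_iff₀ (by positivity), ← div_lt_iff₀ (by positivity)]
    exact ⟨Nat.floor_le (div_nonneg (hb0 i) (by positivity)), Nat.lt_floor_add_one _⟩
  have hinj : Function.Injective fun i => (⟨_, hk i⟩ : Fin 6) := by
    intro i j hij
    by_contra hne
    have h1 := hsep i j hne
    have h2 := hfloor i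
    have h3 := hfloor j
    rw [Fin.mk.injEq] at hij
    rw [hij] at h2
    refine absurd h1 (not_le.2 (abs_lt.2 ⟨?_, ?_⟩)) <;> linarith [h2.1, h2.2, h3.1, h3.2]
  obtain ⟨i, hi⟩ := Finite.injective_iff_surjective.1 hinj 5
  have hi5 : ⌊b i / (Real.pi / 3)⌋₊ = 5 := by
    have := congrArg Fin.val hi
    simpa using this
  have h5 := (hfloor i).1
  rw [hi5] at h5
  push_cast at h5
  have hne : f i ≠ w := by
    intro h
    have h1 : Complex.exp (b i * Complex.I) = 1 := by
      have := hb i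
      rw [h] at this
      exact mul_left_cancel₀ (by rw [← h]; exact hf0 i) (this.trans (mul_one w).symm)
    have h2 := congrArg Complex.re h1
    rw [Complex.exp_ofReal_mul_I_re, Complex.one_re] at h2
    rw [Real.cos_eq_one_iff_of_lt_of_lt (by linarith) (hb1 i)] at h2
    linarith
  have hb5 : b i = 5 * (Real.pi / 3) := by
    refine le_antisymm ?_ h5
    have h1 := (hfw i).resolve_left hne
    have h2 : f i - w = w * (Complex.exp ((2 * Real.pi - b i : ℝ) * Complex.I)
        - Complex.exp ((0 : ℝ) * Complex.I)) := by
      have : ((2 * Real.pi - b i : ℝ) : ℂ) * Complex.I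
        = 2 * Real.pi * Complex.I + -(b i : ℝ) * Complex.I := by push_cast; ring
      rw [this, Complex.exp_add, Complex.exp_two_pi_mul_I, one_mul, mul_sub, ← hexp i]
      simp
    rw [h2, norm_mul, hw] at h1
    have h3 := pi_div_three_le_of_one_le_norm (by linarith)
    rw [sub_zero, abs_of_pos (by linarith [hb1 i])] at h3
    linarith
  refine ⟨i, ?_⟩
  rw [hexp i, mul_comm, hexRoot]
  congr 1
  have : (-(b i : ℝ) : ℂ) * Complex.I
      = (Real.pi / 3 : ℝ) * Complex.I - 2 * Real.pi * Complex.I := by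
    rw [hb5]; push_cast; ring
  rw [this, Complex.exp_sub, Complex.exp_two_pi_mul_I, div_one]

/-- The point of the triangular lattice with coordinates `(m, k)`. -/
def hexPoint (m k : ℤ) : ℂ := 2 * m + 2 * k * hexRoot

/-- The triangular lattice rotated by `u` and translated by `a`. -/
def hexCoset (a u : ℂ) : Set ℂ := {z | ∃ m k : ℤ, z = a + u * hexPoint m k}

lemma hexPoint_re (m k : ℤ) : (hexPoint m k).re = 2 * m + k := by
  simp [hexPoint, hexRoot_re]
  ring

lemma hexPoint_im (m k : ℤ) : (hexPoint m k).im = √3 * k := by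
  simp [hexPoint, hexRoot_im]; ring

lemma hexPoint_sub (m k m' k' : ℤ) :
    hexPoint m k - hexPoint m' k' = hexPoint (m - m') (k - k') := by
  simp only [hexPoint]; push_cast; ring

lemma hexPoint_add (m k m' k' : ℤ) :
    hexPoint m k + hexPoint m' k' = hexPoint (m + m') (k + k') := by
  simp only [hexPoint]; push_cast; ring

lemma two_le_norm_hexPoint {m k : ℤ} (h : ¬ (m = 0 ∧ k = 0)) : 2 ≤ ‖hexPoint m k‖ := by
  refine le_of_sq_le_sq ?_ (norm_nonneg _)
  rw [Complex.sq_norm, Complex.normSq_apply, hexPoint_re, hexPoint_im]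
  have h1 : 1 ≤ m ^ 2 + m * k + k ^ 2 := by
    by_contra! h2
    have h3 : k = 0 := by
      have : 3 * k ^ 2 < 4 := by nlinarith [sq_nonneg (2 * m + k)]
      have : k ^ 2 < 2 := by linarith
      have h4 : -1 ≤ k := by nlinarith
      have h5 : k ≤ 1 := by nlinarith
      interval_cases k
      · nlinarith [show 0 ≤ m * (m - 1) by rcases le_or_gt m 0 with h | h <;> nlinarith]
      · rfl
      · nlinarith [show 0 ≤ m * (m + 1) by rcases lt_or_ge m 0 with h | h <;> nlinarith]
    subst h3
    have : m ≠ 0 := fun h' => h ⟨h', rfl⟩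
    have : 0 < m ^ 2 := by positivity
    nlinarith
  have h2 : (1 : ℝ) ≤ m ^ 2 + m * k + k ^ 2 := by exact_mod_cast h1
  nlinarith [Real.sq_sqrt (show (0 : ℝ) ≤ 3 by norm_num)]

lemma twoSeparated_hexCoset (a : ℂ) {u : ℂ} (hu : ‖u‖ = 1) : TwoSeparated (hexCoset a u) := by
  rintro _ ⟨m, k, rfl⟩ _ ⟨m', k', rfl⟩ hne
  rw [dist_add_left, dist_eq_norm, ← mul_sub, norm_mul, hu, one_mul, hexPoint_sub]
  refine two_le_norm_hexPoint ?_
  rintro ⟨h1, h2⟩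
  exact hne (by rw [sub_eq_zero.1 h1, sub_eq_zero.1 h2])

lemma exists_hexCoset_dist_le (a : ℂ) {u : ℂ} (hu : ‖u‖ = 1) (z : ℂ) :
    ∃ y ∈ hexCoset a u, dist z y ≤ √3 := by
  have hu0 : u ≠ 0 := by rintro rfl; simp at hu
  set v := (z - a) / u with hv
  set t := v.im / √3 with ht
  set s := (v.re - t) / 2 with hs
  refine ⟨_, ⟨round s, round t, rfl⟩, ?_⟩
  have h1 : z - (a + u * hexPoint (round s) (round t)) = u * (v - hexPoint (round s) (round t)) := by
    rw [mul_sub, hv, mul_div_cancel₀ _ hu0]; ring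
  rw [dist_eq_norm, h1, norm_mul, hu, one_mul]
  refine Real.le_sqrt_of_sq_le ?_
  rw [Complex.sq_norm, Complex.normSq_apply, Complex.sub_re, Complex.sub_im, hexPoint_re,
    hexPoint_im]
  have h2 : v.im = √3 * t := by rw [ht]; field_simp
  have h3 : v.re = 2 * s + t := by rw [hs]; ring
  have h4 := abs_le.1 (abs_sub_round s)
  have h5 := abs_le.1 (abs_sub_round t)
  rw [h2, h3]
  set p := s - round s with hp
  set q := t - round t with hq
  have h6 : (2 * s + t - (2 * (round s : ℝ) + round t)) = 2 * p + q := by rw [hp, hq]; ring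
  have h7 : √3 * t - √3 * (round t : ℝ) = √3 * q := by rw [hq]; ring
  rw [h6, h7]
  have h8 : √3 * q * (√3 * q) = 3 * q ^ 2 := by
    nlinarith [Real.mul_self_sqrt (show (0 : ℝ) ≤ 3 by norm_num)]
  rw [h8]
  nlinarith [mul_nonneg (sub_nonneg.2 h4.1) (sub_nonneg.2 h4.2),
    mul_nonneg (sub_nonneg.2 h5.1) (sub_nonneg.2 h5.2)]

/-- The triangular lattice is saturated. -/
lemma TwoSeparated.eq_hexCoset {S : Set ℂ} (hS : TwoSeparated S) {a u : ℂ} (hu : ‖u‖ = 1)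
    (h : hexCoset a u ⊆ S) : S = hexCoset a u := by
  refine Set.Subset.antisymm (fun z hz => ?_) h
  obtain ⟨y, hy, hzy⟩ := exists_hexCoset_dist_le a hu z
  rwa [hS.eq_of_dist_lt hz (h hy) (hzy.trans_lt sqrt_three_bounds.2)]

/-- A separated set in which every point has six neighbors at minimal distance contains a
triangular lattice. -/
lemma exists_hexCoset_subset {L : Set ℂ} (hL : TwoSeparated L) (h0 : 0 ∈ L)
    (hnb : ∀ x ∈ L, ∃ f : Fin 6 → ℂ, Function.Injective f ∧ ∀ i, f i ∈ L ∧ dist (f i) x = 2) :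
    ∃ u : ℂ, ‖u‖ = 1 ∧ hexCoset 0 u ⊆ L := by
  have step : ∀ x ∈ L, ∀ w : ℂ, ‖w‖ = 2 → x + w ∈ L → ∀ k : ℕ, x + hexRoot ^ k * w ∈ L := by
    intro x hx w hw hxw k
    induction k with
    | zero => simpa using hxw
    | succ k ih =>
      obtain ⟨f, hinj, hf⟩ := hnb x hx
      have hn : ‖hexRoot ^ k * w‖ = 2 := by
        rw [norm_mul, norm_pow, norm_hexRoot, one_pow, one_mul, hw]
      obtain ⟨i, hi⟩ := hexRoot_mul_mem_of_six_points hn (f := fun i => f i - x)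
        (fun i => by rw [← dist_eq_norm]; exact (hf i).2)
        (fun i j hij => by
          rw [sub_sub_sub_cancel_right, ← dist_eq_norm]
          exact hL (hf i).1 (hf j).1 (hinj.ne hij))
        (fun i => by
          by_cases h : f i = x + hexRoot ^ k * w
          · left; rw [h]; ring
          · right
            have : 2 ≤ dist (f i) (x + hexRoot ^ k * w) := hL (hf i).1 ih h
            rwa [dist_eq_norm, ← sub_sub] at this)
      have : f i = x + hexRoot ^ (k + 1) * w := by
        rw [pow_succ', mul_assoc, ← hi]; ring
      rw [← this]
      exact (hf i).1
  obtain ⟨f, -, hf⟩ := hnb 0 h0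
  set w := f 0 with hw
  have hwn : ‖w‖ = 2 := by have := (hf 0).2; rwa [dist_zero_right] at this
  have move : ∀ j : ℕ, ∀ x, (x ∈ L ∧ ∀ k : ℕ, x + hexRoot ^ k * w ∈ L) →
      (x + hexRoot ^ j * w ∈ L ∧ ∀ k : ℕ, x + hexRoot ^ j * w + hexRoot ^ k * w ∈ L) := by
    rintro j x ⟨hx, hxk⟩
    refine ⟨hxk j, fun k => ?_⟩
    have h1 := step _ (hxk j) (hexRoot ^ (j + 3) * w)
      (by rw [norm_mul, norm_pow, norm_hexRoot, one_pow, one_mul, hwn])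
      (by rw [pow_add, hexRoot_pow_three]; simpa using hx) (k + 5 * j + 3)
    have h2 : hexRoot ^ (k + 5 * j + 3) * (hexRoot ^ (j + 3) * w) = hexRoot ^ k * w := by
      rw [← mul_assoc, ← pow_add, show k + 5 * j + 3 + (j + 3) = k + 6 * (j + 1) by ring, pow_add,
        pow_mul, hexRoot_pow_six, one_pow, mul_one]
    rwa [h2] at h1
  have base : (0 : ℂ) ∈ L ∧ ∀ k : ℕ, 0 + hexRoot ^ k * w ∈ L :=
    ⟨h0, step 0 h0 w hwn (by rw [zero_add]; exact (hf 0).1)⟩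
  have row : ∀ m : ℤ, (m * w ∈ L ∧ ∀ k : ℕ, m * w + hexRoot ^ k * w ∈ L) := by
    intro m
    induction m with
    | zero => simpa using base
    | succ m ih =>
      have := move 0 _ ih
      rwa [pow_zero, show (((m : ℤ) : ℂ) * w + 1 * w) = ((m + 1 : ℤ) : ℂ) * w by push_cast; ring]
        at this
    | pred m ih =>
      have := move 3 _ ih
      rwa [hexRoot_pow_three, show (((-m : ℤ) : ℂ) * w + -1 * w) = ((-m - 1 : ℤ) : ℂ) * w by
        push_cast; ring] at this
  have all : ∀ m k : ℤ, (m * w + k * (hexRoot * w) ∈ L ∧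
      ∀ j : ℕ, m * w + k * (hexRoot * w) + hexRoot ^ j * w ∈ L) := by
    intro m k
    induction k with
    | zero => simpa using row m
    | succ k ih =>
      have := move 1 _ ih
      rwa [pow_one, show ((m : ℂ) * w + ((k : ℤ) : ℂ) * (hexRoot * w) + hexRoot * w) =
        m * w + ((k + 1 : ℤ) : ℂ) * (hexRoot * w) by push_cast; ring] at this
    | pred k ih =>
      have := move 4 _ ih
      rwa [pow_succ, hexRoot_pow_three, show ((m : ℂ) * w + ((-k : ℤ) : ℂ) * (hexRoot * w) +
        -1 * hexRoot * w) = m * w + ((-k - 1 : ℤ) : ℂ) * (hexRoot * w) by push_cast; ring] at this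
  refine ⟨w / 2, by rw [norm_div, hwn]; norm_num, ?_⟩
  rintro _ ⟨m, k, rfl⟩
  have := (all m k).1
  rwa [show (0 : ℂ) + w / 2 * hexPoint m k = m * w + k * (hexRoot * w) by rw [hexPoint]; ring]

lemma TwoSeparated.two_le_dist_of_tendsto {S : Set ℂ} (hS : TwoSeparated S) {𝒰 : Filter ℕ}
    [𝒰.NeBot] {c s t : ℕ → ℂ} {x y : ℂ} (hs : ∀ n, s n ∈ S) (ht : ∀ n, t n ∈ S)
    (hsx : Tendsto (fun n => s n - c n) 𝒰 (nhds x)) (hty : Tendsto (fun n => t n - c n) 𝒰 (nhds y))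
    (hne : ∀ᶠ n in 𝒰, s n ≠ t n) : 2 ≤ dist x y := by
  refine ge_of_tendsto (hsx.dist hty) (hne.mono fun n hn => ?_)
  rw [dist_sub_right]
  exact hS (hs n) (ht n) hn

/-- If every point in arbitrarily large balls has six near neighbors, then translates of the set
approximate a triangular lattice on arbitrarily large balls. -/
lemma exists_hexCoset_approx {S : Set ℂ} (hS : TwoSeparated S)
    (hgood : ∀ n : ℕ, ∃ c ∈ S, ∀ p ∈ S, dist p c < n + 1 → HasSixNear S (1 / (n + 4)) p) :
    ∃ u : ℂ, ‖u‖ = 1 ∧ ∀ ε > 0, ∀ r : ℝ, ∃ c : ℂ, ∀ h ∈ hexCoset 0 u, ‖h‖ < r →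
      ∃ s ∈ S, dist (s - c) h ≤ ε := by
  choose c hcS hc using hgood
  set 𝒰 : Ultrafilter ℕ := hyperfilter ℕ with h𝒰
  have h𝒰top : (𝒰 : Filter ℕ) ≤ atTop := Nat.hyperfilter_le_atTop
  set L : Set ℂ := {x | ∃ s : ℕ → ℂ, (∀ n, s n ∈ S) ∧
    Tendsto (fun n => s n - c n) 𝒰 (nhds x)} with hLdef
  have hL : TwoSeparated L := by
    rintro x ⟨s, hs, hsx⟩ y ⟨t, ht, hty⟩ hxy
    refine hS.two_le_dist_of_tendsto hs ht hsx hty ?_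
    rw [Ultrafilter.eventually_not]
    intro heq
    exact hxy (tendsto_nhds_unique (hsx.congr' (heq.mono fun n hn => by rw [hn])) hty)
  have h0 : (0 : ℂ) ∈ L := ⟨c, hcS, by simp⟩
  have hnb : ∀ x ∈ L, ∃ f : Fin 6 → ℂ, Function.Injective f ∧ ∀ i, f i ∈ L ∧ dist (f i) x = 2 := by
    rintro x ⟨s, hs, hsx⟩
    have hbd : ∀ᶠ n in (𝒰 : Filter ℕ), dist (s n) (c n) < ‖x‖ + 1 := by
      filter_upwards [hsx.norm.eventually (gt_mem_nhds (lt_add_one ‖x‖))] with n hn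
      rwa [dist_eq_norm]
    have hsix : ∀ᶠ n : ℕ in (𝒰 : Filter ℕ), HasSixNear S (1 / (n + 4)) (s n) := by
      filter_upwards [hbd, h𝒰top (tendsto_natCast_atTop_atTop.eventually_ge_atTop (‖x‖))]
        with n hn hn2
      exact hc n _ (hs n) (by linarith [show ‖x‖ ≤ (n : ℝ) from hn2])
    have hsel : ∀ n : ℕ, ∃ g : Fin 6 → ℂ, (∀ i, g i ∈ S) ∧ (HasSixNear S (1 / (n + 4)) (s n) →
        Function.Injective g ∧ ∀ i, g i ≠ s n ∧ dist (g i) (s n) ≤ 2 + 1 / (n + 4)) := by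
      intro n
      by_cases h : HasSixNear S (1 / (n + 4)) (s n)
      · obtain ⟨g, hg, hg'⟩ := h
        exact ⟨g, fun i => (hg' i).1, fun _ => ⟨hg, fun i => (hg' i).2⟩⟩
      · exact ⟨fun _ => s n, fun _ => hs n, fun h' => absurd h' h⟩
    choose g hgS hg using hsel
    have hlim : ∀ i, ∃ y, Tendsto (fun n => g n i - c n) 𝒰 (nhds y) := by
      intro i
      obtain ⟨y, -, hy⟩ := (isCompact_closedBall (0 : ℂ) (‖x‖ + 4)).ultrafilter_le_nhds
        (𝒰.map fun n => g n i - c n) (by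
          rw [le_principal_iff, Ultrafilter.mem_coe, Ultrafilter.mem_map]
          filter_upwards [hbd, hsix] with n hn hn2
          have h1 := ((hg n hn2).2 i).2
          have h2 : (1 : ℝ) / (n + 4) ≤ 1 := by
            rw [div_le_one (by positivity)]
            linarith [show (0 : ℝ) ≤ n from Nat.cast_nonneg n]
          rw [Set.mem_preimage, mem_closedBall_zero_iff, ← dist_eq_norm]
          linarith [dist_triangle (g n i) (s n) (c n)])
      exact ⟨y, hy⟩
    choose y hy using hlim
    refine ⟨y, fun i j hij => ?_, fun i => ⟨⟨fun n => g n i, fun n => hgS n i, hy i⟩,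
      le_antisymm ?_ ?_⟩⟩
    · by_contra hne
      have h1 := hS.two_le_dist_of_tendsto (fun n => hgS n i) (fun n => hgS n j) (hy i) (hy j)
        (hsix.mono fun n hn => (hg n hn).1.ne hne)
      rw [hij, dist_self] at h1
      norm_num at h1
    · have h1 : Tendsto (fun n : ℕ => (2 : ℝ) + 1 / ((n : ℝ) + 4)) 𝒰 (nhds (2 + 0)) := by
        refine (tendsto_const_nhds.add ?_).mono_left h𝒰top
        have h2 := tendsto_const_div_atTop_nhds_zero_nat (1 : ℝ)
        simpa using (tendsto_add_atTop_iff_nat 4).2 h2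
      rw [add_zero] at h1
      refine le_of_tendsto_of_tendsto ((hy i).dist hsx) h1 (hsix.mono fun n hn => ?_)
      simp only [dist_sub_right]
      exact ((hg n hn).2 i).2
    · exact hS.two_le_dist_of_tendsto (fun n => hgS n i) hs (hy i) hsx
        (hsix.mono fun n hn => ((hg n hn).2 i).1)
  obtain ⟨u, hu, huL⟩ := exists_hexCoset_subset hL h0 hnb
  refine ⟨u, hu, fun ε hε r => ?_⟩
  have hfin := (twoSeparated_hexCoset 0 hu).finite_inter_ball 0 r
  have hev : ∀ᶠ n in (𝒰 : Filter ℕ), ∀ h ∈ hexCoset 0 u ∩ ball 0 r,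
      ∃ s ∈ S, dist (s - c n) h ≤ ε := by
    refine (eventually_all_finite hfin).2 fun h hh => ?_
    obtain ⟨s, hs, hsh⟩ := huL hh.1
    filter_upwards [hsh.eventually (closedBall_mem_nhds h hε)] with n hn
    exact ⟨s n, hs n, hn⟩
  obtain ⟨n, hn⟩ := hev.exists
  exact ⟨c n, fun h hh hr => hn h ⟨hh, mem_ball_zero_iff.2 hr⟩⟩

/-- The identification of the complex plane with the Euclidean plane. -/
def planeEquiv : ℂ ≃ₗᵢ[ℝ] Euc 2 := Complex.orthonormalBasisOneI.repr

/-- The closed unit disk in the Euclidean plane around a point of the complex plane. -/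
def unitDisk (z : ℂ) : Set (Euc 2) := closedBall (planeEquiv z) 1

lemma dist_le_hausdorffDist_unitDisk (a b : ℂ) :
    dist a b ≤ hausdorffDist (unitDisk a) (unitDisk b) := by
  rcases eq_or_ne a b with rfl | hab
  · simp
  have hd : 0 < dist a b := dist_pos.2 hab
  set z : ℂ := a + ((dist a b)⁻¹ : ℝ) • (a - b) with hz
  have hza : dist z a = 1 := by
    rw [hz, dist_eq_norm, add_sub_cancel_left, norm_smul, Real.norm_of_nonneg (by positivity),
      ← dist_eq_norm, inv_mul_cancel₀ hd.ne']
  have hzb : dist z b = dist a b + 1 := by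
    rw [hz, dist_eq_norm, show a + ((dist a b)⁻¹ : ℝ) • (a - b) - b
      = (1 + (dist a b)⁻¹ : ℝ) • (a - b) by rw [add_smul, one_smul]; ring, norm_smul,
      Real.norm_of_nonneg (by positivity), ← dist_eq_norm, add_mul, inv_mul_cancel₀ hd.ne', one_mul]
  have hmem : planeEquiv z ∈ unitDisk a := by
    rw [unitDisk, mem_closedBall, planeEquiv.dist_map, hza]
  have hne : hausdorffEDist (unitDisk a) (unitDisk b) ≠ ⊤ :=
    hausdorffEDist_ne_top_of_nonempty_of_bounded (nonempty_closedBall.2 zero_le_one)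
      (nonempty_closedBall.2 zero_le_one) isBounded_closedBall isBounded_closedBall
  refine le_trans ?_ (infDist_le_hausdorffDist_of_mem hmem hne)
  refine (le_infDist (nonempty_closedBall.2 zero_le_one)).2 fun w hw => ?_
  have h1 := dist_triangle (planeEquiv z) w (planeEquiv b)
  rw [planeEquiv.dist_map, hzb] at h1
  linarith [mem_closedBall.1 hw]

lemma unitDisk_injective : Function.Injective unitDisk := by
  intro a b h
  have h1 := dist_le_hausdorffDist_unitDisk a b
  rw [h, hausdorffDist_self_zero] at h1
  exact dist_le_zero.1 h1

lemma hausdorffDist_unitDisk_le (a b : ℂ) :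
    hausdorffDist (unitDisk a) (unitDisk b) ≤ dist a b := by
  have key : ∀ a b : ℂ, ∀ x ∈ unitDisk a, ∃ y ∈ unitDisk b, dist x y ≤ dist a b := by
    intro a b x hx
    refine ⟨x + (planeEquiv b - planeEquiv a), ?_, ?_⟩
    · rw [unitDisk, mem_closedBall, dist_eq_norm] at *
      convert hx using 2
      abel
    · rw [dist_self_add_right, ← dist_eq_norm, planeEquiv.dist_map, dist_comm]
  refine hausdorffDist_le_of_mem_dist dist_nonneg (key a b) fun x hx => ?_
  obtain ⟨y, hy, hxy⟩ := key b a x hx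
  exact ⟨y, hy, by rwa [dist_comm a b]⟩

lemma norm_lt_of_unitDisk_inter_ball {z : ℂ} {r : ℝ}
    (h : (unitDisk z ∩ ball (0 : Euc 2) r).Nonempty) : ‖z‖ < r + 1 := by
  obtain ⟨x, hx, hxr⟩ := h
  rw [← planeEquiv.norm_map]
  rw [unitDisk, mem_closedBall, dist_comm, dist_eq_norm] at hx
  linarith [norm_le_norm_add_norm_sub' (planeEquiv z) x, mem_ball_zero_iff.1 hxr]

lemma unitDisk_inter_ball_nonempty {z : ℂ} {r : ℝ} (h : ‖z‖ < r) :
    (unitDisk z ∩ ball (0 : Euc 2) r).Nonempty :=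
  ⟨planeEquiv z, mem_closedBall_self zero_le_one, by rwa [mem_ball_zero_iff, planeEquiv.norm_map]⟩

lemma translatePacking_unitDisk (w : ℂ) (S : Set ℂ) :
    translatePacking (planeEquiv w) (unitDisk '' S) = unitDisk '' ((· + w) '' S) := by
  rw [translatePacking, Set.image_image, Set.image_image]
  refine Set.image_congr fun z _ => ?_
  simp [unitDisk]

lemma TwoSeparated.isDiskPacking {S : Set ℂ} (hS : TwoSeparated S) :
    IsDiskPacking (unitDisk '' S) := by
  refine ⟨?_, ?_⟩
  · rintro _ ⟨z, -, rfl⟩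
    exact ⟨_, rfl⟩
  · rintro _ ⟨z, hz, rfl⟩ _ ⟨w, hw, rfl⟩ hne
    have h := hS hz hw fun h => hne (by rw [h])
    rw [unitDisk, unitDisk, interior_closedBall _ one_ne_zero, interior_closedBall _ one_ne_zero,
      ← Set.disjoint_iff_inter_eq_empty]
    refine ball_disjoint_ball ?_
    rw [planeEquiv.dist_map]
    linarith

/-- A packing of unit disks is given by a separated set of centers. -/
lemma IsDiskPacking.exists_centers {P : Set (Set (Euc 2))} (hP : IsDiskPacking P) :
    ∃ S : Set ℂ, TwoSeparated S ∧ P = unitDisk '' S := by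
  refine ⟨{z | unitDisk z ∈ P}, fun a ha b hb hab => ?_, ?_⟩
  · have h := hP.2 ha hb (unitDisk_injective.ne hab)
    rw [unitDisk, unitDisk, interior_closedBall _ one_ne_zero, interior_closedBall _ one_ne_zero,
      ← Set.disjoint_iff_inter_eq_empty, disjoint_ball_ball_iff one_pos one_pos,
      planeEquiv.dist_map] at h
    linarith
  · ext D
    constructor
    · intro hD
      obtain ⟨c, rfl⟩ := hP.1 D hD
      exact ⟨planeEquiv.symm c, by simpa [unitDisk] using hD, by simp [unitDisk]⟩
    · rintro ⟨z, hz, rfl⟩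
      exact hz

lemma PackingClose.mono {P Q : Set (Set (Euc 2))} {ε ε' : ℝ} (hε : 0 < ε) (hεε' : ε ≤ ε')
    (h : PackingClose ε P Q) : PackingClose ε' P Q := by
  obtain ⟨R, h1, h2, h3⟩ := h
  have hsub : ball (0 : Euc 2) (1 / ε') ⊆ ball 0 (1 / ε) :=
    ball_subset_ball (one_div_le_one_div_of_le hε hεε')
  exact ⟨R, fun A B h => ⟨(h1 A B h).1, (h1 A B h).2.1, (h1 A B h).2.2.trans hεε'⟩,
    fun A hA hne => h2 A hA (hne.mono (Set.inter_subset_inter_right _ hsub)),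
    fun B hB hne => h3 B hB (hne.mono (Set.inter_subset_inter_right _ hsub))⟩

lemma packingClose_unitDisk {S T : Set ℂ} (hS : TwoSeparated S) (hT : TwoSeparated T) {ε : ℝ}
    (hε : ε < 1) (h1 : ∀ s ∈ S, ‖s‖ < 1 / ε + 1 → ∃ t ∈ T, dist s t ≤ ε)
    (h2 : ∀ t ∈ T, ‖t‖ < 1 / ε + 1 → ∃ s ∈ S, dist s t ≤ ε) :
    PackingClose ε (unitDisk '' S) (unitDisk '' T) := by
  refine ⟨fun A B => ∃ s ∈ S, ∃ t ∈ T, A = unitDisk s ∧ B = unitDisk t ∧ dist s t ≤ ε, ?_, ?_, ?_⟩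
  · rintro _ _ ⟨s, hs, t, ht, rfl, rfl, hst⟩
    exact ⟨⟨s, hs, rfl⟩, ⟨t, ht, rfl⟩, (hausdorffDist_unitDisk_le s t).trans hst⟩
  · rintro _ ⟨s, hs, rfl⟩ hne
    obtain ⟨t, ht, hst⟩ := h1 s hs (norm_lt_of_unitDisk_inter_ball hne)
    refine ⟨unitDisk t, ⟨s, hs, t, ht, rfl, rfl, hst⟩, ?_⟩
    rintro _ ⟨s', -, t', ht', hss', rfl, hst'⟩
    rw [← unitDisk_injective hss'] at hst'
    rw [hT.eq_of_dist_lt ht' ht (by linarith [dist_triangle_left t' t s])]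
  · rintro _ ⟨t, ht, rfl⟩ hne
    obtain ⟨s, hs, hst⟩ := h2 t ht (norm_lt_of_unitDisk_inter_ball hne)
    refine ⟨unitDisk s, ⟨s, hs, t, ht, rfl, rfl, hst⟩, ?_⟩
    rintro _ ⟨s', hs', t', -, rfl, htt', hst'⟩
    rw [← unitDisk_injective htt'] at hst'
    rw [hS.eq_of_dist_lt hs' hs (by linarith [dist_triangle_right s' s t])]

lemma PackingClose.exists_dist_le_right {S T : Set ℂ} {ε : ℝ}
    (h : PackingClose ε (unitDisk '' S) (unitDisk '' T)) {s : ℂ} (hs : s ∈ S)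
    (hsr : ‖s‖ < 1 / ε) : ∃ t ∈ T, dist s t ≤ ε := by
  obtain ⟨R, h1, h2, -⟩ := h
  obtain ⟨B, hB, -⟩ := h2 _ ⟨s, hs, rfl⟩ (unitDisk_inter_ball_nonempty hsr)
  obtain ⟨-, ⟨t, ht, rfl⟩, hst⟩ := h1 _ _ hB
  exact ⟨t, ht, (dist_le_hausdorffDist_unitDisk s t).trans hst⟩

lemma PackingClose.exists_dist_le_left {S T : Set ℂ} {ε : ℝ}
    (h : PackingClose ε (unitDisk '' S) (unitDisk '' T)) {t : ℂ} (ht : t ∈ T)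
    (htr : ‖t‖ < 1 / ε) : ∃ s ∈ S, dist s t ≤ ε := by
  obtain ⟨R, h1, -, h3⟩ := h
  obtain ⟨A, hA, -⟩ := h3 _ ⟨t, ht, rfl⟩ (unitDisk_inter_ball_nonempty htr)
  obtain ⟨⟨s, hs, rfl⟩, -, hst⟩ := h1 _ _ hA
  exact ⟨s, hs, (dist_le_hausdorffDist_unitDisk s t).trans hst⟩

/-- If translates of a separated set approximate a triangular lattice on arbitrarily large balls,
then the hexagonal packing is a limit of the corresponding disk packing. -/
lemma TwoSeparated.isLimitOf_hexCoset {S : Set ℂ} (hS : TwoSeparated S) {u : ℂ} (hu : ‖u‖ = 1)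
    (happ : ∀ ε > 0, ∀ r : ℝ, ∃ c : ℂ, ∀ h ∈ hexCoset 0 u, ‖h‖ < r →
      ∃ s ∈ S, dist (s - c) h ≤ ε) :
    IsLimitOf (unitDisk '' hexCoset 0 u) (unitDisk '' S) := by
  have hε : ∀ n : ℕ, (0 : ℝ) < 1 / ((n : ℝ) + 5) := fun n => by positivity
  choose c hc using fun n : ℕ => happ _ (hε n) ((n : ℝ) + 8)
  have hshift : ∀ w : ℂ, TwoSeparated ((· + w) '' S) := by
    rintro w _ ⟨a, ha, rfl⟩ _ ⟨b, hb, rfl⟩ hne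
    rw [dist_add_right]
    exact hS ha hb fun h => hne (by rw [h])
  have hclose : ∀ n : ℕ, PackingClose (1 / ((n : ℝ) + 5))
      (translatePacking (planeEquiv (-c n)) (unitDisk '' S)) (unitDisk '' hexCoset 0 u) := by
    intro n
    have hn : (0 : ℝ) ≤ n := n.cast_nonneg
    have hle : 1 / ((n : ℝ) + 5) ≤ 1 / 5 := one_div_le_one_div_of_le (by norm_num) (by linarith)
    have hsqrt : √3 < 1.8 := by
      rw [Real.sqrt_lt' (by norm_num)]
      norm_num
    rw [translatePacking_unitDisk]
    refine packingClose_unitDisk (hshift _) (twoSeparated_hexCoset 0 hu) (by linarith) ?_ ?_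
    · rintro _ ⟨s, hs, rfl⟩ hsn
      rw [one_div_one_div] at hsn
      obtain ⟨y, hy, hsy⟩ := exists_hexCoset_dist_le 0 hu (s + -c n)
      have hyn : ‖y‖ < n + 8 := by
        have h1 := norm_le_norm_add_norm_sub' y (s + -c n)
        rw [← dist_eq_norm, dist_comm] at h1
        linarith
      obtain ⟨s', hs', hd⟩ := hc n y hy hyn
      rw [sub_eq_add_neg] at hd
      have h1 : s = s' := by
        refine hS.eq_of_dist_lt hs hs' ?_
        rw [← dist_add_right s s' (-c n)]
        have := dist_triangle_right (s + -c n) (s' + -c n) y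
        linarith
      exact ⟨y, hy, by rwa [h1]⟩
    · intro y hy hyn
      rw [one_div_one_div] at hyn
      obtain ⟨s, hs, hd⟩ := hc n y hy (by linarith)
      exact ⟨s + -c n, ⟨s, hs, rfl⟩, by rwa [← sub_eq_add_neg]⟩
  refine ⟨fun n => planeEquiv (-c n), fun ε hε0 => ?_⟩
  have hlim : Tendsto (fun n : ℕ => 1 / ((n : ℝ) + 5)) atTop (nhds 0) := by
    have h2 := tendsto_const_div_atTop_nhds_zero_nat (1 : ℝ)
    simpa using (tendsto_add_atTop_iff_nat 5).2 h2
  filter_upwards [hlim.eventually (gt_mem_nhds hε0)] with n hn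
  exact (hclose n).mono (hε n) hn.le

/-- A limit of translates of a triangular lattice packing is a translate of it. -/
lemma TwoSeparated.exists_eq_hexCoset_of_isLimitOf {S : Set ℂ} (hS : TwoSeparated S)
    (hne : S.Nonempty) {u : ℂ} (hu : ‖u‖ = 1)
    (hlim : IsLimitOf (unitDisk '' S) (unitDisk '' hexCoset 0 u)) : ∃ a, S = hexCoset a u := by
  obtain ⟨a, ha⟩ := hne
  obtain ⟨v, hv⟩ := hlim
  refine ⟨a, hS.eq_hexCoset hu ?_⟩
  rintro _ ⟨m, k, rfl⟩
  set z := a + u * hexPoint m k with hz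
  rw [← hS.isClosed.closure_eq, Metric.mem_closure_iff]
  intro η hη
  have hpos : 0 < ‖a‖ + ‖z‖ + 2 := by positivity
  obtain ⟨ε, hε, hεη, hεr⟩ : ∃ ε > 0, ε ≤ η / 3 ∧ ε ≤ 1 / (‖a‖ + ‖z‖ + 2) :=
    ⟨min (η / 3) (1 / (‖a‖ + ‖z‖ + 2)), by positivity, min_le_left _ _, min_le_right _ _⟩
  have hr : ‖a‖ + ‖z‖ + 2 ≤ 1 / ε := (le_one_div hε hpos).1 hεr
  have hε1 : ε ≤ 1 := hεr.trans ((div_le_one hpos).2 (by linarith [norm_nonneg a, norm_nonneg z]))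
  obtain ⟨n, hn⟩ := (hv ε hε).exists
  beta_reduce at hn
  rw [← planeEquiv.apply_symm_apply (v n), translatePacking_unitDisk] at hn
  set w := planeEquiv.symm (v n)
  obtain ⟨_, ⟨_, ⟨m', k', rfl⟩, rfl⟩, htd⟩ := hn.exists_dist_le_left ha
    (by linarith [norm_nonneg z])
  have hmem : (0 + u * hexPoint (m' + m) (k' + k)) + w ∈ (· + w) '' hexCoset 0 u :=
    ⟨_, ⟨_, _, rfl⟩, rfl⟩
  have hd : dist ((0 + u * hexPoint (m' + m) (k' + k)) + w) z ≤ ε := by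
    rw [hz, ← hexPoint_add]
    convert htd using 1
    rw [dist_eq_norm, dist_eq_norm]
    congr 1
    ring
  obtain ⟨s, hs, hsd⟩ := hn.exists_dist_le_right hmem (by
    have h1 := norm_le_norm_add_norm_sub' ((0 + u * hexPoint (m' + m) (k' + k)) + w) z
    rw [← dist_eq_norm] at h1
    linarith [norm_nonneg a])
  refine ⟨s, hs, ?_⟩
  have := dist_triangle_left z s ((0 + u * hexPoint (m' + m) (k' + k)) + w)
  linarith

lemma TwoSeparated.ballFrac_le {S : Set ℂ} (hS : TwoSeparated S) {r : ℝ} (hr : 0 < r) :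
    ballFrac (unitDisk '' S) 0 r ≤ (S ∩ ball 0 (r + 1)).ncard / r ^ 2 := by
  have hfin := hS.finite_inter_ball 0 (r + 1)
  have hsum : ∑' D : unitDisk '' S, volume ((D : Set (Euc 2)) ∩ ball 0 r)
      ≤ ENNReal.ofReal ((S ∩ ball 0 (r + 1)).ncard * Real.pi) := by
    rw [tsum_image (fun D : Set (Euc 2) => volume (D ∩ ball 0 r)) unitDisk_injective.injOn,
      tsum_subtype S fun z => volume (unitDisk z ∩ ball 0 r),
      tsum_eq_sum (s := hfin.toFinset)]
    · calc ∑ z ∈ hfin.toFinset, S.indicator (fun z => volume (unitDisk z ∩ ball 0 r)) z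
          ≤ ∑ z ∈ hfin.toFinset, ENNReal.ofReal Real.pi := by
            refine Finset.sum_le_sum fun z _ => (Set.indicator_le_self _ _ z).trans ?_
            refine (measure_mono Set.inter_subset_left).trans_eq ?_
            rw [unitDisk, InnerProductSpace.volume_closedBall_of_dim_even (k := 1) (by simp)]
            simp
        _ = _ := by
            rw [Finset.sum_const, nsmul_eq_mul, Set.ncard_eq_toFinset_card _ hfin,
              ENNReal.ofReal_mul (by positivity), ENNReal.ofReal_natCast]
    · intro z hz
      rw [Set.indicator_apply_eq_zero]
      intro hzS
      have hempty : unitDisk z ∩ ball (0 : Euc 2) r = ∅ := by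
        refine Set.not_nonempty_iff_eq_empty.1 fun hne => hz ?_
        rw [Set.Finite.mem_toFinset]
        exact ⟨hzS, mem_ball_zero_iff.2 (norm_lt_of_unitDisk_inter_ball hne)⟩
      rw [hempty, measure_empty]
  have hvol : volume (ball (0 : Euc 2) r) = ENNReal.ofReal (r ^ 2 * Real.pi) := by
    rw [InnerProductSpace.volume_ball_of_dim_even (k := 1) (by simp)]
    simp [ENNReal.ofReal_mul, ENNReal.ofReal_pow hr.le, hr.le]
  have hpos : 0 < r ^ 2 * Real.pi := by positivity
  rw [ballFrac, ENNReal.toReal_div, hvol, ENNReal.toReal_ofReal hpos.le]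
  refine (div_le_div_of_nonneg_right (ENNReal.toReal_le_of_le_ofReal (by positivity) hsum)
    hpos.le).trans_eq ?_
  rw [mul_div_mul_right _ _ Real.pi_pos.ne']

lemma TwoSeparated.eventually_le_ncard {S : Set ℂ} (hS : TwoSeparated S)
    (hd : HasDensity (unitDisk '' S) (Real.pi / √12)) {η : ℝ} (hη : 0 < η) :
    ∀ᶠ r : ℝ in atTop, (Real.pi - η) * r ^ 2 ≤ 2 * √3 * (S ∩ ball 0 (r + 1)).ncard := by
  have h12 : √12 = 2 * √3 := by
    rw [show (12 : ℝ) = 2 ^ 2 * 3 by norm_num, Real.sqrt_mul (by norm_num),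
      Real.sqrt_sq (by norm_num)]
  have h3 : 0 < 2 * √3 := by positivity
  rw [h12] at hd
  filter_upwards [(hd 0).eventually (lt_mem_nhds
    (div_lt_div_of_pos_right (sub_lt_self Real.pi hη) h3)), eventually_gt_atTop 0] with r hr hr0
  have h := hr.trans_le (hS.ballFrac_le hr0)
  rw [div_lt_div_iff₀ h3 (by positivity)] at h
  linarith

/-- The disk packing of a coset of a rotated triangular lattice is congruent to the hexagonal
packing. -/
lemma exists_isometryEquiv_image_hexPacking (a : ℂ) {u : ℂ} (hu : ‖u‖ = 1) :
    ∃ f : Euc 2 ≃ᵢ Euc 2, unitDisk '' hexCoset a u = (fun D => f '' D) '' hexPacking := by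
  have hrot : u ∈ Submonoid.unitSphere ℂ := mem_sphere_zero_iff_norm.2 hu
  let f : Euc 2 ≃ᵢ Euc 2 := planeEquiv.symm.toIsometryEquiv.trans
    ((rotation ⟨u, hrot⟩).toIsometryEquiv.trans
      ((IsometryEquiv.addLeft a).trans planeEquiv.toIsometryEquiv))
  have hf : ∀ z, f (planeEquiv z) = planeEquiv (a + u * z) := by
    intro z
    simpa [f] using rotation_apply ⟨u, hrot⟩ z
  have hhex : ∀ m k : ℤ, (m : ℝ) • pt2 2 0 + (k : ℝ) • pt2 1 (√3) = planeEquiv (hexPoint m k) := by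
    intro m k
    ext i
    fin_cases i
    · simp [pt2, planeEquiv, hexPoint_re]
      ring
    · simp [pt2, planeEquiv, hexPoint_im]
      ring
  have himg : ∀ m k : ℤ, unitDisk (a + u * hexPoint m k)
      = f '' closedBall ((m : ℝ) • pt2 2 0 + (k : ℝ) • pt2 1 (√3)) 1 := by
    intro m k
    rw [f.image_closedBall, hhex, hf, unitDisk]
  refine ⟨f, ?_⟩
  ext D
  constructor
  · rintro ⟨_, ⟨m, k, rfl⟩, rfl⟩
    exact ⟨_, ⟨m, k, rfl⟩, (himg m k).symm⟩
  · rintro ⟨_, ⟨m, k, rfl⟩, rfl⟩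
    exact ⟨_, ⟨m, k, rfl⟩, himg m k⟩

/-- Every uniformly recurrent packing of unit disks in the plane
with density `π/√12` is congruent to the hexagonal packing. -/
theorem uniformly_recurrent_dense_disk_packing_is_hexagonal
    (P : Set (Set (Euc 2))) (hP : IsDiskPacking P)
    (hur : UniformlyRecurrentDisk P)
    (hd : HasDensity P (Real.pi / Real.sqrt 12)) :
    ∃ f : Euc 2 ≃ᵢ Euc 2, P = (fun D => f '' D) '' hexPacking := by
  obtain ⟨S, hS, rfl⟩ := hP.exists_centers
  have hgood : ∀ n : ℕ, ∃ c ∈ S, ∀ p ∈ S, dist p c < n + 1 → HasSixNear S (1 / (n + 4)) p := by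
    intro n
    have hn : (0 : ℝ) ≤ n := n.cast_nonneg
    exact exists_ball_hasSixNear hS (fun η hη => hS.eventually_le_ncard hd hη) (by positivity)
      (one_div_le_one_div_of_le (by norm_num) (by linarith)) (by positivity)
  obtain ⟨u, hu, happ⟩ := exists_hexCoset_approx hS hgood
  obtain ⟨c, hc, -⟩ := hgood 0
  obtain ⟨a, rfl⟩ := hS.exists_eq_hexCoset_of_isLimitOf ⟨c, hc⟩ hu
    (hur _ (twoSeparated_hexCoset 0 hu).isDiskPacking (hS.isLimitOf_hexCoset hu happ))
  exact exists_isometryEquiv_image_hexPacking a hu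
end
end

section
/- For every positive integer n, every body K in Euclidean space ℝ^d has a packing that is simultaneously n-saturated and uniformly dense. -/
open MeasureTheory Metric Filter Pointwise
open scoped ENNReal NNReal

noncomputable section

/-- Linear maps of `ℝ^d` preserving the norm. -/
abbrev Orth (d : ℕ) : Type := {B : Euc d →L[ℝ] Euc d // ∀ x, ‖B x‖ = ‖x‖}

/-- A placement `(B, v)` encodes an isometry `x ↦ B⁻¹ (x - x₀) + v` sending the base point `x₀`
to `v`. -/
abbrev Placement (d : ℕ) : Type := Orth d × Euc d

/-- The isometric copy of `K` given by a placement. -/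
def placed {d : ℕ} (K : Set (Euc d)) (x₀ : Euc d) (t : Placement d) : Set (Euc d) :=
  {y | t.1.1 (y - t.2) + x₀ ∈ K}

/-- The placed copies have pairwise disjoint interiors. -/
def Separated {d : ℕ} (K : Set (Euc d)) (x₀ : Euc d) (T : Set (Placement d)) : Prop :=
  T.Pairwise fun t u => interior (placed K x₀ t) ∩ interior (placed K x₀ u) = ∅

/-- The compact set `K` lies between two balls centered at `x₀`. -/
structure BetweenBalls {d : ℕ} (K : Set (Euc d)) (x₀ : Euc d) (ρ R : ℝ) : Prop where
  isCompact : IsCompact K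
  pos : 0 < ρ
  ball_subset : ball x₀ ρ ⊆ K
  subset_ball : K ⊆ ball x₀ R

namespace Orth

variable {d : ℕ}

/-- A norm-preserving linear map as a linear isometric equivalence. -/
def toEquiv (B : Orth d) : Euc d ≃ₗᵢ[ℝ] Euc d :=
  LinearIsometry.toLinearIsometryEquiv (⟨B.1.toLinearMap, B.2⟩ : Euc d →ₗᵢ[ℝ] Euc d) rfl

instance : CompactSpace (Orth d) := by
  have hc : IsClosed {B : Euc d →L[ℝ] Euc d | ∀ x, ‖B x‖ = ‖x‖} := by
    simp only [Set.ofPred_forall]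
    exact isClosed_iInter fun x => isClosed_eq (by fun_prop) continuous_const
  have hsub : {B : Euc d →L[ℝ] Euc d | ∀ x, ‖B x‖ = ‖x‖} ⊆ closedBall 0 1 := by
    intro B hB
    rw [mem_closedBall_zero_iff]
    exact B.opNorm_le_bound zero_le_one fun x => by rw [hB x, one_mul]
  exact isCompact_iff_compactSpace.1 ((isCompact_closedBall 0 1).of_isClosed_subset hc hsub)

instance : Inhabited (Orth d) := ⟨⟨ContinuousLinearMap.id ℝ _, fun _ => rfl⟩⟩

end Orth

section placed

variable {d : ℕ} {K : Set (Euc d)} {x₀ : Euc d} {ρ R : ℝ}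

/-- The isometry `y ↦ B (y - v) + x₀` attached to a placement. -/
def Placement.chart (x₀ : Euc d) (t : Placement d) : Euc d ≃ᵢ Euc d :=
  ((IsometryEquiv.subRight t.2).trans t.1.toEquiv.toIsometryEquiv).trans
    (IsometryEquiv.addRight x₀)

lemma placed_eq_preimage (t : Placement d) : placed K x₀ t = t.chart x₀ ⁻¹' K := rfl

lemma mem_placed {t : Placement d} {y : Euc d} :
    y ∈ placed K x₀ t ↔ t.1.1 (y - t.2) + x₀ ∈ K := Iff.rfl

lemma mem_interior_placed {t : Placement d} {y : Euc d} :
    y ∈ interior (placed K x₀ t) ↔ t.1.1 (y - t.2) + x₀ ∈ interior K := by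
  rw [placed_eq_preimage]
  have := (t.chart x₀).toHomeomorph.preimage_interior K
  rw [IsometryEquiv.coe_toHomeomorph] at this
  rw [← this]
  rfl

lemma isIsomCopy_placed (t : Placement d) : IsIsomCopy K (placed K x₀ t) :=
  ⟨(t.chart x₀).symm, by
    rw [placed_eq_preimage]
    exact ((t.chart x₀).toEquiv.image_symm_eq_preimage K).symm⟩

lemma IsIsomCopy.exists_placed {D : Set (Euc d)} (h : IsIsomCopy K D) (x₀ : Euc d) :
    ∃ t : Placement d, placed K x₀ t = D := by
  obtain ⟨f, rfl⟩ := h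
  let L := f.symm.toRealLinearIsometryEquiv
  refine ⟨(⟨L.toContinuousLinearEquiv.toContinuousLinearMap, fun x => L.norm_map x⟩, f x₀), ?_⟩
  ext y
  have : L (y - f x₀) + x₀ = f.symm y := by
    rw [map_sub, IsometryEquiv.toRealLinearIsometryEquiv_apply,
      IsometryEquiv.toRealLinearIsometryEquiv_apply]
    simp
  rw [mem_placed]
  change L (y - f x₀) + x₀ ∈ K ↔ _
  rw [this]
  constructor
  · intro h
    exact ⟨_, h, by simp⟩
  · rintro ⟨x, hx, rfl⟩
    simpa using hx

lemma dist_chart (t : Placement d) (y : Euc d) :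
    dist (t.1.1 (y - t.2) + x₀) x₀ = dist y t.2 := by
  rw [dist_eq_norm, add_sub_cancel_right, t.1.2, dist_eq_norm]

namespace BetweenBalls

lemma pos_outer (h : BetweenBalls K x₀ ρ R) : 0 < R := by
  have := h.subset_ball (h.ball_subset (mem_ball_self h.pos))
  simpa using this

lemma ball_subset_interior (h : BetweenBalls K x₀ ρ R) (t : Placement d) :
    ball t.2 ρ ⊆ interior (placed K x₀ t) := by
  refine interior_maximal (fun y hy => h.ball_subset ?_) isOpen_ball
  rw [mem_ball, dist_chart]
  exact hy

lemma placed_subset_ball (h : BetweenBalls K x₀ ρ R) (t : Placement d) :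
    placed K x₀ t ⊆ ball t.2 R := by
  intro y hy
  have := h.subset_ball hy
  rwa [mem_ball, dist_chart] at this

lemma inter_interior_nonempty (h : BetweenBalls K x₀ ρ R) {t u : Placement d}
    (htu : dist t.2 u.2 < ρ) :
    interior (placed K x₀ t) ∩ interior (placed K x₀ u) ≠ ∅ := by
  refine Set.Nonempty.ne_empty ⟨u.2, h.ball_subset_interior t ?_, h.ball_subset_interior u ?_⟩
  · rwa [mem_ball, dist_comm]
  · simpa using h.pos

lemma dist_lt_of_inter (h : BetweenBalls K x₀ ρ R) {t u : Placement d}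
    (htu : interior (placed K x₀ t) ∩ interior (placed K x₀ u) ≠ ∅) : dist t.2 u.2 < 2 * R := by
  obtain ⟨y, hy, hy'⟩ := Set.nonempty_iff_ne_empty.2 htu
  have h1 := h.placed_subset_ball t (interior_subset hy)
  have h2 := h.placed_subset_ball u (interior_subset hy')
  rw [mem_ball] at h1 h2
  linarith [dist_triangle_left t.2 u.2 y]

lemma inter_interior_self (h : BetweenBalls K x₀ ρ R) (t : Placement d) :
    interior (placed K x₀ t) ∩ interior (placed K x₀ t) ≠ ∅ :=
  h.inter_interior_nonempty (by simpa using h.pos)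

lemma eq_of_dist_lt (h : BetweenBalls K x₀ ρ R) {T : Set (Placement d)}
    (hT : Separated K x₀ T) {t u : Placement d} (ht : t ∈ T) (hu : u ∈ T)
    (htu : dist t.2 u.2 < ρ) : t = u := by
  by_contra hne
  exact h.inter_interior_nonempty htu (hT ht hu hne)

lemma injOn_placed (h : BetweenBalls K x₀ ρ R) {T : Set (Placement d)}
    (hT : Separated K x₀ T) : Set.InjOn (placed K x₀) T := by
  intro t ht u hu htu
  by_contra hne
  have : interior (placed K x₀ t) ∩ interior (placed K x₀ u) = ∅ := hT ht hu hne
  rw [htu] at this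
  exact h.inter_interior_self u this

end BetweenBalls

lemma Separated.isPacking_image {T : Set (Placement d)} (hT : Separated K x₀ T) :
    IsPacking K (placed K x₀ '' T) := by
  refine ⟨?_, ?_⟩
  · rintro _ ⟨t, -, rfl⟩
    exact isIsomCopy_placed t
  · rintro _ ⟨t, ht, rfl⟩ _ ⟨u, hu, rfl⟩ hne
    exact hT ht hu fun e => hne (by rw [e])

lemma IsPacking.exists_separated {P : Set (Set (Euc d))} (hP : IsPacking K P) (x₀ : Euc d) :
    ∃ T, Separated K x₀ T ∧ placed K x₀ '' T = P := by
  choose! f hf using fun D (hD : D ∈ P) => (hP.1 D hD).exists_placed x₀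
  refine ⟨f '' P, ?_, ?_⟩
  · rintro _ ⟨D, hD, rfl⟩ _ ⟨E, hE, rfl⟩ hne
    rw [hf D hD, hf E hE]
    exact hP.2 hD hE fun e => hne (by rw [e])
  · rw [Set.image_image]
    exact (Set.image_congr hf).trans (Set.image_id' P)

lemma volume_placed (t : Placement d) (hK : IsCompact K) : volume (placed K x₀ t) = volume K := by
  have h1 : MeasurePreserving (t.chart x₀) volume volume :=
    (measurePreserving_add_right volume x₀).comp
      (t.1.toEquiv.measurePreserving.comp (measurePreserving_sub_right volume t.2))
  rw [placed_eq_preimage]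
  exact h1.measure_preimage hK.measurableSet.nullMeasurableSet

/-- The set of pairs of overlapping placements is open. -/
lemma isOpen_overlap : IsOpen {p : Placement d × Placement d |
    interior (placed K x₀ p.1) ∩ interior (placed K x₀ p.2) ≠ ∅} := by
  have : {p : Placement d × Placement d |
      interior (placed K x₀ p.1) ∩ interior (placed K x₀ p.2) ≠ ∅} =
      ⋃ y, {p | p.1.1.1 (y - p.1.2) + x₀ ∈ interior K} ∩
        {p | p.2.1.1 (y - p.2.2) + x₀ ∈ interior K} := by
    ext p
    simp only [Set.mem_ofPred_eq, ← Set.nonempty_iff_ne_empty, Set.mem_iUnion, Set.mem_inter_iff,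
      Set.Nonempty, mem_interior_placed]
  rw [this]
  refine isOpen_iUnion fun y => IsOpen.inter ?_ ?_
  · exact isOpen_interior.preimage (f := fun p : Placement d × Placement d =>
      p.1.1.1 (y - p.1.2) + x₀) (by fun_prop)
  · exact isOpen_interior.preimage (f := fun p : Placement d × Placement d =>
      p.2.1.1 (y - p.2.2) + x₀) (by fun_prop)

/-- Translation of a placement. -/
def Placement.translate (a : Euc d) (t : Placement d) : Placement d := (t.1, t.2 + a)

lemma mem_interior_placed_translate {a : Euc d} {t : Placement d} {y : Euc d} :
    y ∈ interior (placed K x₀ (t.translate a)) ↔ y - a ∈ interior (placed K x₀ t) := by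
  rw [mem_interior_placed, mem_interior_placed, Placement.translate, sub_sub, add_comm t.2 a]

lemma Placement.translate_injective (a : Euc d) :
    Function.Injective (Placement.translate a) := by
  rintro ⟨B, v⟩ ⟨C, w⟩ e
  simpa [Placement.translate] using e

lemma Separated.translate {T : Set (Placement d)} (hT : Separated K x₀ T) (a : Euc d) :
    Separated K x₀ (Placement.translate a '' T) := by
  rintro _ ⟨t, ht, rfl⟩ _ ⟨u, hu, rfl⟩ hne
  have : interior (placed K x₀ t) ∩ interior (placed K x₀ u) = ∅ :=
    hT ht hu fun e => hne (by rw [e])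
  rw [Set.eq_empty_iff_forall_notMem] at this ⊢
  intro y hy
  exact this (y - a) ⟨mem_interior_placed_translate.1 hy.1, mem_interior_placed_translate.1 hy.2⟩

lemma Separated.mono {T T' : Set (Placement d)} (hT : Separated K x₀ T) (h : T' ⊆ T) :
    Separated K x₀ T' :=
  Set.Pairwise.mono h hT

end placed

lemma summable_exp_neg_sum_abs {μ : ℝ} (hμ : 0 < μ) (d : ℕ) :
    Summable fun z : Fin d → ℤ => Real.exp (-μ * ∑ i, |(z i : ℝ)|) := by
  have h1 : Summable fun k : ℤ => Real.exp (-μ * |(k : ℝ)|) := by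
    have hN : Summable fun k : ℕ => Real.exp (-μ * (k : ℝ)) := by
      simpa [mul_comm] using Real.summable_exp_nat_mul_iff.2 (neg_lt_zero.2 hμ)
    exact Summable.of_nat_of_neg (by simpa using hN) (by simpa using hN)
  induction d with
  | zero => exact Summable.of_finite
  | succ d ih =>
    rw [← (Fin.consEquiv fun _ : Fin (d + 1) => ℤ).summable_iff]
    refine (h1.mul_of_nonneg ih (fun _ => (Real.exp_pos _).le)
      fun _ => (Real.exp_pos _).le).congr fun z => ?_
    simp [Fin.consEquiv, Fin.sum_univ_succ, ← Real.exp_add, mul_add]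

lemma summable_exp_neg_norm {μ : ℝ} (hμ : 0 < μ) (d : ℕ) :
    Summable fun z : Fin d → ℤ => Real.exp (-μ * ‖z‖) := by
  have hd : (0 : ℝ) < d + 1 := by positivity
  refine Summable.of_nonneg_of_le (fun _ => (Real.exp_pos _).le) (fun z => ?_)
    (summable_exp_neg_sum_abs (div_pos hμ hd) d)
  rw [Real.exp_le_exp]
  have h1 : ∑ i, |(z i : ℝ)| ≤ (d + 1) * ‖z‖ := by
    calc ∑ i, |(z i : ℝ)| ≤ ∑ _i : Fin d, ‖z‖ := Finset.sum_le_sum fun i _ => by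
          simpa [Int.norm_eq_abs] using norm_le_pi_norm z i
      _ = d * ‖z‖ := by simp
      _ ≤ (d + 1) * ‖z‖ := by nlinarith [norm_nonneg z]
  have h2 : μ / (d + 1) * ∑ i, |(z i : ℝ)| ≤ μ / (d + 1) * ((d + 1) * ‖z‖) :=
    mul_le_mul_of_nonneg_left h1 (by positivity)
  have h3 : μ / (d + 1) * ((d + 1) * ‖z‖) = μ * ‖z‖ := by field_simp
  linarith

/-- A configuration stores, for each cell of the cubic lattice, at most one placement whose
center lies in this cell. The Boolean tells whether the cell is occupied. -/
abbrev Config (d : ℕ) : Type := (Fin d → ℤ) → Bool × Orth d × (Fin d → unitInterval)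

namespace Config

variable {d : ℕ} {K : Set (Euc d)} {x₀ : Euc d} {ρ R s : ℝ}

/-- The placement stored in the cell `z`, for cells of side `s`. -/
def place (s : ℝ) (c : Config d) (z : Fin d → ℤ) : Placement d :=
  ((c z).2.1, WithLp.toLp 2 fun i => s * ((z i : ℝ) + ((c z).2.2 i : ℝ)))

/-- The placements stored in the occupied cells. -/
def placements (s : ℝ) (c : Config d) : Set (Placement d) :=
  c.place s '' {z | (c z).1 = true}

/-- Different occupied cells store nonoverlapping placements. -/
def Admissible (K : Set (Euc d)) (x₀ : Euc d) (s : ℝ) (c : Config d) : Prop :=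
  ∀ z z', z ≠ z' → (c z).1 = true → (c z').1 = true →
    interior (placed K x₀ (c.place s z)) ∩ interior (placed K x₀ (c.place s z')) = ∅

@[fun_prop]
lemma continuous_place (s : ℝ) (z : Fin d → ℤ) : Continuous fun c : Config d => c.place s z := by
  unfold place
  fun_prop

lemma isClosed_occupied (z : Fin d → ℤ) : IsClosed {c : Config d | (c z).1 = true} :=
  (isClosed_discrete {true}).preimage (f := fun c : Config d => (c z).1) (by fun_prop)

lemma isOpen_occupied (z : Fin d → ℤ) : IsOpen {c : Config d | (c z).1 = true} :=
  (isOpen_discrete {true}).preimage (f := fun c : Config d => (c z).1) (by fun_prop)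

lemma isClosed_admissible (K : Set (Euc d)) (x₀ : Euc d) (s : ℝ) :
    IsClosed {c : Config d | c.Admissible K x₀ s} := by
  have hset : {c : Config d | c.Admissible K x₀ s} = ⋂ (z) (z') (_ : z ≠ z'),
      ({c : Config d | (c z).1 = true}ᶜ ∪ {c : Config d | (c z').1 = true}ᶜ) ∪
        {c : Config d | interior (placed K x₀ (c.place s z)) ∩
          interior (placed K x₀ (c.place s z')) = ∅} := by
    ext c
    simp only [Admissible, Set.mem_iInter, Set.mem_union, Set.mem_compl_iff, Set.mem_ofPred_eq]
    refine forall_congr' fun z => forall_congr' fun z' => forall_congr' fun _ => ?_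
    tauto
  rw [hset]
  refine isClosed_iInter fun z => isClosed_iInter fun z' => isClosed_iInter fun _ =>
    (((isOpen_occupied z).isClosed_compl).union (isOpen_occupied z').isClosed_compl).union ?_
  rw [← isOpen_compl_iff]
  exact isOpen_overlap.preimage
    (f := fun c : Config d => (c.place s z, c.place s z')) (by fun_prop)

lemma Admissible.separated {c : Config d} (hc : c.Admissible K x₀ s) :
    Separated K x₀ (c.placements s) := by
  rintro _ ⟨z, hz, rfl⟩ _ ⟨z', hz', rfl⟩ hne
  exact hc z z' (fun e => hne (by rw [e])) hz hz'

lemma Admissible.injOn_place {c : Config d} (hc : c.Admissible K x₀ s)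
    (h : BetweenBalls K x₀ ρ R) : Set.InjOn (c.place s) {z | (c z).1 = true} := by
  intro z hz z' hz' e
  by_contra hne
  have := hc z z' hne hz hz'
  rw [e] at this
  exact h.inter_interior_self _ this

lemma Admissible.tsum_placements {c : Config d} (hc : c.Admissible K x₀ s)
    (h : BetweenBalls K x₀ ρ R) (g : Placement d → ℝ≥0∞) :
    ∑' t : c.placements s, g t = ∑' z, if (c z).1 = true then g (c.place s z) else 0 := by
  rw [placements, tsum_image g (hc.injOn_place h), tsum_subtype _ (fun z => g (c.place s z))]
  exact tsum_congr fun z => by simp [Set.indicator_apply]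

/-- Every separated set of placements is stored in an admissible configuration. -/
lemma exists_of_separated (h : BetweenBalls K x₀ ρ R) (hs : 0 < s) (hsρ : d * s < ρ)
    {T : Set (Placement d)} (hT : Separated K x₀ T) :
    ∃ c : Config d, c.Admissible K x₀ s ∧ c.placements s = T := by
  classical
  let cell : Placement d → Fin d → ℤ := fun t i => ⌊t.2 i / s⌋
  have hcell : ∀ t ∈ T, ∀ u ∈ T, cell t = cell u → t = u := by
    intro t ht u hu e
    refine h.eq_of_dist_lt hT ht hu (lt_of_le_of_lt ?_ hsρ)
    rw [EuclideanSpace.dist_eq]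
    have hi : ∀ i, dist (t.2 i) (u.2 i) ≤ s := by
      intro i
      have e' : ⌊t.2 i / s⌋ = ⌊u.2 i / s⌋ := congrFun e i
      have h1 := Int.abs_sub_lt_one_of_floor_eq_floor e'
      rw [← sub_div, abs_div, abs_of_pos hs, div_lt_one hs] at h1
      exact h1.le
    calc √(∑ i, dist (t.2 i) (u.2 i) ^ 2) ≤ √(∑ _i : Fin d, s ^ 2) :=
          Real.sqrt_le_sqrt (Finset.sum_le_sum fun i _ => by gcongr; exact hi i)
      _ = √(d * s ^ 2) := by simp
      _ ≤ √((d * s) ^ 2) := by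
          apply Real.sqrt_le_sqrt
          rw [mul_pow]
          have : (d : ℝ) ≤ (d : ℝ) ^ 2 := by exact_mod_cast Nat.le_self_pow two_ne_zero d
          gcongr
      _ = d * s := Real.sqrt_sq (by positivity)
  let c : Config d := fun z => if hz : ∃ t ∈ T, cell t = z then
    (true, hz.choose.1, fun i => ⟨Int.fract (hz.choose.2 i / s),
      Int.fract_nonneg _, (Int.fract_lt_one _).le⟩) else (false, default, 0)
  have hpos : ∀ z (hex : ∃ t ∈ T, cell t = z), c z = (true, hex.choose.1,
      fun i => ⟨Int.fract (hex.choose.2 i / s), Int.fract_nonneg _, (Int.fract_lt_one _).le⟩) :=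
    fun z hex => dif_pos hex
  have hneg : ∀ z, (¬ ∃ t ∈ T, cell t = z) → c z = (false, default, 0) :=
    fun z hex => dif_neg hex
  have hocc : ∀ z, (c z).1 = true → ∃ t ∈ T, cell t = z ∧ c.place s z = t := by
    intro z hz
    by_cases hex : ∃ t ∈ T, cell t = z
    · refine ⟨hex.choose, hex.choose_spec.1, hex.choose_spec.2, ?_⟩
      refine Prod.ext (by rw [place, hpos z hex]) ?_
      ext i
      have h1 : (z i : ℝ) = ⌊hex.choose.2 i / s⌋ := by
        exact_mod_cast (congrFun hex.choose_spec.2 i).symm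
      have h2 : ((c z).2.2 i : ℝ) = Int.fract (hex.choose.2 i / s) := by
        rw [hpos z hex]
      simp only [place]
      rw [h1, h2, Int.floor_add_fract]
      field_simp
    · rw [hneg z hex] at hz
      exact absurd hz Bool.false_ne_true
  have hmem : ∀ t ∈ T, (c (cell t)).1 = true := by
    intro t ht
    have : ∃ u ∈ T, cell u = cell t := ⟨t, ht, rfl⟩
    rw [hpos _ this]
  refine ⟨c, ?_, ?_⟩
  · intro z z' hne hz hz'
    obtain ⟨t, ht, htz, e⟩ := hocc z hz
    obtain ⟨u, hu, huz, e'⟩ := hocc z' hz'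
    rw [e, e']
    exact hT ht hu fun htu => hne (by rw [← htz, ← huz, htu])
  · ext t
    constructor
    · rintro ⟨z, hz, rfl⟩
      obtain ⟨t, ht, -, e⟩ := hocc z hz
      rwa [e]
    · intro ht
      refine ⟨cell t, hmem t ht, ?_⟩
      obtain ⟨u, hu, e, e'⟩ := hocc (cell t) (hmem t ht)
      rw [e', hcell u hu t ht e]

lemma le_dist_place (hs : 0 < s) (c : Config d) (z : Fin d → ℤ) (q : Euc d) :
    s * (‖z - fun i => ⌊q i / s⌋‖ - 1) ≤ dist (c.place s z).2 q := by
  set D := dist (c.place s z).2 q with hD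
  have hD0 : 0 ≤ D := dist_nonneg
  suffices ‖z - fun i => ⌊q i / s⌋‖ ≤ D / s + 1 by
    have h1 : s * (D / s) = D := by field_simp
    nlinarith
  rw [pi_norm_le_iff_of_nonneg (by positivity)]
  intro i
  have h1 : |(c.place s z).2 i - q i| ≤ D := by
    rw [hD, dist_eq_norm]
    exact PiLp.norm_apply_le ((c.place s z).2 - q) i
  have h2 : (c.place s z).2 i - q i =
      s * (z i - ⌊q i / s⌋ + (((c z).2.2 i : ℝ) - Int.fract (q i / s))) := by
    have : q i = s * (⌊q i / s⌋ + Int.fract (q i / s)) := by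
      rw [Int.floor_add_fract]; field_simp
    simp only [place]
    linear_combination -this
  rw [h2, abs_mul, abs_of_pos hs, ← le_div_iff₀' hs] at h1
  have h3 := ((c z).2.2 i).2
  have h4 := Int.fract_nonneg (q i / s)
  have h5 := (Int.fract_lt_one (q i / s)).le
  have h6 : ‖(z - fun i => ⌊q i / s⌋) i‖ = |(z i : ℝ) - ⌊q i / s⌋| := by
    simp [Int.norm_eq_abs]
  rw [h6, abs_le] at *
  constructor <;> linarith [h3.1, h3.2, h1.1, h1.2]

end Config

/-- The placements in `T` with center at distance at most `r` from `p`. -/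
def near {d : ℕ} (T : Set (Placement d)) (p : Euc d) (r : ℝ) : Set (Placement d) :=
  {t ∈ T | dist t.2 p ≤ r}

/-- A weight equal to `1` on the ball of radius `r` around `q`, decaying exponentially outside. -/
def weight {d : ℕ} (lam : ℝ) (q : Euc d) (r : ℝ) (x : Euc d) : ℝ :=
  Real.exp (-lam * max (dist x q - r) 0)

/-- The total weight of the centers of the placements in `T`. -/
def potential {d : ℕ} (lam : ℝ) (q : Euc d) (r : ℝ) (T : Set (Placement d)) : ℝ≥0∞ :=
  ∑' t : T, ENNReal.ofReal (weight lam q r t.1.2)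

section near

variable {d : ℕ} {K : Set (Euc d)} {x₀ : Euc d} {ρ R s : ℝ}

lemma weight_pos (lam : ℝ) (q : Euc d) (r : ℝ) (x : Euc d) : 0 < weight lam q r x :=
  Real.exp_pos _

lemma summable_exp_sub_norm_sub (hs : 0 < s) {lam : ℝ} (hlam : 0 < lam) (n : Fin d → ℤ) (r : ℝ) :
    Summable fun z : Fin d → ℤ => Real.exp (-lam * (s * (‖z - n‖ - 1) - r)) := by
  have h1 := (summable_exp_neg_norm (mul_pos hlam hs) d).mul_left (Real.exp (lam * (s + r)))
  rw [← (Equiv.subRight n).summable_iff] at h1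
  refine h1.congr fun z => ?_
  simp only [Function.comp, Equiv.subRight_apply, ← Real.exp_add]
  congr 1
  ring

lemma weight_place_le (hs : 0 < s) {lam : ℝ} (hlam : 0 < lam) (q : Euc d) (r : ℝ) (c : Config d)
    (z : Fin d → ℤ) : weight lam q r (c.place s z).2 ≤
      Real.exp (-lam * (s * (‖z - fun i => ⌊q i / s⌋‖ - 1) - r)) := by
  rw [weight, Real.exp_le_exp]
  have h1 := c.le_dist_place hs z q
  have h2 := le_max_left (dist (c.place s z).2 q - r) 0
  nlinarith

/-- The potential of the placements stored in a configuration, as a real number. -/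
def Config.realPotential (s lam : ℝ) (q : Euc d) (r : ℝ) (c : Config d) : ℝ :=
  ∑' z, if (c z).1 = true then weight lam q r (c.place s z).2 else 0

lemma ite_weight_le (hs : 0 < s) {lam : ℝ} (hlam : 0 < lam) (q : Euc d) (r : ℝ) (z : Fin d → ℤ)
    (c : Config d) : ‖if (c z).1 = true then weight lam q r (c.place s z).2 else 0‖ ≤
      Real.exp (-lam * (s * (‖z - fun i => ⌊q i / s⌋‖ - 1) - r)) := by
  split_ifs
  · rw [Real.norm_of_nonneg (weight_pos ..).le]
    exact weight_place_le hs hlam q r c z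
  · simpa using (Real.exp_pos _).le

lemma continuous_realPotential (hs : 0 < s) {lam : ℝ} (hlam : 0 < lam) (q : Euc d) (r : ℝ) :
    Continuous (Config.realPotential s lam q r) := by
  refine continuous_tsum (fun z => ?_) (summable_exp_sub_norm_sub hs hlam _ r)
    (ite_weight_le hs hlam q r)
  refine Continuous.if (fun c hc => ?_) ?_ continuous_const
  · have : frontier {c : Config d | (c z).1 = true} = ∅ :=
      IsClopen.frontier_eq ⟨Config.isClosed_occupied z, Config.isOpen_occupied z⟩
    rw [this] at hc
    exact hc.elim
  · unfold weight
    fun_prop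

lemma potential_placements (h : BetweenBalls K x₀ ρ R) (hs : 0 < s) {lam : ℝ} (hlam : 0 < lam)
    (q : Euc d) (r : ℝ) {c : Config d} (hc : c.Admissible K x₀ s) :
    potential lam q r (c.placements s) = ENNReal.ofReal (c.realPotential s lam q r) := by
  rw [potential, hc.tsum_placements h fun t => ENNReal.ofReal (weight lam q r t.2),
    Config.realPotential, ENNReal.ofReal_tsum_of_nonneg]
  · exact tsum_congr fun z => by split_ifs <;> simp
  · intro z
    split_ifs
    exacts [(weight_pos ..).le, le_rfl]
  · exact Summable.of_norm_bounded (summable_exp_sub_norm_sub hs hlam _ r)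
      fun z => ite_weight_le hs hlam q r z c

lemma BetweenBalls.cell_side (h : BetweenBalls K x₀ ρ R) :
    0 < ρ / (d + 1) ∧ d * (ρ / (d + 1)) < ρ := by
  have := h.pos
  refine ⟨by positivity, ?_⟩
  rw [← mul_div_assoc, div_lt_iff₀ (by positivity)]
  nlinarith

lemma potential_ne_top (h : BetweenBalls K x₀ ρ R) {lam : ℝ} (hlam : 0 < lam) (q : Euc d) (r : ℝ)
    {T : Set (Placement d)} (hT : Separated K x₀ T) : potential lam q r T ≠ ∞ := by
  obtain ⟨hs, hsρ⟩ := h.cell_side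
  obtain ⟨c, hc, rfl⟩ := Config.exists_of_separated h hs hsρ hT
  rw [potential_placements h hs hlam q r hc]
  exact ENNReal.ofReal_ne_top

lemma exists_tsum_exp_le (h : BetweenBalls K x₀ ρ R) {lam : ℝ} (hlam : 0 < lam) :
    ∃ C : ℝ, ∀ T, Separated K x₀ T → ∀ q : Euc d,
      ∑' t : T, ENNReal.ofReal (Real.exp (-lam * dist t.1.2 q)) ≤ ENNReal.ofReal C := by
  obtain ⟨hs, hsρ⟩ := h.cell_side
  set s := ρ / (d + 1)
  refine ⟨∑' z : Fin d → ℤ, Real.exp (-lam * (s * (‖z - 0‖ - 1) - 0)), fun T hT q => ?_⟩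
  obtain ⟨c, hc, rfl⟩ := Config.exists_of_separated h hs hsρ hT
  have h0 : ∀ t : c.placements s, ENNReal.ofReal (Real.exp (-lam * dist t.1.2 q)) =
      ENNReal.ofReal (weight lam q 0 t.1.2) := fun t => by
    rw [weight, sub_zero, max_eq_left dist_nonneg]
  rw [tsum_congr h0, ← potential, potential_placements h hs hlam q 0 hc]
  refine ENNReal.ofReal_le_ofReal ?_
  rw [← (Equiv.subRight fun i => ⌊q i / s⌋).tsum_eq
    fun z : Fin d → ℤ => Real.exp (-lam * (s * (‖z - 0‖ - 1) - 0))]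
  simp only [Equiv.subRight_apply, sub_zero]
  have h1 := summable_exp_sub_norm_sub hs hlam (fun i => ⌊q i / s⌋) 0
  simp only [sub_zero] at h1
  refine Summable.tsum_le_tsum (fun z => ?_) (Summable.of_norm_bounded h1 fun z => by
    simpa using ite_weight_le hs hlam q 0 z c) h1
  simpa using (le_abs_self _).trans (ite_weight_le hs hlam q 0 z c)

lemma finite_cells (hs : 0 < s) (p : Euc d) (r : ℝ) :
    {z : Fin d → ℤ | ∃ c : Config d, dist (c.place s z).2 p ≤ r}.Finite := by
  refine (isCompact_iff_finite.1
    (isCompact_closedBall (fun i => ⌊p i / s⌋ : Fin d → ℤ) (r / s + 1))).subset ?_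
  rintro z ⟨c, hc⟩
  have h1 := (c.le_dist_place hs z p).trans hc
  rw [← le_div_iff₀' hs] at h1
  rw [mem_closedBall, dist_eq_norm]
  linarith

lemma near_placements (c : Config d) (p : Euc d) (r : ℝ) :
    near (c.placements s) p r =
      c.place s '' {z | (c z).1 = true ∧ dist (c.place s z).2 p ≤ r} := by
  ext t
  constructor
  · rintro ⟨⟨z, hz, rfl⟩, h⟩
    exact ⟨z, ⟨hz, h⟩, rfl⟩
  · rintro ⟨z, ⟨hz, h⟩, rfl⟩
    exact ⟨⟨z, hz, rfl⟩, h⟩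

lemma finite_near (h : BetweenBalls K x₀ ρ R) {T : Set (Placement d)} (hT : Separated K x₀ T)
    (p : Euc d) (r : ℝ) : (near T p r).Finite := by
  obtain ⟨hs, hsρ⟩ := h.cell_side
  obtain ⟨c, hc, rfl⟩ := Config.exists_of_separated h hs hsρ hT
  rw [near_placements]
  exact ((finite_cells hs p r).subset fun z hz => ⟨c, hz.2⟩).image _

lemma isClosed_le_ncard_near (h : BetweenBalls K x₀ ρ R) (hs : 0 < s) (p : Euc d) (r : ℝ) (m : ℕ) :
    IsClosed {c : Config d | c.Admissible K x₀ s ∧ m ≤ (near (c.placements s) p r).ncard} := by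
  classical
  set Z := (finite_cells hs p r).toFinset with hZ
  let A : (Fin d → ℤ) → Set (Config d) := fun z =>
    {c | (c z).1 = true} ∩ {c | dist (c.place s z).2 p ≤ r}
  have hA : ∀ z, IsClosed (A z) := fun z => (Config.isClosed_occupied z).inter
    (isClosed_le (by fun_prop) continuous_const)
  have husc : UpperSemicontinuous fun c => ∑ z ∈ Z, (A z).indicator (fun _ => (1 : ℕ)) c :=
    upperSemicontinuous_sum fun z _ => (hA z).upperSemicontinuous_indicator zero_le_one
  have hcount : ∀ c : Config d, c.Admissible K x₀ s → (near (c.placements s) p r).ncard =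
      ∑ z ∈ Z, (A z).indicator (fun _ => (1 : ℕ)) c := by
    intro c hc
    rw [near_placements, ((hc.injOn_place h).mono fun z hz => hz.1).ncard_image]
    have : {z | (c z).1 = true ∧ dist (c.place s z).2 p ≤ r} = ↑(Z.filter fun z => c ∈ A z) := by
      ext z
      simp only [Finset.coe_filter, hZ, Set.Finite.mem_toFinset, Set.mem_ofPred_eq, A,
        Set.mem_inter_iff]
      exact ⟨fun hz => ⟨⟨c, hz.2⟩, hz⟩, fun hz => hz.2⟩
    rw [this, Set.ncard_coe_finset, Finset.card_filter]
    exact Finset.sum_congr rfl fun z _ => by simp [Set.indicator_apply]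
  convert (Config.isClosed_admissible K x₀ s).inter (husc.isClosed_preimage m) using 1
  ext c
  simp only [Set.mem_ofPred_eq, Set.mem_inter_iff, Set.mem_preimage, Set.mem_Ici]
  exact and_congr_right fun hc => by rw [hcount c hc]

end near

section extremal

variable {d : ℕ} {K : Set (Euc d)} {x₀ : Euc d} {ρ R : ℝ}

/-- Volume of a ball of radius `r`. -/
def ballVol (d : ℕ) (r : ℝ) : ℝ := (volume (ball (0 : Euc d) r)).toReal

lemma volume_ball_eq (p : Euc d) (r : ℝ) : volume (ball p r) = ENNReal.ofReal (ballVol d r) := by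
  rw [ballVol, ENNReal.ofReal_toReal measure_ball_lt_top.ne, Measure.addHaar_ball_center]

lemma ballVol_pos {r : ℝ} (hr : 0 < r) : 0 < ballVol d r :=
  ENNReal.toReal_pos (measure_ball_pos volume _ hr).ne' measure_ball_lt_top.ne

lemma ballVol_nonneg (r : ℝ) : 0 ≤ ballVol d r := ENNReal.toReal_nonneg

lemma ballVol_eq {r : ℝ} (hr : 0 < r) : ballVol d r = r ^ d * ballVol d 1 := by
  rw [ballVol, Measure.addHaar_ball_of_pos volume _ hr, ENNReal.toReal_mul,
    ENNReal.toReal_ofReal (by positivity), finrank_euclideanSpace_fin, ballVol]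

/-- Disjoint balls around the centers bound the number of placements. -/
lemma ncard_near_mul_le (h : BetweenBalls K x₀ ρ R) {T : Set (Placement d)}
    (hT : Separated K x₀ T) (p : Euc d) (r : ℝ) :
    (near T p r).ncard * ballVol d (ρ / 2) ≤ ballVol d (r + ρ / 2) := by
  have hfin := finite_near h hT p r
  rw [Set.ncard_eq_toFinset_card _ hfin]
  have hmem : ∀ t ∈ hfin.toFinset, t ∈ near T p r := fun t ht => hfin.mem_toFinset.1 ht
  have h1 : volume (⋃ t ∈ hfin.toFinset, ball t.2 (ρ / 2)) =
      ∑ t ∈ hfin.toFinset, volume (ball t.2 (ρ / 2)) := by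
    refine measure_biUnion_finset (fun t ht u hu hne => ?_) fun _ _ => measurableSet_ball
    refine ball_disjoint_ball ?_
    by_contra hlt
    refine hne (h.eq_of_dist_lt hT (hmem t ht).1 (hmem u hu).1 ?_)
    linarith
  have h2 : (⋃ t ∈ hfin.toFinset, ball t.2 (ρ / 2)) ⊆ ball p (r + ρ / 2) := by
    refine Set.iUnion₂_subset fun t ht => ball_subset_ball' ?_
    linarith [(hmem t ht).2]
  have h3 := measure_mono (μ := volume) h2
  rw [h1] at h3
  simp only [volume_ball_eq, Finset.sum_const, nsmul_eq_mul] at h3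
  rw [← ENNReal.ofReal_natCast, ← ENNReal.ofReal_mul (by positivity)] at h3
  exact (ENNReal.ofReal_le_ofReal_iff (ballVol_nonneg _)).1 h3

lemma Separated.union {T W : Set (Placement d)} (hT : Separated K x₀ T) (hW : Separated K x₀ W)
    (hTW : ∀ t ∈ T, ∀ u ∈ W, interior (placed K x₀ t) ∩ interior (placed K x₀ u) = ∅) :
    Separated K x₀ (T ∪ W) :=
  Set.pairwise_union.2 ⟨hT, hW, fun t ht u hu _ =>
    ⟨hTW t ht u hu, (Set.inter_comm _ _).trans (hTW t ht u hu)⟩⟩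

lemma Separated.replace (h : BetweenBalls K x₀ ρ R) {T W : Set (Placement d)}
    (hT : Separated K x₀ T) (hW : Separated K x₀ W) {p : Euc d} {r : ℝ}
    (hr : ∀ t ∈ W, dist t.2 p ≤ r) : Separated K x₀ (T \ near T p (r + 2 * R) ∪ W) := by
  refine (hT.mono Set.sdiff_subset).union hW fun t ht u hu => ?_
  by_contra hne
  have h1 := h.dist_lt_of_inter hne
  refine ht.2 ⟨ht.1, ?_⟩
  linarith [dist_triangle t.2 u.2 p, hr u hu]

lemma card_le_of_maximal (h : BetweenBalls K x₀ ρ R) {T : Set (Placement d)}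
    (hT : Separated K x₀ T) {k : ℝ} (hmax : ∀ T', Separated K x₀ T' →
      (near T' 0 k).ncard ≤ (near T 0 k).ncard)
    {W : Finset (Placement d)} (hW : Separated K x₀ W) {p : Euc d} {r : ℝ}
    (hr : ∀ t ∈ W, dist t.2 p ≤ r) (hk : ‖p‖ + r + 2 * R ≤ k) :
    W.card ≤ (near T p (r + 2 * R)).ncard := by
  have hR := h.pos_outer
  have hnear : near T p (r + 2 * R) ⊆ near T 0 k := fun t ht => by
    refine ⟨ht.1, ?_⟩
    have := ht.2
    linarith [dist_triangle t.2 p 0, dist_zero_right p]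
  have heq : near (T \ near T p (r + 2 * R) ∪ W) 0 k =
      near T 0 k \ near T p (r + 2 * R) ∪ W := by
    ext t
    constructor
    · rintro ⟨ht | ht, ht'⟩
      exacts [Or.inl ⟨⟨ht.1, ht'⟩, ht.2⟩, Or.inr ht]
    · rintro (ht | ht)
      · exact ⟨Or.inl ⟨ht.1.1, ht.2⟩, ht.1.2⟩
      · refine ⟨Or.inr ht, ?_⟩
        linarith [dist_triangle t.2 p 0, dist_zero_right p, hr t ht]
  have hdisj : Disjoint (near T 0 k \ near T p (r + 2 * R)) (W : Set (Placement d)) := by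
    rw [Set.disjoint_left]
    intro t ht ht'
    exact ht.2 ⟨ht.1.1, by linarith [hr t ht']⟩
  have hfin := finite_near h hT 0 k
  have h1 := hmax _ (hT.replace h hW hr)
  rw [heq, Set.ncard_union_eq hdisj (hfin.subset Set.sdiff_subset) W.finite_toSet,
    Set.ncard_coe_finset] at h1
  have h2 := Set.ncard_sdiff_add_ncard_of_subset hnear hfin
  omega

/-- There is a packing such that no finite replacement inside a ball increases the number of
copies meeting a slightly larger ball. -/
lemma exists_locally_maximal (h : BetweenBalls K x₀ ρ R) : ∃ T, Separated K x₀ T ∧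
    ∀ (p : Euc d) (r : ℝ) (W : Finset (Placement d)), Separated K x₀ W →
      (∀ t ∈ W, dist t.2 p ≤ r) → W.card ≤ (near T p (r + 2 * R)).ncard := by
  obtain ⟨hs, hsρ⟩ := h.cell_side
  set s := ρ / (d + 1)
  let A : ℕ → Set (Config d) := fun k => {c | c.Admissible K x₀ s} ∩
    ⋂ (p : Euc d) (r : ℝ) (W : Finset (Placement d)) (_ : Separated K x₀ W)
      (_ : ∀ t ∈ W, dist t.2 p ≤ r) (_ : ‖p‖ + r + 2 * R ≤ k),
      {c | c.Admissible K x₀ s ∧ W.card ≤ (near (c.placements s) p (r + 2 * R)).ncard}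
  have hclosed : ∀ k, IsClosed (A k) := fun k => by
    refine (Config.isClosed_admissible K x₀ s).inter ?_
    iterate 6 refine isClosed_iInter fun _ => ?_
    exact isClosed_le_ncard_near h hs _ _ _
  have hanti : ∀ k, A (k + 1) ⊆ A k := fun k c hc => by
    simp only [A, Set.mem_inter_iff, Set.mem_iInter] at hc ⊢
    exact ⟨hc.1, fun p r W hW hr hk => hc.2 p r W hW hr (by push_cast; linarith)⟩
  have hne : ∀ k, (A k).Nonempty := fun k => by
    let N : Set ℕ := {m | ∃ T, Separated K x₀ T ∧ (near T 0 k).ncard = m}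
    have hb : BddAbove N := by
      refine ⟨⌈ballVol d (k + ρ / 2) / ballVol d (ρ / 2)⌉₊, ?_⟩
      rintro _ ⟨T, hT, rfl⟩
      have := ncard_near_mul_le h hT 0 k
      rw [← le_div_iff₀ (ballVol_pos (half_pos h.pos))] at this
      exact_mod_cast this.trans (Nat.le_ceil _)
    obtain ⟨T, hT, hTN⟩ := Nat.sSup_mem (s := N) ⟨_, ∅, Set.pairwise_empty _, rfl⟩ hb
    have hmax : ∀ T', Separated K x₀ T' → (near T' 0 k).ncard ≤ (near T 0 k).ncard :=
      fun T' hT' => hTN ▸ le_csSup hb ⟨T', hT', rfl⟩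
    obtain ⟨c, hc, rfl⟩ := Config.exists_of_separated h hs hsρ hT
    refine ⟨c, hc, ?_⟩
    simp only [Set.mem_iInter]
    exact fun p r W hW hr hk => ⟨hc, card_le_of_maximal h hT hmax hW hr hk⟩
  obtain ⟨c, hc⟩ := IsCompact.nonempty_iInter_of_sequence_nonempty_isCompact_isClosed A hanti hne
    (hclosed 0).isCompact hclosed
  simp only [Set.mem_iInter, A, Set.mem_inter_iff] at hc
  refine ⟨c.placements s, (hc 0).1.separated, fun p r W hW hr => ?_⟩
  obtain ⟨k, hk⟩ := exists_nat_ge (‖p‖ + r + 2 * R)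
  exact ((hc k).2 p r W hW hr hk).2

lemma ncard_near_le_of_locally_maximal (h : BetweenBalls K x₀ ρ R) {T T' : Set (Placement d)}
    (hmax : ∀ (p : Euc d) (r : ℝ) (W : Finset (Placement d)), Separated K x₀ W →
      (∀ t ∈ W, dist t.2 p ≤ r) → W.card ≤ (near T p (r + 2 * R)).ncard)
    (hT' : Separated K x₀ T') (p q : Euc d) (r : ℝ) :
    (near T' p r).ncard ≤ (near T q (r + 2 * R)).ncard := by
  have hfin := finite_near h hT' p r
  have h1 := hmax q r (hfin.toFinset.map ⟨_, Placement.translate_injective (q - p)⟩)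
    (by
      rw [Finset.coe_map, hfin.coe_toFinset]
      exact (hT'.mono fun t ht => ht.1).translate _)
    (by
      simp only [Finset.mem_map, Set.Finite.mem_toFinset]
      rintro _ ⟨t, ht, rfl⟩
      have := ht.2
      rw [dist_eq_norm] at this ⊢
      convert this using 2
      simp only [Placement.translate, Function.Embedding.coeFn_mk]
      abel)
  rwa [Finset.card_map, ← Set.ncard_eq_toFinset_card _ hfin] at h1

/-- Among the packings whose potentials dominate those of `T₀`, one has maximal potential. -/
lemma exists_potential_maximal (h : BetweenBalls K x₀ ρ R) {lam : ℝ} (hlam : 0 < lam)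
    {T₀ : Set (Placement d)} (hT₀ : Separated K x₀ T₀) : ∃ T, Separated K x₀ T ∧
      (∀ q r, potential lam q r T₀ ≤ potential lam q r T) ∧
      ∀ T', Separated K x₀ T' → (∀ q r, potential lam q r T ≤ potential lam q r T') →
        potential lam 0 0 T' ≤ potential lam 0 0 T := by
  obtain ⟨hs, hsρ⟩ := h.cell_side
  set s := ρ / (d + 1)
  let S : Set (Config d) := {c | c.Admissible K x₀ s} ∩ ⋂ (q : Euc d) (r : ℝ),
    {c | potential lam q r T₀ ≤ ENNReal.ofReal (c.realPotential s lam q r)}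
  have hcont : ∀ (q : Euc d) (r : ℝ), Continuous fun c : Config d =>
      ENNReal.ofReal (c.realPotential s lam q r) := fun q r =>
    ENNReal.continuous_ofReal.comp (continuous_realPotential hs hlam q r)
  have hS : IsCompact S := ((Config.isClosed_admissible K x₀ s).inter
    (isClosed_iInter fun q => isClosed_iInter fun r =>
      isClosed_le continuous_const (hcont q r))).isCompact
  have hmem : ∀ c : Config d, c ∈ S ↔ c.Admissible K x₀ s ∧
      ∀ q r, potential lam q r T₀ ≤ potential lam q r (c.placements s) := fun c => by
    simp only [S, Set.mem_inter_iff, Set.mem_iInter, Set.mem_ofPred_eq]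
    exact and_congr_right fun hc => by simp only [potential_placements h hs hlam _ _ hc]
  obtain ⟨c₀, hc₀, rfl⟩ := Config.exists_of_separated h hs hsρ hT₀
  obtain ⟨c, hcS, hmax⟩ := hS.exists_isMaxOn ⟨c₀, (hmem c₀).2 ⟨hc₀, fun _ _ => le_rfl⟩⟩
    (hcont 0 0).continuousOn
  have hc := (hmem c).1 hcS
  refine ⟨c.placements s, hc.1.separated, hc.2, fun T' hT' hle => ?_⟩
  obtain ⟨c', hc', rfl⟩ := Config.exists_of_separated h hs hsρ hT'
  have := hmax ((hmem c').2 ⟨hc', fun q r => (hc.2 q r).trans (hle q r)⟩)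
  rw [potential_placements h hs hlam 0 0 hc', potential_placements h hs hlam 0 0 hc.1]
  exact this

end extremal

/-- In a finite bipartite graph with more vertices on the right, some connected component has
more vertices on the right; its diameter is controlled by the length of the edges. -/
lemma exists_component_card_lt {α β X : Type*} [Fintype α] [Fintype β] [PseudoMetricSpace X]
    (rel : α → β → Prop) (x : α → X) (y : β → X) {D : ℝ} (hD : 0 ≤ D)
    (hrel : ∀ a b, rel a b → dist (x a) (y b) ≤ D) (hcard : Fintype.card α < Fintype.card β) :
    ∃ (A : Finset α) (B : Finset β), A.card < B.card ∧ (∀ a b, rel a b → (a ∈ A ↔ b ∈ B)) ∧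
      ∀ a ∈ A, ∀ b ∈ B, dist (x a) (y b) ≤ (Fintype.card α + Fintype.card β : ℝ) * D := by
  classical
  let G : SimpleGraph (α ⊕ β) := SimpleGraph.fromRel fun u v =>
    ∃ a b, rel a b ∧ u = Sum.inl a ∧ v = Sum.inr b
  have hadj : ∀ a b, rel a b → G.Adj (Sum.inl a) (Sum.inr b) := fun a b hab =>
    (SimpleGraph.fromRel_adj _ _ _).2 ⟨Sum.inl_ne_inr, Or.inl ⟨a, b, hab, rfl, rfl⟩⟩
  let f : α ⊕ β → X := Sum.elim x y
  have hf : ∀ u v, G.Adj u v → dist (f u) (f v) ≤ D := by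
    intro u v huv
    obtain ⟨-, ⟨a, b, hab, rfl, rfl⟩ | ⟨a, b, hab, rfl, rfl⟩⟩ :=
      (SimpleGraph.fromRel_adj _ _ _).1 huv
    · exact hrel a b hab
    · rw [dist_comm]
      exact hrel a b hab
  have hwalk : ∀ u v (w : G.Walk u v), dist (f u) (f v) ≤ w.length * D := by
    intro u v w
    induction w with
    | nil => simp
    | @cons u v' v huv w ih =>
      rw [SimpleGraph.Walk.length_cons]
      push_cast
      linarith [dist_triangle (f u) (f v') (f v), hf _ _ huv]
  have : Fintype G.ConnectedComponent := Fintype.ofFinite _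
  let κ : α ⊕ β → G.ConnectedComponent := G.connectedComponentMk
  have hα : ∑ k, (Finset.univ.filter fun a => κ (Sum.inl a) = k).card = Fintype.card α :=
    (Finset.card_eq_sum_card_fiberwise fun a _ => Finset.mem_coe.2 (Finset.mem_univ _)).symm
  have hβ : ∑ k, (Finset.univ.filter fun b => κ (Sum.inr b) = k).card = Fintype.card β :=
    (Finset.card_eq_sum_card_fiberwise fun a _ => Finset.mem_coe.2 (Finset.mem_univ _)).symm
  obtain ⟨k, -, hk⟩ := Finset.exists_lt_of_sum_lt (hα.trans_lt (hcard.trans_eq hβ.symm))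
  refine ⟨_, _, hk, fun a b hab => ?_, fun a ha b hb => ?_⟩
  · have : κ (Sum.inl a) = κ (Sum.inr b) :=
      SimpleGraph.ConnectedComponent.sound (hadj a b hab).reachable
    simp [this]
  · simp only [Finset.mem_filter, Finset.mem_univ, true_and] at ha hb
    obtain ⟨w⟩ : G.Reachable (Sum.inl a) (Sum.inr b) :=
      SimpleGraph.ConnectedComponent.exact (ha.trans hb.symm)
    have hlen := w.toPath.2.length_lt
    rw [Fintype.card_sum] at hlen
    refine (hwalk _ _ w.toPath.1).trans (mul_le_mul_of_nonneg_right ?_ hD)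
    exact_mod_cast hlen.le

lemma weight_le_exp_mul {d : ℕ} {lam : ℝ} (hlam : 0 ≤ lam) (q : Euc d) (r : ℝ) {x y : Euc d}
    {Δ : ℝ} (hxy : dist x y ≤ Δ) : weight lam q r x ≤ Real.exp (lam * Δ) * weight lam q r y := by
  rw [weight, weight, ← Real.exp_add, Real.exp_le_exp]
  have h1 : max (dist y q - r) 0 ≤ max (dist x q - r) 0 + Δ := by
    have := dist_triangle_left y q x
    have h0 : 0 ≤ Δ := dist_nonneg.trans hxy
    refine max_le ?_ (by positivity)
    linarith [le_max_left (dist x q - r) 0]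
  nlinarith

lemma sum_weight_lt {d : ℕ} {ι κ : Type*} {lam : ℝ} (hlam : 0 ≤ lam) (q : Euc d) (r : ℝ)
    (A : Finset ι) (B : Finset κ) (x : ι → Euc d) (y : κ → Euc d) {Δ : ℝ} {n : ℕ}
    (hAB : A.card < B.card) (hA : A.card ≤ n) (hΔ : n * Real.exp (lam * Δ) < n + 1)
    (hdist : ∀ a ∈ A, ∀ b ∈ B, dist (x a) (y b) ≤ Δ) :
    ∑ a ∈ A, weight lam q r (x a) < ∑ b ∈ B, weight lam q r (y b) := by
  obtain ⟨b₀, hb₀, hmin⟩ := B.exists_min_image (fun b => weight lam q r (y b))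
    (Finset.card_pos.1 (by omega))
  set w := weight lam q r (y b₀)
  have hw : 0 < w := weight_pos ..
  have h1 : ∑ a ∈ A, weight lam q r (x a) ≤ A.card * (Real.exp (lam * Δ) * w) := by
    rw [← nsmul_eq_mul]
    exact Finset.sum_le_card_nsmul _ _ _ fun a ha => weight_le_exp_mul hlam q r (hdist a ha b₀ hb₀)
  have h2 : B.card * w ≤ ∑ b ∈ B, weight lam q r (y b) := by
    rw [← nsmul_eq_mul]
    exact Finset.card_nsmul_le_sum _ _ _ hmin
  have h3 : (A.card : ℝ) + 1 ≤ B.card := by exact_mod_cast hAB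
  have h4 : A.card * Real.exp (lam * Δ) < A.card + 1 := by
    have h5 : (A.card : ℝ) ≤ n := by exact_mod_cast hA
    by_cases h6 : 1 ≤ Real.exp (lam * Δ)
    · nlinarith
    · nlinarith [(Nat.cast_nonneg A.card : (0 : ℝ) ≤ A.card)]
  calc _ ≤ A.card * (Real.exp (lam * Δ) * w) := h1
    _ = (A.card * Real.exp (lam * Δ)) * w := by ring
    _ < (A.card + 1) * w := by gcongr
    _ ≤ B.card * w := by gcongr
    _ ≤ _ := h2

section saturated

variable {d : ℕ} {K : Set (Euc d)} {x₀ : Euc d} {ρ R : ℝ}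

lemma potential_union {T W : Set (Placement d)} (hTW : Disjoint T W) (lam : ℝ) (q : Euc d)
    (r : ℝ) : potential lam q r (T ∪ W) = potential lam q r T + potential lam q r W :=
  Summable.tsum_union_disjoint (f := fun t : Placement d => ENNReal.ofReal (weight lam q r t.2))
    hTW ENNReal.summable ENNReal.summable

lemma potential_coe_finset (W : Finset (Placement d)) (lam : ℝ) (q : Euc d) (r : ℝ) :
    potential lam q r W = ENNReal.ofReal (∑ t ∈ W, weight lam q r t.2) := by
  rw [potential, ENNReal.ofReal_sum_of_nonneg fun _ _ => (weight_pos ..).le]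
  exact Finset.tsum_subtype W fun t : Placement d => ENNReal.ofReal (weight lam q r t.2)

/-- A packing of maximal potential is saturated, provided that the weights decay slowly. -/
lemma saturated_of_potential_maximal (h : BetweenBalls K x₀ ρ R) {n : ℕ} (hn : 0 < n) {lam : ℝ}
    (hlam : 0 < lam) (hΔ : n * Real.exp (lam * (2 * n * (2 * R))) < n + 1)
    {T : Set (Placement d)} (hT : Separated K x₀ T)
    (hmax : ∀ T', Separated K x₀ T' → (∀ q r, potential lam q r T ≤ potential lam q r T') →
        potential lam 0 0 T' ≤ potential lam 0 0 T) :
    Saturated K n (placed K x₀ '' T) := by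
  classical
  rintro ⟨F, G, hFP, hF, hG, hdisj, hpack⟩
  have hR := h.pos_outer
  choose f hfT hf using fun D : F => hFP D.2
  choose g hg using fun E : G => (hpack.1 E.1 (Or.inr E.2)).exists_placed x₀
  have hf_inj : Function.Injective f := fun D D' e => Subtype.ext (by rw [← hf D, ← hf D', e])
  have hg_inj : Function.Injective g := fun E E' e => Subtype.ext (by rw [← hg E, ← hg E', e])
  obtain ⟨A, B, hAB, hrel, hdist⟩ := exists_component_card_lt
    (fun (D : F) (E : G) => interior D.1 ∩ interior E.1 ≠ ∅) (fun D => (f D).2)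
    (fun E => (g E).2) (D := 2 * R) (by linarith)
    (fun D E hDE => (h.dist_lt_of_inter (by rwa [hf, hg])).le)
    (by simp only [Fintype.card_coe]; omega)
  simp only [Fintype.card_coe, hF, hG] at hdist
  set A' : Finset (Placement d) := A.map ⟨f, hf_inj⟩
  set B' : Finset (Placement d) := B.map ⟨g, hg_inj⟩
  have hA'T : (A' : Set (Placement d)) ⊆ T := by
    intro t ht
    obtain ⟨D, -, rfl⟩ := Finset.mem_map.1 (Finset.mem_coe.1 ht)
    exact hfT D
  have hB' : Separated K x₀ (B' : Set (Placement d)) := by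
    intro t ht u hu hne
    obtain ⟨E, -, rfl⟩ := Finset.mem_map.1 (Finset.mem_coe.1 ht)
    obtain ⟨E', -, rfl⟩ := Finset.mem_map.1 (Finset.mem_coe.1 hu)
    simp only [Function.Embedding.coeFn_mk, hg]
    exact hpack.2 (Or.inr E.2) (Or.inr E'.2) fun e => hne (by rw [Subtype.ext e])
  have hcross : ∀ t ∈ T \ (A' : Set (Placement d)), ∀ u ∈ (B' : Set (Placement d)),
      interior (placed K x₀ t) ∩ interior (placed K x₀ u) = ∅ := by
    intro t ht u hu
    obtain ⟨E, hE, rfl⟩ := Finset.mem_map.1 (Finset.mem_coe.1 hu)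
    simp only [Function.Embedding.coeFn_mk, hg]
    by_cases htF : placed K x₀ t ∈ F
    · by_contra hne
      have hA : (⟨_, htF⟩ : F) ∈ A := (hrel ⟨_, htF⟩ E hne).2 hE
      refine ht.2 (Finset.mem_coe.2 (Finset.mem_map.2 ⟨_, hA, ?_⟩))
      exact h.injOn_placed hT (hfT _) ht.1 (hf ⟨_, htF⟩)
    · have hmem : placed K x₀ t ∈ placed K x₀ '' T \ (F : Set (Set (Euc d))) :=
        ⟨⟨t, ht.1, rfl⟩, htF⟩
      refine hpack.2 (Or.inl hmem) (Or.inr E.2) fun e => ?_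
      exact Set.disjoint_left.1 hdisj (Finset.mem_coe.2 E.2) (e ▸ hmem)
  have hdisj' : Disjoint (T \ (A' : Set (Placement d))) (B' : Set (Placement d)) :=
    Set.disjoint_left.2 fun t ht ht' => h.inter_interior_self t (hcross t ht t ht')
  have hlt : ∀ q r, potential lam q r T <
      potential lam q r (T \ (A' : Set (Placement d)) ∪ (B' : Set (Placement d))) := by
    intro q r
    have h1 : T = T \ (A' : Set (Placement d)) ∪ (A' : Set (Placement d)) :=
      (Set.sdiff_union_of_subset hA'T).symm
    rw [potential_union hdisj', potential_coe_finset]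
    conv_lhs => rw [h1, potential_union Set.disjoint_sdiff_left, potential_coe_finset]
    refine ENNReal.add_lt_add_left
      (potential_ne_top h hlam q r (hT.mono Set.sdiff_subset)) ?_
    have hsum := sum_weight_lt hlam.le q r A B (fun D => (f D).2) (fun E => (g E).2) hAB
      (A.card_le_univ.trans (by rw [Fintype.card_coe, hF]; omega)) hΔ fun a ha b hb =>
        (hdist a ha b hb).trans (by
          have : ((n - 1 : ℕ) : ℝ) ≤ n := by exact_mod_cast Nat.sub_le n 1
          gcongr
          linarith)
    rw [Finset.sum_map, Finset.sum_map]
    refine (ENNReal.ofReal_lt_ofReal_iff_of_nonneg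
      (Finset.sum_nonneg fun _ _ => (weight_pos ..).le)).2 hsum
  exact (hlt 0 0).not_ge
    (hmax _ ((hT.mono Set.sdiff_subset).union hB' hcross) fun q r => (hlt q r).le)

end saturated

/-- A function with the growth and averaging properties of a counting function has an asymptotic
density. -/
lemma exists_tendsto_div_pow {d : ℕ} {f : ℝ → ℝ} {B c : ℝ} (hc : 0 < c)
    (hB : ∀ r, 0 ≤ r → f r ≤ B * (r + c) ^ d)
    (hf : ∀ r s, 0 ≤ r → 0 ≤ s → f r * s ^ d ≤ (r + c) ^ d * f (s + r + c)) :
    ∃ m, Tendsto (fun r => f r / r ^ d) atTop (nhds m) := by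
  let g : Set.Ici (0 : ℝ) → ℝ := fun r => f r / (r + c) ^ d
  have hpos : ∀ r : Set.Ici (0 : ℝ), 0 < ((r : ℝ) + c) ^ d := fun r => by
    have := r.2.out
    positivity
  have hbdd : BddAbove (Set.range g) := by
    refine ⟨B, ?_⟩
    rintro _ ⟨r, rfl⟩
    exact (div_le_iff₀ (hpos r)).2 (hB r r.2)
  have : Nonempty (Set.Ici (0 : ℝ)) := ⟨⟨0, Set.self_mem_Ici⟩⟩
  have hratio : ∀ a : ℝ, Tendsto (fun r : ℝ => ((r + a) / r) ^ d) atTop (nhds 1) := fun a => by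
    have h1 : Tendsto (fun r : ℝ => 1 + a / r) atTop (nhds (1 + 0)) :=
      tendsto_const_nhds.add (tendsto_const_nhds.div_atTop tendsto_id)
    have h2 := h1.pow d
    rw [add_zero, one_pow] at h2
    refine h2.congr' ?_
    filter_upwards [eventually_gt_atTop 0] with r hr
    rw [add_div, div_self hr.ne']
  refine ⟨⨆ r, g r, tendsto_order.2 ⟨fun a ha => ?_, fun a ha => ?_⟩⟩
  · obtain ⟨r₀, hr₀⟩ := exists_lt_of_lt_ciSup ha
    have h1 := (hratio (-(r₀ + c))).const_mul (g r₀)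
    rw [mul_one] at h1
    filter_upwards [h1.eventually_const_lt hr₀, eventually_gt_atTop (r₀ + c : ℝ)] with r hr hr'
    refine hr.trans_le ?_
    have h0 := r₀.2.out
    have h2 := hf r₀ (r - r₀ - c) h0 (by linarith)
    have hr0 : 0 < r := by linarith
    rw [show r - r₀ - c + r₀ + c = r by ring] at h2
    rw [div_pow, ← mul_div_assoc]
    refine div_le_div_of_nonneg_right ?_ (by positivity)
    rw [div_mul_eq_mul_div, div_le_iff₀ (hpos r₀), mul_comm (f r)]
    rwa [← sub_eq_add_neg, ← sub_sub]
  · have h1 := (hratio c).const_mul (⨆ r, g r)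
    rw [mul_one] at h1
    filter_upwards [h1.eventually_lt_const ha, eventually_gt_atTop 0] with r hr hr'
    refine lt_of_le_of_lt ?_ hr
    rw [div_pow, ← mul_div_assoc]
    refine div_le_div_of_nonneg_right ?_ (by positivity)
    rw [← div_le_iff₀ (hpos ⟨r, hr'.le⟩)]
    exact le_ciSup hbdd ⟨r, hr'.le⟩

lemma tendsto_div_pow_comp_affine {d : ℕ} {f : ℝ → ℝ} {m a : ℝ}
    (hf : Tendsto (fun r => f r / r ^ d) atTop (nhds m)) (ha : 0 < a) (c : ℝ) :
    Tendsto (fun r => f (a * r + c) / r ^ d) atTop (nhds (m * a ^ d)) := by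
  have h0 : Tendsto (fun r : ℝ => a * r + c) atTop atTop :=
    tendsto_atTop_add_const_right _ _ (tendsto_id.const_mul_atTop ha)
  have h1 : Tendsto (fun r : ℝ => a + c / r) atTop (nhds (a + 0)) :=
    tendsto_const_nhds.add (tendsto_const_nhds.div_atTop tendsto_id)
  rw [add_zero] at h1
  refine ((hf.comp h0).mul (h1.pow d)).congr' ?_
  filter_upwards [eventually_gt_atTop 0, h0.eventually_gt_atTop 0] with r hr hr'
  rw [Function.comp, show a + c / r = (a * r + c) / r by field_simp, div_pow]
  field_simp

section density

variable {d : ℕ} {K : Set (Euc d)} {x₀ : Euc d} {ρ R : ℝ}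

lemma ncard_near_mono (h : BetweenBalls K x₀ ρ R) {T : Set (Placement d)}
    (hT : Separated K x₀ T) (p : Euc d) {r r' : ℝ} (hr : r ≤ r') :
    (near T p r).ncard ≤ (near T p r').ncard :=
  Set.ncard_le_ncard (fun _ ht => ⟨ht.1, ht.2.trans hr⟩) (finite_near h hT p r')

/-- Averaging a uniform lower bound on the number of placements over a large ball. -/
lemma mul_ballVol_le (h : BetweenBalls K x₀ ρ R) {T : Set (Placement d)}
    (hT : Separated K x₀ T) {k : ℕ} {r : ℝ} (hk : ∀ p, k ≤ (near T p r).ncard) (s : ℝ) :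
    k * ballVol d s ≤ ballVol d (r + 1) * (near T 0 (s + r)).ncard := by
  have hfin := finite_near h hT 0 (s + r)
  have h1 : ∫⁻ _ in ball (0 : Euc d) s, (k : ℝ≥0∞) ≤ ∫⁻ p : Euc d in ball 0 s,
      ∑ t ∈ hfin.toFinset, (ball t.2 (r + 1)).indicator 1 p := by
    refine setLIntegral_mono' measurableSet_ball fun p hp => ?_
    classical
    have h2 : near T p r ⊆ ↑(hfin.toFinset.filter fun t => p ∈ ball t.2 (r + 1)) := by
      intro t ht
      have h3 := ht.2
      rw [mem_ball] at hp
      rw [Finset.coe_filter]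
      refine ⟨hfin.mem_toFinset.2 ⟨ht.1, ?_⟩, ?_⟩
      · linarith [dist_triangle t.2 p 0]
      · rw [mem_ball, dist_comm]
        linarith
    have h3 := (hk p).trans (Set.ncard_le_ncard h2 (Finset.finite_toSet _))
    rw [Set.ncard_coe_finset, Finset.card_filter] at h3
    simp only [Set.indicator_apply, Pi.one_apply]
    exact_mod_cast h3
  have h2 : ∫⁻ p : Euc d in ball 0 s, ∑ t ∈ hfin.toFinset, (ball t.2 (r + 1)).indicator 1 p ≤
      ∑ t ∈ hfin.toFinset, volume (ball t.2 (r + 1)) := by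
    refine (setLIntegral_le_lintegral _ _).trans ?_
    rw [lintegral_finsetSum _ fun t _ => measurable_one.indicator measurableSet_ball]
    exact Finset.sum_le_sum fun t _ => by rw [lintegral_indicator_one measurableSet_ball]
  have h3 := h1.trans h2
  simp only [setLIntegral_const, volume_ball_eq, Finset.sum_const, nsmul_eq_mul] at h3
  rw [← Set.ncard_eq_toFinset_card _ hfin, ← ENNReal.ofReal_natCast, ← ENNReal.ofReal_natCast,
    ← ENNReal.ofReal_mul (by positivity), ← ENNReal.ofReal_mul (by positivity)] at h3
  rw [mul_comm (ballVol d (r + 1))]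
  exact (ENNReal.ofReal_le_ofReal_iff (mul_nonneg (by positivity) (ballVol_nonneg _))).1 h3

lemma exists_tendsto_ncard_near (h : BetweenBalls K x₀ ρ R) {T : Set (Placement d)}
    (hT : Separated K x₀ T) (hmax : ∀ p q r, (near T p r).ncard ≤ (near T q (r + 2 * R)).ncard) :
    ∃ m, Tendsto (fun r => ((near T 0 r).ncard : ℝ) / r ^ d) atTop (nhds m) := by
  have hρ := h.pos
  have hR := h.pos_outer
  have h1 : 0 < ballVol d 1 := ballVol_pos one_pos
  refine exists_tendsto_div_pow (B := ((ρ / 2) ^ d)⁻¹) (c := ρ / 2 + 2 * R + 1) (by positivity)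
    (fun r hr => ?_) fun r s hr hs => ?_
  · have h2 := ncard_near_mul_le h hT 0 r
    rw [ballVol_eq (half_pos hρ), ballVol_eq (r := r + ρ / 2) (by positivity), ← mul_assoc,
      mul_le_mul_iff_left₀ h1] at h2
    rw [inv_mul_eq_div, le_div_iff₀ (by positivity)]
    refine h2.trans (pow_le_pow_left₀ (by positivity) ?_ _)
    linarith
  · have h2 : (near T 0 r).ncard * s ^ d ≤
        (r + 2 * R + 1) ^ d * ((near T 0 (s + (r + 2 * R))).ncard : ℝ) := by
      rcases hs.eq_or_lt with rfl | hs
      · rcases eq_or_ne d 0 with rfl | hd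
        · simpa using hmax 0 0 r
        · rw [zero_pow hd, mul_zero]
          positivity
      · have h2 := mul_ballVol_le h hT (fun p => hmax 0 p r) s
        rw [ballVol_eq hs, ballVol_eq (r := r + 2 * R + 1) (by positivity)] at h2
        refine le_of_mul_le_mul_right ?_ h1
        linarith
    refine h2.trans ?_
    refine mul_le_mul (pow_le_pow_left₀ (by positivity) (by linarith) _)
      (Nat.cast_le.2 (ncard_near_mono h hT 0 (by linarith))) (by positivity) (by positivity)

lemma tsum_volume_inter_ball (h : BetweenBalls K x₀ ρ R) {T : Set (Placement d)}
    (hT : Separated K x₀ T) (p : Euc d) (r : ℝ) :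
    ∑' D : placed K x₀ '' T, volume ((D : Set (Euc d)) ∩ ball p r) =
      ∑ t ∈ (finite_near h hT p (r + R)).toFinset, volume (placed K x₀ t ∩ ball p r) := by
  rw [tsum_image (fun D => volume (D ∩ ball p r)) (h.injOn_placed hT),
    tsum_subtype T fun t => volume (placed K x₀ t ∩ ball p r),
    tsum_eq_sum (s := (finite_near h hT p (r + R)).toFinset)]
  · exact Finset.sum_congr rfl fun t ht =>
      Set.indicator_of_mem ((Set.Finite.mem_toFinset _).1 ht).1 _
  · intro t ht
    rw [Set.indicator_apply_eq_zero]
    intro htT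
    have : placed K x₀ t ∩ ball p r = ∅ := by
      by_contra hne
      obtain ⟨y, hy, hy'⟩ := Set.nonempty_iff_ne_empty.2 hne
      refine ht ((Set.Finite.mem_toFinset _).2 ⟨htT, ?_⟩)
      have h1 := h.placed_subset_ball t hy
      rw [mem_ball] at h1 hy'
      linarith [dist_triangle_left t.2 p y]
    rw [this, measure_empty]

lemma ballFrac_le (h : BetweenBalls K x₀ ρ R) {T : Set (Placement d)} (hT : Separated K x₀ T)
    (p : Euc d) (r : ℝ) : ballFrac (placed K x₀ '' T) p r ≤
      (volume K).toReal * (near T p (r + R)).ncard / ballVol d r := by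
  have hfin := finite_near h hT p (r + R)
  have hV := h.isCompact.measure_lt_top (μ := volume)
  rw [ballFrac, ENNReal.toReal_div, tsum_volume_inter_ball h hT, volume_ball_eq,
    ENNReal.toReal_ofReal (ballVol_nonneg _)]
  refine div_le_div_of_nonneg_right ?_ (ballVol_nonneg _)
  have h1 : ∑ t ∈ hfin.toFinset, volume (placed K x₀ t ∩ ball p r) ≤
      ∑ t ∈ hfin.toFinset, volume K := Finset.sum_le_sum fun t _ =>
    (measure_mono Set.inter_subset_left).trans_eq (volume_placed t h.isCompact)
  rw [Finset.sum_const, nsmul_eq_mul, ← Set.ncard_eq_toFinset_card _ hfin] at h1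
  have h2 := ENNReal.toReal_mono (ENNReal.mul_ne_top (by simp) hV.ne) h1
  rwa [ENNReal.toReal_mul, ENNReal.toReal_natCast, mul_comm] at h2

lemma le_ballFrac (h : BetweenBalls K x₀ ρ R) {T : Set (Placement d)} (hT : Separated K x₀ T)
    (p : Euc d) (r : ℝ) : (volume K).toReal * (near T p (r - R)).ncard / ballVol d r ≤
      ballFrac (placed K x₀ '' T) p r := by
  have hfin := finite_near h hT p (r - R)
  have hR := h.pos_outer
  rw [ballFrac, ENNReal.toReal_div, tsum_volume_inter_ball h hT, volume_ball_eq,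
    ENNReal.toReal_ofReal (ballVol_nonneg _)]
  refine div_le_div_of_nonneg_right ?_ (ballVol_nonneg _)
  have h1 : ∑ t ∈ hfin.toFinset, volume K ≤
      ∑ t ∈ (finite_near h hT p (r + R)).toFinset, volume (placed K x₀ t ∩ ball p r) := by
    refine le_trans (Finset.sum_le_sum fun t ht => ?_) (Finset.sum_le_sum_of_subset ?_)
    · rw [Set.inter_eq_left.2, volume_placed t h.isCompact]
      refine (h.placed_subset_ball t).trans (ball_subset_ball' ?_)
      linarith [(hfin.mem_toFinset.1 ht).2]
    · rw [Set.Finite.toFinset_subset_toFinset]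
      exact fun t ht => ⟨ht.1, by linarith [ht.2]⟩
  rw [Finset.sum_const, nsmul_eq_mul, ← Set.ncard_eq_toFinset_card _ hfin] at h1
  have h2 := ENNReal.toReal_mono (ENNReal.sum_ne_top.2 fun t _ =>
    ((measure_mono Set.inter_subset_right).trans_lt measure_ball_lt_top).ne) h1
  rwa [ENNReal.toReal_mul, ENNReal.toReal_natCast, mul_comm] at h2

/-- A placement set whose potentials dominate those of `T₀` contains, up to a small error, at least
as many placements in a slightly larger ball. -/
lemma exists_ncard_near_le_add (h : BetweenBalls K x₀ ρ R) {T₀ T : Set (Placement d)}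
    (hT₀ : Separated K x₀ T₀) (hT : Separated K x₀ T) {lam : ℝ} (hlam : 0 < lam)
    (hdom : ∀ q r, potential lam q r T₀ ≤ potential lam q r T) {η : ℝ} (hη : 0 < η) :
    ∃ C, 0 ≤ C ∧ ∀ q r, 0 ≤ r → ((near T₀ q r).ncard : ℝ) ≤
      (near T q ((1 + η) * r)).ncard + C * Real.exp (-(lam * η / 2) * r) := by
  have hη1 : 0 < 1 + η := by linarith
  obtain ⟨C, hC⟩ := exists_tsum_exp_le h (lam := lam * η / (2 * (1 + η))) (by positivity)
  refine ⟨max C 0, le_max_right _ _, fun q r hr => ?_⟩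
  have hfin₀ := finite_near h hT₀ q r
  have hfin := finite_near h hT q ((1 + η) * r)
  have h1 : ((near T₀ q r).ncard : ℝ≥0∞) ≤ potential lam q r T₀ := by
    rw [potential, tsum_subtype T₀ fun t => ENNReal.ofReal (weight lam q r t.2)]
    refine le_trans ?_ (ENNReal.sum_le_tsum hfin₀.toFinset)
    rw [Set.ncard_eq_toFinset_card _ hfin₀, Finset.card_eq_sum_ones, Nat.cast_sum]
    refine Finset.sum_le_sum fun t ht => ?_
    have ht' := hfin₀.mem_toFinset.1 ht
    rw [Set.indicator_of_mem ht'.1, weight, max_eq_right (by linarith [ht'.2])]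
    simp
  have h2 : potential lam q r T ≤ (near T q ((1 + η) * r)).ncard +
      ENNReal.ofReal (Real.exp (-(lam * η / 2) * r)) * ENNReal.ofReal C := by
    have hpt : ∀ t : T, ENNReal.ofReal (weight lam q r t.1.2) ≤
        (near T q ((1 + η) * r)).indicator 1 t.1 +
        ENNReal.ofReal (Real.exp (-(lam * η / 2) * r)) *
          ENNReal.ofReal (Real.exp (-(lam * η / (2 * (1 + η))) * dist t.1.2 q)) := fun t => by
      by_cases ht : dist t.1.2 q ≤ (1 + η) * r
      · rw [Set.indicator_of_mem (show t.1 ∈ near T q ((1 + η) * r) from ⟨t.2, ht⟩)]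
        refine le_trans ?_ le_self_add
        rw [Pi.one_apply, ENNReal.ofReal_le_one, weight, Real.exp_le_one_iff]
        nlinarith [le_max_right (dist t.1.2 q - r) 0]
      · refine le_trans ?_ le_add_self
        rw [← ENNReal.ofReal_mul (Real.exp_pos _).le, ← Real.exp_add, weight]
        refine ENNReal.ofReal_le_ofReal (Real.exp_le_exp.2 ?_)
        have h3 := le_max_left (dist t.1.2 q - r) 0
        have h4 : lam * η / (2 * (1 + η)) * dist t.1.2 q ≤ lam * (dist t.1.2 q - r) -
            lam * η / 2 * r := by
          rw [div_mul_eq_mul_div, div_le_iff₀ (by positivity)]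
          push Not at ht
          have h5 := mul_pos hlam (mul_pos (by linarith : 0 < η + 2) (sub_pos.2 ht))
          nlinarith
        nlinarith
    refine (ENNReal.tsum_le_tsum hpt).trans ?_
    rw [ENNReal.tsum_add, ENNReal.tsum_mul_left]
    gcongr
    · rw [tsum_subtype T fun t => (near T q ((1 + η) * r)).indicator 1 t,
        tsum_eq_sum (s := hfin.toFinset), Set.ncard_eq_toFinset_card _ hfin,
        Finset.card_eq_sum_ones, Nat.cast_sum]
      · refine Finset.sum_le_sum fun t _ => (Set.indicator_le_self _ _ t).trans ?_
        refine (Set.indicator_le_self _ _ t).trans ?_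
        simp
      · intro t ht
        rw [Set.indicator_apply_eq_zero]
        exact fun _ => Set.indicator_of_notMem (fun ht' => ht (hfin.mem_toFinset.2 ht')) _
    · exact hC T hT q
  have h3 := (h1.trans (hdom q r)).trans h2
  rw [← ENNReal.ofReal_mul (Real.exp_pos _).le, ← ENNReal.ofReal_natCast,
    ← ENNReal.ofReal_natCast] at h3
  have h4 : ENNReal.ofReal (Real.exp (-(lam * η / 2) * r) * C) ≤
      ENNReal.ofReal (max C 0 * Real.exp (-(lam * η / 2) * r)) := by
    rw [mul_comm]
    exact ENNReal.ofReal_le_ofReal (mul_le_mul_of_nonneg_right (le_max_left _ _)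
      (Real.exp_pos _).le)
  have h5 := h3.trans (add_le_add_right h4 _)
  have h6 : 0 ≤ max C 0 * Real.exp (-(lam * η / 2) * r) := by positivity
  rw [← ENNReal.ofReal_add (by positivity) h6] at h5
  exact (ENNReal.ofReal_le_ofReal_iff (by positivity)).1 h5

end density

section uniform

variable {d : ℕ} {K : Set (Euc d)} {x₀ : Euc d} {ρ R : ℝ}

lemma eventually_lt_ballFrac (h : BetweenBalls K x₀ ρ R) {T₀ T : Set (Placement d)}
    (hT₀ : Separated K x₀ T₀) (hT : Separated K x₀ T)
    (hmax : ∀ p q r, (near T₀ p r).ncard ≤ (near T₀ q (r + 2 * R)).ncard)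
    {lam : ℝ} (hlam : 0 < lam) (hdom : ∀ q r, potential lam q r T₀ ≤ potential lam q r T)
    {m : ℝ} (hm : Tendsto (fun r => ((near T₀ 0 r).ncard : ℝ) / r ^ d) atTop (nhds m))
    {a : ℝ} (ha : a < (volume K).toReal * m / ballVol d 1) :
    ∀ᶠ r in atTop, ∀ p, a < ballFrac (placed K x₀ '' T) p r := by
  have hb : 0 < ballVol d 1 := ballVol_pos one_pos
  obtain ⟨η, hηa, hη⟩ : ∃ η : ℝ, a < (volume K).toReal * (m * ((1 + η)⁻¹) ^ d) / ballVol d 1 ∧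
      0 < η := by
    have hc : ContinuousAt (fun η : ℝ => (volume K).toReal * (m * ((1 + η)⁻¹) ^ d) /
        ballVol d 1) 0 := by
      have : (1 : ℝ) + 0 ≠ 0 := by norm_num
      fun_prop (disch := assumption)
    have h1 : ∀ᶠ η in nhds (0 : ℝ),
        a < (volume K).toReal * (m * ((1 + η)⁻¹) ^ d) / ballVol d 1 :=
      hc.eventually_const_lt (by simpa using ha)
    exact ((h1.filter_mono nhdsWithin_le_nhds).and (self_mem_nhdsWithin (s := Set.Ioi 0))).exists
  have hη1 : 0 < (1 + η)⁻¹ := by positivity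
  obtain ⟨C, hC0, hC⟩ := exists_ncard_near_le_add h hT₀ hT hlam hdom hη
  have h1 := tendsto_div_pow_comp_affine hm hη1 (-((1 + η)⁻¹ * R) - 2 * R)
  have h2 : Tendsto (fun r : ℝ => C * Real.exp (-(lam * η / 2) * ((1 + η)⁻¹ * (r - R))))
      atTop (nhds (C * 0)) := by
    refine (Real.tendsto_exp_atBot.comp ?_).const_mul C
    refine Tendsto.const_mul_atTop_of_neg (by simp; positivity) ?_
    exact (tendsto_atTop_add_const_right _ (-R) tendsto_id).const_mul_atTop hη1
  have h3 := ((h1.sub h2).const_mul (volume K).toReal).div_const (ballVol d 1)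
  rw [mul_zero, sub_zero] at h3
  filter_upwards [h3.eventually_const_lt hηa, eventually_ge_atTop 1, eventually_ge_atTop R]
    with r hr hr1 hrR p
  have hr0 : 0 < r := by linarith
  have hpow : 1 ≤ r ^ d := one_le_pow₀ hr1
  refine hr.trans_le (le_trans ?_ (le_ballFrac h hT p r))
  rw [ballVol_eq hr0, ← div_div]
  refine div_le_div_of_nonneg_right ?_ hb.le
  rw [mul_div_assoc (volume K).toReal]
  refine mul_le_mul_of_nonneg_left ?_ ENNReal.toReal_nonneg
  have h4 := hC p ((1 + η)⁻¹ * (r - R)) (mul_nonneg hη1.le (by linarith))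
  rw [mul_inv_cancel_left₀ (by positivity)] at h4
  have h5 := hmax 0 p ((1 + η)⁻¹ * r + (-((1 + η)⁻¹ * R) - 2 * R))
  rw [show (1 + η)⁻¹ * r + (-((1 + η)⁻¹ * R) - 2 * R) + 2 * R = (1 + η)⁻¹ * (r - R) by ring] at h5
  have h6 := (Nat.cast_le (α := ℝ).2 h5).trans h4
  have h7 := div_le_div_of_nonneg_right h6 (zero_le_one.trans hpow)
  rw [add_div] at h7
  have h8 := div_le_self (mul_nonneg hC0
    (Real.exp_pos (-(lam * η / 2) * ((1 + η)⁻¹ * (r - R)))).le) hpow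
  linarith

lemma eventually_ballFrac_lt (h : BetweenBalls K x₀ ρ R) {f : ℝ → ℝ} {m : ℝ}
    (hm : Tendsto (fun r => f r / r ^ d) atTop (nhds m))
    {a : ℝ} (ha : (volume K).toReal * m / ballVol d 1 < a) :
    ∀ᶠ r in atTop, ∀ T, Separated K x₀ T → (∀ p r, (near T p r).ncard ≤ f (r + 2 * R)) →
      ∀ p, ballFrac (placed K x₀ '' T) p r < a := by
  have hb : 0 < ballVol d 1 := ballVol_pos one_pos
  have h1 := ((tendsto_div_pow_comp_affine hm one_pos (R + 2 * R)).const_mul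
    (volume K).toReal).div_const (ballVol d 1)
  rw [one_pow, mul_one] at h1
  filter_upwards [h1.eventually_lt_const ha, eventually_gt_atTop 0] with r hr hr0 T hT hTf p
  refine lt_of_le_of_lt ((ballFrac_le h hT p r).trans ?_) hr
  rw [ballVol_eq hr0, ← div_div, one_mul, mul_div_assoc]
  refine div_le_div_of_nonneg_right (mul_le_mul_of_nonneg_left ?_ ENNReal.toReal_nonneg) hb.le
  refine div_le_div_of_nonneg_right ?_ (by positivity)
  rw [← add_assoc]
  exact hTf p (r + R)

lemma HasUniformDensity.hasDensity {P : Set (Set (Euc d))} {δ : ℝ} (hP : HasUniformDensity P δ) :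
    HasDensity P δ :=
  fun p => hP.tendsto_at p

/-- A packing whose potentials dominate those of a locally maximal packing is uniformly dense. -/
theorem hasUniformDensity_of_potential_le (h : BetweenBalls K x₀ ρ R) {T₀ T : Set (Placement d)}
    (hT₀ : Separated K x₀ T₀) (hT : Separated K x₀ T)
    (hmax : ∀ T', Separated K x₀ T' → ∀ p q r,
      (near T' p r).ncard ≤ (near T₀ q (r + 2 * R)).ncard)
    {lam : ℝ} (hlam : 0 < lam) (hdom : ∀ q r, potential lam q r T₀ ≤ potential lam q r T) :
    HasUniformDensity (placed K x₀ '' T) (packingDensity K) := by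
  obtain ⟨m, hm⟩ := exists_tendsto_ncard_near h hT₀ (hmax T₀ hT₀)
  have hle : ∀ T', Separated K x₀ T' → ∀ p r,
      ((near T' p r).ncard : ℝ) ≤ (near T₀ 0 (r + 2 * R)).ncard :=
    fun T' hT' p r => Nat.cast_le.2 (hmax T' hT' p 0 r)
  have hunif : HasUniformDensity (placed K x₀ '' T) ((volume K).toReal * m / ballVol d 1) := by
    refine Metric.tendstoUniformly_iff.2 fun ε hε => ?_
    filter_upwards [eventually_lt_ballFrac h hT₀ hT (hmax T₀ hT₀) hlam hdom hm
      (sub_lt_self _ hε), eventually_ballFrac_lt h hm (lt_add_of_pos_right _ hε)] with r h1 h2 p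
    rw [dist_comm, Real.dist_eq, abs_sub_lt_iff]
    constructor
    · linarith [h2 T hT (hle T hT) p]
    · linarith [h1 p]
  have hgreatest : IsGreatest {δ : ℝ | ∃ P, IsPacking K P ∧ HasDensity P δ}
      ((volume K).toReal * m / ballVol d 1) := by
    refine ⟨⟨_, hT.isPacking_image, hunif.hasDensity⟩, ?_⟩
    rintro δ ⟨P, hP, hδ⟩
    obtain ⟨T', hT', rfl⟩ := hP.exists_separated x₀
    refine le_of_forall_gt fun a ha => ?_
    obtain ⟨b, hb, hba⟩ := exists_between ha
    refine lt_of_le_of_lt (le_of_tendsto (hδ 0) ?_) hba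
    filter_upwards [eventually_ballFrac_lt h hm hb] with r hr
    exact (hr T' hT' (hle T' hT') 0).le
  rwa [packingDensity, hgreatest.csSup_eq]

end uniform

lemma exists_pos_mul_exp_lt {n : ℕ} (c : ℝ) : ∃ lam : ℝ, 0 < lam ∧
    n * Real.exp (lam * c) < n + 1 := by
  have hc : ContinuousAt (fun lam : ℝ => n * Real.exp (lam * c)) 0 := by fun_prop
  have h1 : ∀ᶠ lam in nhds (0 : ℝ), n * Real.exp (lam * c) < n + 1 :=
    hc.eventually_lt_const (by simp)
  obtain ⟨lam, h2, h3⟩ :=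
    ((h1.filter_mono nhdsWithin_le_nhds).and (self_mem_nhdsWithin (s := Set.Ioi 0))).exists
  exact ⟨lam, h3, h2⟩

lemma IsBody.exists_betweenBalls {d : ℕ} {K : Set (Euc d)} (hK : IsBody K) (hne : K.Nonempty) :
    ∃ x₀ ρ R, BetweenBalls K x₀ ρ R := by
  have hint : (interior K).Nonempty := by
    rw [hK.2] at hne
    exact closure_nonempty_iff.1 hne
  obtain ⟨x₀, hx₀⟩ := hint
  obtain ⟨ρ, hρ, hball⟩ := Metric.isOpen_iff.1 isOpen_interior x₀ hx₀
  obtain ⟨R, hR⟩ := hK.1.isBounded.subset_ball x₀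
  exact ⟨x₀, ρ, R, ⟨hK.1, hρ, hball.trans interior_subset, hR⟩⟩

lemma IsIsomCopy.eq_empty {d : ℕ} {D : Set (Euc d)} (h : IsIsomCopy ∅ D) : D = ∅ := by
  obtain ⟨f, rfl⟩ := h
  exact Set.image_empty f

lemma ballFrac_of_isPacking_empty {d : ℕ} {P : Set (Set (Euc d))} (hP : IsPacking ∅ P)
    (p : Euc d) (r : ℝ) : ballFrac P p r = 0 := by
  have h1 : ∀ D : P, volume ((D : Set (Euc d)) ∩ ball p r) = 0 := fun D => by
    rw [(hP.1 D D.2).eq_empty, Set.empty_inter, measure_empty]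
  simp [ballFrac, h1]

lemma isPacking_singleton {d : ℕ} (K : Set (Euc d)) : IsPacking K {K} :=
  ⟨fun D hD => ⟨IsometryEquiv.refl _, by
    rw [Set.mem_singleton_iff.1 hD]
    exact (Set.image_id K).symm⟩, Set.pairwise_singleton _ _⟩

lemma saturated_empty {d n : ℕ} (hn : 0 < n) : Saturated (∅ : Set (Euc d)) n {∅} := by
  rintro ⟨F, G, hF, hFn, hGn, hdisj, hpack⟩
  have hG : G ⊆ {∅} := fun D hD => by
    rw [Finset.mem_singleton]
    exact (hpack.1 D (Or.inr hD)).eq_empty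
  have hG1 : n ≤ 1 := hGn ▸ Finset.card_le_card hG
  obtain rfl : n = 1 := by omega
  have hF0 : F = ∅ := Finset.card_eq_zero.1 hFn
  have hG2 : G = {∅} := Finset.eq_of_subset_of_card_le hG (by simp [hGn])
  subst hF0 hG2
  simp at hdisj

lemma hasUniformDensity_packingDensity_empty {d : ℕ} :
    HasUniformDensity ({∅} : Set (Set (Euc d))) (packingDensity (∅ : Set (Euc d))) := by
  have hzero : ∀ P : Set (Set (Euc d)), IsPacking ∅ P → HasUniformDensity P 0 := fun P hP => by
    simp only [HasUniformDensity, ballFrac_of_isPacking_empty hP]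
    exact Metric.tendstoUniformly_iff.2 fun ε hε => Eventually.of_forall fun _ _ => by simpa
  have hset : {δ : ℝ | ∃ P, IsPacking (∅ : Set (Euc d)) P ∧ HasDensity P δ} = {0} := by
    ext δ
    constructor
    · rintro ⟨P, hP, hδ⟩
      exact tendsto_nhds_unique (hδ 0) ((hzero P hP).hasDensity 0)
    · rintro rfl
      exact ⟨_, isPacking_singleton ∅, (hzero _ (isPacking_singleton ∅)).hasDensity⟩
  rw [packingDensity, hset, csSup_singleton]
  exact hzero _ (isPacking_singleton ∅)

/-- For every positive integer `n`, every body `K` in `ℝ^d` has a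
packing that is simultaneously `n`-saturated and uniformly dense. -/
theorem exists_n_saturated_uniformly_dense_packing {d : ℕ} (n : ℕ) (hn : 0 < n)
    (K : Set (Euc d)) (hK : IsBody K) :
    ∃ P : Set (Set (Euc d)), IsPacking K P ∧ Saturated K n P ∧
      HasUniformDensity P (packingDensity K) := by
  rcases K.eq_empty_or_nonempty with rfl | hne
  · exact ⟨{∅}, isPacking_singleton ∅, saturated_empty hn, hasUniformDensity_packingDensity_empty⟩
  obtain ⟨x₀, ρ, R, h⟩ := hK.exists_betweenBalls hne
  obtain ⟨lam, hlam, hΔ⟩ := exists_pos_mul_exp_lt (n := n) (2 * n * (2 * R))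
  obtain ⟨T₀, hT₀, hmax₀⟩ := exists_locally_maximal h
  obtain ⟨T, hT, hdom, hmax⟩ := exists_potential_maximal h hlam hT₀
  exact ⟨placed K x₀ '' T, hT.isPacking_image, saturated_of_potential_maximal h hn hlam hΔ hT hmax,
    hasUniformDensity_of_potential_le h hT₀ hT
      (fun T' hT' p q r => ncard_near_le_of_locally_maximal h hmax₀ hT' p q r) hlam hdom⟩
end
end
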